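/- Assume the inverse temperature sequence (β_N)_{N≥1} with β_N ∈ (0,1) satisfies lim_{N→∞} β_N = 1 and lim_{N→∞} N^{1/3}(1 − β_N²) = c where c ∈ (0,∞) or c = ∞. Define ν(β) = −(1/2)·ln(1 − β²) − β²/2 for β < 1. Then there exists a finite constant L (depending on the sequence (β_N)) such that for all N ≥ 1, |Var(F_N(β_N)) − ν(β_N)| ≤ L·(N^{1/3}(1 − β_N²))^{−3/2}. -/

import Mathlib

open MeasureTheory ProbabilityTheory Real Finset Filter

noncomputable section

/-- Spin configurations: each of the `N` sites carries a `±1` spin, encoded by a `Bool`. -/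
abbrev Config (N : ℕ) := Fin N → Bool

/-- The `±1` value of a spin. -/
def spin (b : Bool) : ℝ := if b then 1 else -1

/-- The value of the last spin `σ_N` (junk value `0` when `N = 0`). -/
def spinLast {N : ℕ} (σ : Config N) : ℝ :=
  if h : 0 < N then spin (σ ⟨N - 1, Nat.sub_lt h Nat.one_pos⟩) else 0

/-- The Gaussian disorder: i.i.d. standard Gaussians indexed by pairs `(i, j)`
(only the entries with `i < j` are used). -/
def gaussPi (N : ℕ) : Measure (Fin N × Fin N → ℝ) :=
  Measure.pi fun _ => gaussianReal 0 1

instance (N : ℕ) : IsProbabilityMeasure (gaussPi N) := by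
  unfold gaussPi; infer_instance

/-- Three independent copies `g, g', g''` of the disorder. -/
def disM3 (N : ℕ) :
    Measure ((Fin N × Fin N → ℝ) × (Fin N × Fin N → ℝ) × (Fin N × Fin N → ℝ)) :=
  (gaussPi N).prod ((gaussPi N).prod (gaussPi N))

/-- The SK Hamiltonian `H_{N,β}(σ) = (β/√N) ∑_{i<j} g_{ij} σ_i σ_j`. -/
def ham (N : ℕ) (β : ℝ) (g : Fin N × Fin N → ℝ) (σ : Config N) : ℝ :=
  (β / Real.sqrt N) *
    ∑ p ∈ Finset.univ.filter (fun p : Fin N × Fin N => p.1 < p.2),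
      g p * spin (σ p.1) * spin (σ p.2)

/-- The cavity Hamiltonian `H⁻_N(σ) = (β/√N) ∑_{i<j<N} g_{ij} σ_i σ_j` on the first
`N - 1` spins. -/
def hamCav (N : ℕ) (β : ℝ) (g : Fin N × Fin N → ℝ) (σ : Config N) : ℝ :=
  (β / Real.sqrt N) *
    ∑ p ∈ Finset.univ.filter
        (fun p : Fin N × Fin N => p.1 < p.2 ∧ (p.2 : ℕ) < N - 1),
      g p * spin (σ p.1) * spin (σ p.2)

/-- The overlap `R(σ¹,σ²) = (1/N) ∑_{i ≤ N} σ_i¹ σ_i²`. -/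
def ovlp (N : ℕ) (σ τ : Config N) : ℝ := (∑ i, spin (σ i) * spin (τ i)) / N

/-- The truncated overlap `R⁻(σ¹,σ²) = (1/N) ∑_{i ≤ N−1} σ_i¹ σ_i²`. -/
def ovlpm (N : ℕ) (σ τ : Config N) : ℝ :=
  (∑ i ∈ Finset.univ.filter (fun i : Fin N => (i : ℕ) < N - 1),
    spin (σ i) * spin (τ i)) / N

/-- The partition function `Z_N(β)`. -/
def partFun (N : ℕ) (β : ℝ) (g : Fin N × Fin N → ℝ) : ℝ :=
  ∑ σ : Config N, Real.exp (ham N β g σ)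

/-- The free energy `F_N(β) = ln Z_N(β)`. -/
def freeEnergy (N : ℕ) (β : ℝ) (g : Fin N × Fin N → ℝ) : ℝ :=
  Real.log (partFun N β g)

/-- Two-replica Gibbs average `⟨f⟩` for the single SK system. -/
def gibbs2 (N : ℕ) (β : ℝ) (g : Fin N × Fin N → ℝ)
    (f : Config N → Config N → ℝ) : ℝ :=
  (∑ σ : Config N, ∑ τ : Config N,
    f σ τ * Real.exp (ham N β g σ + ham N β g τ)) / (partFun N β g) ^ 2

/-- Disorder expectation of the two-replica Gibbs average. -/
def Egibbs2 (N : ℕ) (β : ℝ) (f : Config N → Config N → ℝ) : ℝ :=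
  ∫ g, gibbs2 N β g f ∂gaussPi N

/-- The interpolated Hamiltonian `√t · H_N + √(1−t) · H'_N`. -/
def hamT (N : ℕ) (β t : ℝ) (g g' : Fin N × Fin N → ℝ) (σ : Config N) : ℝ :=
  Real.sqrt t * ham N β g σ + Real.sqrt (1 - t) * ham N β g' σ

/-- The coupled Gibbs weight `exp(H¹_{N,t}(σ) + H²_{N,t}(τ))`. -/
def wT (N : ℕ) (β t : ℝ) (g g' g'' : Fin N × Fin N → ℝ)
    (ρ : Config N × Config N) : ℝ :=
  Real.exp (hamT N β t g g' ρ.1 + hamT N β t g g'' ρ.2)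

/-- The coupled Gibbs average `⟨f⟩_t` of a function of one pair `(σ, τ)`. -/
def gibbsT (N : ℕ) (β t : ℝ) (g g' g'' : Fin N × Fin N → ℝ)
    (f : Config N × Config N → ℝ) : ℝ :=
  (∑ ρ : Config N × Config N, f ρ * wT N β t g g' g'' ρ) /
    (∑ ρ : Config N × Config N, wT N β t g g' g'' ρ)

/-- The coupled Gibbs average `⟨f⟩_t` of a function of two pairs. -/
def gibbsT2 (N : ℕ) (β t : ℝ) (g g' g'' : Fin N × Fin N → ℝ)
    (f : Config N × Config N → Config N × Config N → ℝ) : ℝ :=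
  (∑ ρ₁ : Config N × Config N, ∑ ρ₂ : Config N × Config N,
    f ρ₁ ρ₂ * wT N β t g g' g'' ρ₁ * wT N β t g g' g'' ρ₂) /
    (∑ ρ : Config N × Config N, wT N β t g g' g'' ρ) ^ 2

/-- Disorder expectation `E⟨f⟩_t` (one pair). -/
def EgibbsT (N : ℕ) (β t : ℝ) (f : Config N × Config N → ℝ) : ℝ :=
  ∫ ω, gibbsT N β t ω.1 ω.2.1 ω.2.2 f ∂disM3 N

/-- Disorder expectation `E⟨f⟩_t` (two pairs). -/
def EgibbsT2 (N : ℕ) (β t : ℝ)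
    (f : Config N × Config N → Config N × Config N → ℝ) : ℝ :=
  ∫ ω, gibbsT2 N β t ω.1 ω.2.1 ω.2.2 f ∂disM3 N

/-- The `s`-dependent cavity field term
`(β/√N) σ_N ∑_{i<N} (√t g_{iN} + √(1−t) g'_{iN}) σ_i`. -/
def cavField (N : ℕ) (β t : ℝ) (g g' : Fin N × Fin N → ℝ) (σ : Config N) : ℝ :=
  if h : 0 < N then
    (β / Real.sqrt N) * spin (σ ⟨N - 1, Nat.sub_lt h Nat.one_pos⟩) *
      ∑ i ∈ Finset.univ.filter (fun i : Fin N => (i : ℕ) < N - 1),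
        (Real.sqrt t * g (i, ⟨N - 1, Nat.sub_lt h Nat.one_pos⟩) +
          Real.sqrt (1 - t) * g' (i, ⟨N - 1, Nat.sub_lt h Nat.one_pos⟩)) * spin (σ i)
  else 0

/-- The cavity-interpolated Hamiltonian `H^1_{N,t,s}` (resp. `H^2_{N,t,s}` with `g''`). -/
def hamTS (N : ℕ) (β t s : ℝ) (g g' : Fin N × Fin N → ℝ) (σ : Config N) : ℝ :=
  Real.sqrt t * hamCav N β g σ + Real.sqrt (1 - t) * hamCav N β g' σ +
    Real.sqrt s * cavField N β t g g' σ

/-- The coupled cavity Gibbs weight `exp(H¹_{N,t,s}(σ) + H²_{N,t,s}(τ))`. -/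
def wTS (N : ℕ) (β t s : ℝ) (g g' g'' : Fin N × Fin N → ℝ)
    (ρ : Config N × Config N) : ℝ :=
  Real.exp (hamTS N β t s g g' ρ.1 + hamTS N β t s g g'' ρ.2)

/-- The coupled cavity Gibbs average `⟨f⟩_{t,s}` of a function of one pair. -/
def gibbsTS1 (N : ℕ) (β t s : ℝ) (g g' g'' : Fin N × Fin N → ℝ)
    (f : Config N × Config N → ℝ) : ℝ :=
  (∑ ρ : Config N × Config N, f ρ * wTS N β t s g g' g'' ρ) /
    (∑ ρ : Config N × Config N, wTS N β t s g g' g'' ρ)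

/-- The coupled cavity Gibbs average `⟨f⟩_{t,s}` of a function of two pairs. -/
def gibbsTS2 (N : ℕ) (β t s : ℝ) (g g' g'' : Fin N × Fin N → ℝ)
    (f : Config N × Config N → Config N × Config N → ℝ) : ℝ :=
  (∑ ρ₁ : Config N × Config N, ∑ ρ₂ : Config N × Config N,
    f ρ₁ ρ₂ * wTS N β t s g g' g'' ρ₁ * wTS N β t s g g' g'' ρ₂) /
    (∑ ρ : Config N × Config N, wTS N β t s g g' g'' ρ) ^ 2

/-- The coupled cavity Gibbs average `⟨f⟩_{t,s}` of a function of `n` pairs. -/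
def gibbsTSn (N : ℕ) (β t s : ℝ) (g g' g'' : Fin N × Fin N → ℝ) {n : ℕ}
    (f : (Fin n → Config N × Config N) → ℝ) : ℝ :=
  (∑ ρ : Fin n → Config N × Config N, f ρ * ∏ l, wTS N β t s g g' g'' (ρ l)) /
    (∑ ρ₀ : Config N × Config N, wTS N β t s g g' g'' ρ₀) ^ n

/-- Disorder expectation `E⟨f⟩_{t,s}` (one pair). -/
def EgibbsTS1 (N : ℕ) (β t s : ℝ) (f : Config N × Config N → ℝ) : ℝ :=
  ∫ ω, gibbsTS1 N β t s ω.1 ω.2.1 ω.2.2 f ∂disM3 N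

/-- Disorder expectation `E⟨f⟩_{t,s}` (two pairs). -/
def EgibbsTS2 (N : ℕ) (β t s : ℝ)
    (f : Config N × Config N → Config N × Config N → ℝ) : ℝ :=
  ∫ ω, gibbsTS2 N β t s ω.1 ω.2.1 ω.2.2 f ∂disM3 N

/-- Disorder expectation `E⟨f⟩_{t,s}` (`n` pairs). -/
def EgibbsTSn (N : ℕ) (β t s : ℝ) {n : ℕ}
    (f : (Fin n → Config N × Config N) → ℝ) : ℝ :=
  ∫ ω, gibbsTSn N β t s ω.1 ω.2.1 ω.2.2 f ∂disM3 N

/-- The covariance kernel `U(ρ, ρ')` of the `s`-part of the coupled cavity Hamiltonians. -/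
def Ufun (N : ℕ) (β t : ℝ) (ρ ρ' : Config N × Config N) : ℝ :=
  β ^ 2 / 2 * (spinLast ρ.1 * spinLast ρ'.1 * ovlpm N ρ.1 ρ'.1 +
      spinLast ρ.2 * spinLast ρ'.2 * ovlpm N ρ.2 ρ'.2) +
    β ^ 2 * t / 2 * (spinLast ρ.1 * spinLast ρ'.2 * ovlpm N ρ.1 ρ'.2 +
      spinLast ρ.2 * spinLast ρ'.1 * ovlpm N ρ.2 ρ'.1)

/-- `ν(β) = −(1/2)·ln(1 − β²) − β²/2`. -/
def nuSK (b : ℝ) : ℝ := -(1 / 2) * Real.log (1 - b ^ 2) - b ^ 2 / 2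

namespace SKVar

/-- The standard Gaussian measure on the line. -/
abbrev stdG : Measure ℝ := gaussianReal 0 1

lemma exp_mul_abs_le (K x : ℝ) : exp (K * |x|) ≤ exp (K * x) + exp (-K * x) := by
  rcases abs_cases x with ⟨h, _⟩ | ⟨h, _⟩
  · rw [h]; linarith [exp_pos (-K * x)]
  · rw [h]
    have : K * -x = -K * x := by ring
    rw [this]; linarith [exp_pos (K * x)]

lemma integrable_exp_abs (K : ℝ) : Integrable (fun x => exp (K * |x|)) stdG := by
  refine ((integrable_exp_mul_gaussianReal K).add (integrable_exp_mul_gaussianReal (-K))).mono'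
    (by fun_prop) (ae_of_all _ fun x => ?_)
  rw [norm_of_nonneg (exp_pos _).le]
  exact exp_mul_abs_le K x

lemma integral_exp_mul_stdG (t : ℝ) : ∫ x, exp (t * x) ∂stdG = exp (t ^ 2 / 2) := by
  have := mgf_gaussianReal (p := stdG) (X := id) (μ := 0) (v := 1) (by simp) t
  simpa [mgf] using this

lemma integrable_stdG_iff (f : ℝ → ℝ) :
    Integrable f stdG ↔ Integrable (fun x => gaussianPDFReal 0 1 x * f x) volume := by
  rw [stdG, gaussianReal_of_var_ne_zero _ one_ne_zero,
    integrable_withDensity_iff_integrable_smul' (measurable_gaussianPDF _ _)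
      (ae_of_all _ fun x => gaussianPDF_lt_top)]
  simp [toReal_gaussianPDF]

lemma hasDerivAt_gaussianPDFReal (x : ℝ) :
    HasDerivAt (gaussianPDFReal 0 1) (-(x * gaussianPDFReal 0 1 x)) x := by
  have h : HasDerivAt (fun x : ℝ => (√(2 * π * 1))⁻¹ * exp (-(x - 0) ^ 2 / (2 * 1)))
      ((√(2 * π * 1))⁻¹ * (exp (-(x - 0) ^ 2 / (2 * 1)) * (-x))) x := by
    refine HasDerivAt.const_mul _ (HasDerivAt.exp ?_)
    have := (((hasDerivAt_id x).sub_const 0).pow 2).neg.div_const (2 * 1)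
    refine this.congr_deriv ?_
    simp only [id]; ring
  have e : gaussianPDFReal 0 1 = fun x : ℝ => (√(2 * π * 1))⁻¹ * exp (-(x - 0) ^ 2 / (2 * 1)) := by
    ext y; simp [gaussianPDFReal]
  rw [e]
  convert h using 1
  ring

lemma integrable_of_le_exp_abs {G : ℝ → ℝ} {K : ℝ} (hG : AEStronglyMeasurable G stdG)
    (h : ∀ x, |G x| ≤ K * exp (K * |x|)) : Integrable G stdG :=
  ((integrable_exp_abs K).const_mul K).mono' hG (ae_of_all _ h)

/-- Gaussian integration by parts on the line. -/
lemma stein_line {G G' : ℝ → ℝ} {K : ℝ} (hd : ∀ x, HasDerivAt G (G' x) x)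
    (hG'm : Measurable G') (hG : ∀ x, |G x| ≤ K * exp (K * |x|))
    (hG' : ∀ x, |G' x| ≤ K * exp (K * |x|)) :
    ∫ x, x * G x ∂stdG = ∫ x, G' x ∂stdG := by
  have hGc : Continuous G := continuous_iff_continuousAt.2 fun x => (hd x).continuousAt
  have hK : 0 ≤ K := by
    have := (abs_nonneg _).trans (hG 0)
    simpa using this
  have i1 : Integrable G stdG := integrable_of_le_exp_abs hGc.aestronglyMeasurable hG
  have i2 : Integrable G' stdG := integrable_of_le_exp_abs hG'm.aestronglyMeasurable hG'
  have i3 : Integrable (fun x => x * G x) stdG := by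
    refine ((integrable_exp_abs (K + 1)).const_mul K).mono'
      (by fun_prop) (ae_of_all _ fun x => ?_)
    rw [norm_mul, norm_eq_abs, norm_eq_abs]
    calc |x| * |G x| ≤ exp |x| * (K * exp (K * |x|)) := by
          gcongr
          · linarith [add_one_le_exp |x|]
          · exact hG x
      _ = K * exp ((K + 1) * |x|) := by
          rw [add_mul, Real.exp_add, one_mul]; ring
  have key := integral_mul_deriv_eq_deriv_mul_of_integrable (u := G) (u' := G')
    (v := gaussianPDFReal 0 1) (v' := fun x => -(x * gaussianPDFReal 0 1 x))
    (fun x _ => hd x) (fun x _ => hasDerivAt_gaussianPDFReal x)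
    (by
      refine ((integrable_stdG_iff _).1 i3).neg.congr (ae_of_all _ fun x => ?_)
      simp; ring)
    (by
      refine ((integrable_stdG_iff _).1 i2).congr (ae_of_all _ fun x => ?_)
      simp; ring)
    (by
      refine ((integrable_stdG_iff _).1 i1).congr (ae_of_all _ fun x => ?_)
      simp; ring)
  rw [stdG, integral_gaussianReal_eq_integral_smul one_ne_zero,
    integral_gaussianReal_eq_integral_smul one_ne_zero]
  have e1 : ∫ x, gaussianPDFReal 0 1 x • (x * G x) =
      -∫ x, G x * -(x * gaussianPDFReal 0 1 x) := by
    rw [← integral_neg]; congr 1; ext x; simp; ring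
  rw [e1, key, neg_neg]
  congr 1; ext x; simp; ring

section Pi
variable {ι : Type*} [Fintype ι]

/-- Resampling one coordinate preserves a product measure. -/
lemma measurePreserving_update [DecidableEq ι] {α : Type*} [MeasurableSpace α] (ν : Measure α)
    [IsProbabilityMeasure ν] (p : ι) :
    MeasurePreserving (fun q : (ι → α) × α => Function.update q.1 p q.2)
      ((Measure.pi fun _ : ι => ν).prod ν) (Measure.pi fun _ : ι => ν) := by
  have hm : Measurable (fun q : (ι → α) × α => Function.update q.1 p q.2) := by
    refine measurable_pi_iff.2 fun i => ?_
    by_cases h : i = p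
    · subst h; simpa using measurable_snd
    · simp only [Function.update_of_ne h]; fun_prop
  refine ⟨hm, ?_⟩
  refine (Measure.pi_eq fun s hs => ?_).symm
  rw [Measure.map_apply hm (MeasurableSet.univ_pi hs)]
  have : (fun q : (ι → α) × α => Function.update q.1 p q.2) ⁻¹' (Set.univ.pi s) =
      (Set.univ.pi (Function.update s p Set.univ)) ×ˢ (s p) := by
    ext q
    simp only [Set.mem_preimage, Set.mem_pi, Set.mem_univ, true_implies, Set.mem_prod]
    constructor
    · intro h
      refine ⟨fun i => ?_, by simpa using h p⟩
      by_cases hi : i = p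
      · subst hi; simp
      · simpa [hi] using h i
    · rintro ⟨h1, h2⟩ i
      by_cases hi : i = p
      · subst hi; simpa using h2
      · simpa [hi] using h1 i
  rw [this, Measure.prod_prod, Measure.pi_pi, ← Finset.mul_prod_erase _ _ (Finset.mem_univ p),
    ← Finset.mul_prod_erase (a := p) (f := fun i => ν (s i)) _ (Finset.mem_univ p)]
  simp only [Function.update_self, measure_univ, one_mul]
  rw [mul_comm]
  congr 1
  refine Finset.prod_congr rfl fun i hi => ?_
  rw [Function.update_of_ne (Finset.ne_of_mem_erase hi)]

/-- Restricting to an injectively indexed family of coordinates preserves product measures. -/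
lemma measurePreserving_comp_injective {κ : Type*} [Fintype κ] {α : Type*} [MeasurableSpace α]
    (ν : Measure α) [IsProbabilityMeasure ν] {e : ι → κ} (he : Function.Injective e) :
    MeasurePreserving (fun ω : κ → α => ω ∘ e)
      (Measure.pi fun _ : κ => ν) (Measure.pi fun _ : ι => ν) := by
  classical
  have hm : Measurable (fun ω : κ → α => ω ∘ e) := by
    refine measurable_pi_iff.2 fun i => ?_
    exact measurable_pi_apply _
  refine ⟨hm, ?_⟩
  refine (Measure.pi_eq fun s hs => ?_).symm
  rw [Measure.map_apply hm (MeasurableSet.univ_pi hs)]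
  have : (fun ω : κ → α => ω ∘ e) ⁻¹' (Set.univ.pi s) =
      Set.univ.pi (fun k => if h : ∃ i, e i = k then s h.choose else Set.univ) := by
    ext ω
    simp only [Set.mem_preimage, Set.mem_pi, Set.mem_univ, true_implies, Function.comp]
    constructor
    · intro h k
      split_ifs with hk
      · have := h hk.choose
        rwa [hk.choose_spec] at this
      · trivial
    · intro h i
      have := h (e i)
      have hk : ∃ j, e j = e i := ⟨i, rfl⟩
      rw [dif_pos hk] at this
      rwa [he hk.choose_spec] at this
  rw [this, Measure.pi_pi]
  have : ∏ k, ν (if h : ∃ i, e i = k then s h.choose else Set.univ) =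
      ∏ k ∈ Finset.univ.image e, ν (if h : ∃ i, e i = k then s h.choose else Set.univ) := by
    symm
    refine Finset.prod_subset (Finset.subset_univ _) fun k _ hk => ?_
    have : ¬ ∃ i, e i = k := by simpa using hk
    rw [dif_neg this, measure_univ]
  rw [this, Finset.prod_image (fun a _ b _ h => he h)]
  refine Finset.prod_congr rfl fun i _ => ?_
  have hk : ∃ j, e j = e i := ⟨i, rfl⟩
  rw [dif_pos hk, he hk.choose_spec]

end Pi

lemma integral_comp_of_measurePreserving {α β : Type*} [MeasurableSpace α] [MeasurableSpace β]
    {μ : Measure α} {ν : Measure β} {f : α → β} (h : MeasurePreserving f μ ν) {g : β → ℝ}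
    (hg : AEStronglyMeasurable g ν) : ∫ x, g (f x) ∂μ = ∫ y, g y ∂ν := by
  rw [← h.map_eq, integral_map h.measurable.aemeasurable]
  rwa [h.map_eq]

/-- The standard Gaussian measure on the plane. -/
abbrev pairG : Measure (ℝ × ℝ) := stdG.prod stdG

section Pi
variable {ι : Type*} [Fintype ι]

/-- The `ℓ¹` size of a family of pairs. -/
def pairNorm (ω : ι → ℝ × ℝ) : ℝ := ∑ p, (|(ω p).1| + |(ω p).2|)

/-- First component field. -/
def fstF (ω : ι → ℝ × ℝ) : ι → ℝ := fun p => (ω p).1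

/-- The field at angle `θ` from the first component. -/
def rotF (θ : ℝ) (ω : ι → ℝ × ℝ) : ι → ℝ := fun p => cos θ * (ω p).1 + sin θ * (ω p).2

/-- The derivative of `rotF` in the angle. -/
def rotF' (θ : ℝ) (ω : ι → ℝ × ℝ) : ι → ℝ := fun p => -sin θ * (ω p).1 + cos θ * (ω p).2

@[fun_prop] lemma continuous_fstF : Continuous (fstF (ι := ι)) := by
  unfold fstF; fun_prop

@[fun_prop] lemma continuous_rotF (θ : ℝ) : Continuous (rotF (ι := ι) θ) := by
  unfold rotF; fun_prop

@[fun_prop] lemma continuous_rotF' (θ : ℝ) : Continuous (rotF' (ι := ι) θ) := by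
  unfold rotF'; fun_prop

lemma pairNorm_nonneg (ω : ι → ℝ × ℝ) : 0 ≤ pairNorm ω :=
  Finset.sum_nonneg fun _ _ => by positivity

lemma sum_abs_fstF_le (ω : ι → ℝ × ℝ) : ∑ p, |fstF ω p| ≤ pairNorm ω :=
  Finset.sum_le_sum fun p _ => by
    simp only [fstF]; linarith [abs_nonneg (ω p).2]

lemma abs_mul_add_mul_le {c s : ℝ} (hc : |c| ≤ 1) (hs : |s| ≤ 1) (x z : ℝ) :
    |c * x + s * z| ≤ |x| + |z| := by
  refine (abs_add_le _ _).trans ?_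
  rw [abs_mul, abs_mul]
  gcongr
  · exact mul_le_of_le_one_left (abs_nonneg _) hc
  · exact mul_le_of_le_one_left (abs_nonneg _) hs

lemma sum_abs_rotF_le (θ : ℝ) (ω : ι → ℝ × ℝ) : ∑ p, |rotF θ ω p| ≤ pairNorm ω :=
  Finset.sum_le_sum fun _ _ =>
    abs_mul_add_mul_le (abs_cos_le_one θ) (abs_sin_le_one θ) _ _

lemma abs_rotF'_le (θ : ℝ) (ω : ι → ℝ × ℝ) (p : ι) : |rotF' θ ω p| ≤ pairNorm ω := by
  refine (abs_mul_add_mul_le (c := -sin θ) (s := cos θ)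
    (by rw [abs_neg]; exact abs_sin_le_one θ) (abs_cos_le_one θ) _ _).trans ?_
  exact Finset.single_le_sum (f := fun p => |(ω p).1| + |(ω p).2|)
    (fun _ _ => by positivity) (Finset.mem_univ p)

lemma integrable_exp_pairNorm (K : ℝ) :
    Integrable (fun ω : ι → ℝ × ℝ => exp (K * pairNorm ω)) (Measure.pi fun _ => pairG) := by
  have h1 : Integrable (fun q : ℝ × ℝ => exp (K * |q.1|) * exp (K * |q.2|)) pairG :=
    (integrable_exp_abs K).mul_prod (integrable_exp_abs K)
  have := Integrable.fintype_prod (ι := ι) (f := fun _ q => exp (K * |q.1|) * exp (K * |q.2|))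
    (μ := fun _ => pairG) (fun _ => h1)
  refine this.congr (ae_of_all _ fun ω => ?_)
  simp only [pairNorm, Finset.mul_sum, Real.exp_sum, mul_add, Real.exp_add]

lemma integrable_of_le_exp_pairNorm {Φ : (ι → ℝ × ℝ) → ℝ} (hΦ : Continuous Φ) (C K : ℝ)
    (h : ∀ ω, |Φ ω| ≤ C * exp (K * pairNorm ω)) :
    Integrable Φ (Measure.pi fun _ => pairG) :=
  ((integrable_exp_pairNorm K).const_mul C).mono' hΦ.aestronglyMeasurable (ae_of_all _ h)

lemma measurePreserving_rot (θ : ℝ) :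
    MeasurePreserving (fun (ω : ι → ℝ × ℝ) p => (rotF θ ω p, rotF' θ ω p))
      (Measure.pi fun _ => pairG) (Measure.pi fun _ => pairG) := by
  refine measurePreserving_pi (fun _ : ι => pairG) (fun _ : ι => pairG)
    (f := fun _ q => (cos θ * q.1 + sin θ * q.2, -sin θ * q.1 + cos θ * q.2)) fun _ => ?_
  refine ⟨by fun_prop, ?_⟩
  have := IsGaussian.map_rotation_eq_self (μ := stdG) (by simp) θ
  convert this using 2
  ext q <;> simp [ContinuousLinearMap.rotation_apply]

lemma pairNorm_update [DecidableEq ι] (ω : ι → ℝ × ℝ) (p : ι) (q : ℝ × ℝ) :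
    pairNorm (Function.update ω p q) =
      (∑ i ∈ Finset.univ.erase p, (|(ω i).1| + |(ω i).2|)) + (|q.1| + |q.2|) := by
  unfold pairNorm
  rw [← Finset.add_sum_erase _ _ (Finset.mem_univ p), add_comm]
  congr 1
  · refine Finset.sum_congr rfl fun i hi => ?_
    rw [Function.update_of_ne (Finset.ne_of_mem_erase hi)]
  · simp

/-- Gaussian integration by parts in the second component of one coordinate pair. -/
lemma stein_pi [DecidableEq ι] {Φ Φ' : (ι → ℝ × ℝ) → ℝ} {K : ℝ} (p : ι) (hΦ : Continuous Φ)
    (hΦ' : Continuous Φ') (bΦ : ∀ ω, |Φ ω| ≤ K * exp (K * pairNorm ω))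
    (bΦ' : ∀ ω, |Φ' ω| ≤ K * exp (K * pairNorm ω))
    (hd : ∀ (ω : ι → ℝ × ℝ) (u v : ℝ), HasDerivAt (fun v => Φ (Function.update ω p (u, v)))
      (Φ' (Function.update ω p (u, v))) v) :
    ∫ ω, (ω p).2 * Φ ω ∂(Measure.pi fun _ => pairG) =
      ∫ ω, Φ' ω ∂(Measure.pi fun _ => pairG) := by
  have hK : 0 ≤ K := by
    have := (abs_nonneg _).trans (bΦ 0)
    exact nonneg_of_mul_nonneg_left this (exp_pos _)
  have i1 : Integrable (fun ω => (ω p).2 * Φ ω) (Measure.pi fun _ : ι => pairG) := by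
    refine integrable_of_le_exp_pairNorm (by fun_prop) K (K + 1) fun ω => ?_
    rw [abs_mul]
    calc |(ω p).2| * |Φ ω| ≤ exp (pairNorm ω) * (K * exp (K * pairNorm ω)) := by
          gcongr
          · have h1 : |(ω p).2| ≤ pairNorm ω := by
              refine le_trans ?_ (Finset.single_le_sum (f := fun p => |(ω p).1| + |(ω p).2|)
                (fun _ _ => by positivity) (Finset.mem_univ p))
              linarith [abs_nonneg (ω p).1]
            linarith [add_one_le_exp (pairNorm ω)]
          · exact bΦ ω
      _ = K * exp ((K + 1) * pairNorm ω) := by rw [add_mul, Real.exp_add, one_mul]; ring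
  have i2 : Integrable Φ' (Measure.pi fun _ : ι => pairG) :=
    integrable_of_le_exp_pairNorm hΦ' K K bΦ'
  have mp := measurePreserving_update (ι := ι) pairG p
  rw [← integral_comp_of_measurePreserving mp i1.aestronglyMeasurable,
    ← integral_comp_of_measurePreserving mp i2.aestronglyMeasurable]
  have j1 := mp.integrable_comp_of_integrable i1
  have j2 := mp.integrable_comp_of_integrable i2
  simp only [Function.comp_def] at j1 j2
  rw [integral_prod _ j1, integral_prod _ j2]
  refine integral_congr_ae ?_
  filter_upwards [j1.prod_right_ae, j2.prod_right_ae] with ω k1 k2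
  rw [integral_prod _ k1, integral_prod _ k2]
  refine integral_congr_ae (ae_of_all _ fun u => ?_)
  simp only [Function.update_self]
  have hbd : ∀ v, K * exp (K * pairNorm (Function.update ω p (u, v))) ≤
      (max K (K * exp (K * pairNorm (Function.update ω p (u, 0))))) *
        exp ((max K (K * exp (K * pairNorm (Function.update ω p (u, 0))))) * |v|) := by
    intro v
    have e : pairNorm (Function.update ω p (u, v)) =
        pairNorm (Function.update ω p (u, 0)) + |v| := by
      simp only [pairNorm_update, abs_zero]; ring
    rw [e, mul_add, Real.exp_add, ← mul_assoc]
    gcongr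
    · exact le_max_right _ _
    · exact le_max_left _ _
  have cu : Continuous fun v : ℝ => Function.update ω p (u, v) :=
    Continuous.update continuous_const p (by fun_prop)
  exact stein_line (fun v => hd ω u v) (by fun_prop)
    (fun v => (bΦ _).trans (hbd v)) (fun v => (bΦ' _).trans (hbd v))

/-- Derivative in the angle of the covariance `E f(X) g(cos θ X + sin θ Z)`. -/
theorem hasDerivAt_covariance {f g : (ι → ℝ) → ℝ} {f' g' : ι → (ι → ℝ) → ℝ} {K : ℝ}
    (hf : ∀ x, HasFDerivAt f (∑ p, f' p x • ContinuousLinearMap.proj (R := ℝ) p) x)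
    (hg : ∀ x, HasFDerivAt g (∑ p, g' p x • ContinuousLinearMap.proj (R := ℝ) p) x)
    (cf' : ∀ p, Continuous (f' p)) (cg' : ∀ p, Continuous (g' p))
    (bf : ∀ x, |f x| ≤ K * exp (K * ∑ p, |x p|)) (bg : ∀ x, |g x| ≤ K * exp (K * ∑ p, |x p|))
    (bf' : ∀ p x, |f' p x| ≤ K * exp (K * ∑ p, |x p|))
    (bg' : ∀ p x, |g' p x| ≤ K * exp (K * ∑ p, |x p|)) (θ : ℝ) :
    HasDerivAt (fun θ => ∫ ω, f (fstF ω) * g (rotF θ ω) ∂(Measure.pi fun _ : ι => pairG))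
      (-sin θ * ∫ ω, ∑ p, f' p (fstF ω) * g' p (rotF θ ω) ∂(Measure.pi fun _ : ι => pairG)) θ := by
  classical
  have hK : 0 ≤ K := by
    have := (abs_nonneg _).trans (bf 0)
    exact nonneg_of_mul_nonneg_left this (exp_pos _)
  have cf : Continuous f := continuous_iff_continuousAt.2 fun x => (hf x).continuousAt
  have cg : Continuous g := continuous_iff_continuousAt.2 fun x => (hg x).continuousAt
  have up : ∀ {h : (ι → ℝ) → ℝ}, (∀ x, |h x| ≤ K * exp (K * ∑ p, |x p|)) →
      ∀ {x : ι → ℝ} {ω : ι → ℝ × ℝ}, ∑ p, |x p| ≤ pairNorm ω →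
        |h x| ≤ K * exp (K * pairNorm ω) := by
    intro h hh x ω hx
    refine (hh x).trans ?_
    gcongr
  have mul2 : ∀ {a b : ℝ} {ω : ι → ℝ × ℝ}, |a| ≤ K * exp (K * pairNorm ω) →
      |b| ≤ K * exp (K * pairNorm ω) → |a * b| ≤ K ^ 2 * exp (2 * K * pairNorm ω) := by
    intro a b ω ha hb
    rw [abs_mul]
    calc |a| * |b| ≤ (K * exp (K * pairNorm ω)) * (K * exp (K * pairNorm ω)) := by gcongr
      _ = _ := by
        rw [show 2 * K * pairNorm ω = K * pairNorm ω + K * pairNorm ω by ring, Real.exp_add]; ring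
  have bW : ∀ (θ : ℝ) (p : ι) (ω : ι → ℝ × ℝ),
      |f (fstF ω) * (g' p (rotF θ ω) * rotF' θ ω p)| ≤
        K ^ 2 * exp ((2 * K + 1) * pairNorm ω) := by
    intro θ p ω
    rw [← mul_assoc, abs_mul, add_mul, Real.exp_add, one_mul, ← mul_assoc]
    gcongr
    · exact mul2 (up bf (sum_abs_fstF_le ω)) (up (bg' p) (sum_abs_rotF_le θ ω))
    · linarith [abs_rotF'_le θ ω p, add_one_le_exp (pairNorm ω)]
  have main := hasDerivAt_integral_of_dominated_loc_of_deriv_le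
    (μ := Measure.pi fun _ : ι => pairG) (x₀ := θ) (s := Set.univ)
    (F := fun θ ω => f (fstF ω) * g (rotF θ ω))
    (F' := fun θ ω => ∑ p, f (fstF ω) * (g' p (rotF θ ω) * rotF' θ ω p))
    (bound := fun ω => ∑ _p : ι, K ^ 2 * exp ((2 * K + 1) * pairNorm ω))
    Filter.univ_mem
    (Filter.Eventually.of_forall fun θ => (by fun_prop : Continuous _).aestronglyMeasurable)
    (integrable_of_le_exp_pairNorm (by fun_prop) (K ^ 2) (2 * K)
      fun ω => mul2 (up bf (sum_abs_fstF_le ω)) (up bg (sum_abs_rotF_le θ ω)))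
    (by
      refine (continuous_finsetSum _ fun p _ => ?_).aestronglyMeasurable
      have := continuous_apply (A := fun _ : ι => ℝ) p
      have h2 : Continuous fun ω : ι → ℝ × ℝ => rotF' θ ω p := this.comp (continuous_rotF' θ)
      fun_prop)
    (ae_of_all _ fun ω θ _ => by
      refine (norm_sum_le _ _).trans (Finset.sum_le_sum fun p _ => ?_)
      exact bW θ p ω)
    (integrable_finsetSum _ fun p _ => (integrable_exp_pairNorm _).const_mul _)
    (ae_of_all _ fun ω θ _ => by
      have hr : HasDerivAt (fun θ => rotF θ ω) (rotF' θ ω) θ := by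
        refine hasDerivAt_pi.2 fun p => ?_
        exact ((hasDerivAt_cos θ).mul_const _).add ((hasDerivAt_sin θ).mul_const _)
      have := ((hg (rotF θ ω)).comp_hasDerivAt θ hr).const_mul (f (fstF ω))
      refine this.congr_deriv ?_
      simp [Finset.mul_sum])
  refine main.2.congr_deriv ?_
  have hcW : ∀ p, Continuous fun ω : ι → ℝ × ℝ => rotF' θ ω p := fun p =>
    (continuous_apply (A := fun _ : ι => ℝ) p).comp (continuous_rotF' θ)
  have iW : ∀ p, Integrable (fun ω => f (fstF ω) * (g' p (rotF θ ω) * rotF' θ ω p))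
      (Measure.pi fun _ : ι => pairG) := fun p =>
    integrable_of_le_exp_pairNorm
      (by have := hcW p; have := cg' p; fun_prop) _ _ (bW θ p)
  rw [integral_finsetSum _ fun p _ => iW p, integral_finsetSum _ fun p _ =>
    integrable_of_le_exp_pairNorm (by have := cg' p; have := cf' p; fun_prop) (K ^ 2) (2 * K)
      fun ω => mul2 (up (bf' p) (sum_abs_fstF_le ω)) (up (bg' p) (sum_abs_rotF_le θ ω)),
    Finset.mul_sum]
  refine Finset.sum_congr rfl fun p _ => ?_
  -- rotate the coordinates and integrate by parts
  set B : (ι → ℝ × ℝ) → (ι → ℝ) := rotF (-θ) with hB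
  have cB : Continuous B := continuous_rotF _
  set R : (ι → ℝ × ℝ) → (ι → ℝ × ℝ) := fun ω p => (rotF θ ω p, rotF' θ ω p) with hR
  have mpR : MeasurePreserving R _ _ := measurePreserving_rot (ι := ι) θ
  have eB : ∀ ω, B (R ω) = fstF ω := by
    intro ω; ext q
    simp only [hB, hR, rotF, rotF', fstF, cos_neg, sin_neg]
    linear_combination (ω q).1 * Real.sin_sq_add_cos_sq θ
  have eF : ∀ ω, fstF (R ω) = rotF θ ω := fun ω => rfl
  have st := stein_pi (ι := ι) (K := max (K ^ 2) (2 * K)) p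
    (Φ := fun ω => f (B ω) * g' p (fstF ω))
    (Φ' := fun ω => -sin θ * (f' p (B ω) * g' p (fstF ω)))
    (by have := cg' p; fun_prop) (by have := cg' p; have := cf' p; fun_prop)
    (fun ω => by
      refine (mul2 (up bf (sum_abs_rotF_le (-θ) ω)) (up (bg' p) (sum_abs_fstF_le ω))).trans ?_
      have := pairNorm_nonneg ω
      gcongr
      · exact le_max_left _ _
      · exact le_max_right _ _)
    (fun ω => by
      rw [abs_mul, abs_neg]
      refine (mul_le_of_le_one_left (abs_nonneg _) (abs_sin_le_one θ)).trans ?_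
      refine (mul2 (up (bf' p) (sum_abs_rotF_le (-θ) ω)) (up (bg' p) (sum_abs_fstF_le ω))).trans ?_
      have := pairNorm_nonneg ω
      gcongr
      · exact le_max_left _ _
      · exact le_max_right _ _)
    (by
      intro ω u v
      have e2 : ∀ v, fstF (Function.update ω p (u, v)) = Function.update (fstF ω) p u := by
        intro v; ext q
        by_cases hq : q = p
        · subst hq; simp [fstF]
        · simp [fstF, hq]
      have hr : HasDerivAt (fun v => B (Function.update ω p (u, v)))
          (Pi.single p (-sin θ)) v := by
        refine hasDerivAt_pi.2 fun q => ?_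
        by_cases hq : q = p
        · subst hq
          simp only [hB, rotF, Function.update_self, Pi.single_eq_same, cos_neg, sin_neg]
          simpa using ((hasDerivAt_id v).const_mul (-sin θ)).const_add (cos θ * u)
        · simp only [hB, rotF, Function.update_of_ne hq, Pi.single_eq_of_ne hq]
          exact hasDerivAt_const _ _
      have := ((hf (B (Function.update ω p (u, v)))).comp_hasDerivAt v hr).mul_const
        (g' p (Function.update (fstF ω) p u))
      simp only [e2]
      refine this.congr_deriv ?_
      have e3 : ∀ z : ℝ, (∑ q, f' q (B (Function.update ω p (u, v))) * Pi.single (M := fun _ => ℝ) p z q) =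
          f' p (B (Function.update ω p (u, v))) * z := by
        intro z
        rw [Finset.sum_eq_single p]
        · simp
        · intro q _ hq; simp [hq]
        · simp
      simp only [_root_.sum_apply, smul_apply,
        ContinuousLinearMap.proj_apply, smul_eq_mul]
      rw [e3]; ring)
  calc ∫ ω, f (fstF ω) * (g' p (rotF θ ω) * rotF' θ ω p) ∂(Measure.pi fun _ : ι => pairG)
      = ∫ ω, (fun ω => (ω p).2 * (f (B ω) * g' p (fstF ω))) (R ω)
          ∂(Measure.pi fun _ : ι => pairG) := by
        refine integral_congr_ae (ae_of_all _ fun ω => ?_)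
        simp only [eB, eF]
        simp only [hR]; ring
    _ = ∫ ω, -sin θ * (f' p (B ω) * g' p (fstF ω)) ∂(Measure.pi fun _ : ι => pairG) := by
        have := cg' p
        rw [integral_comp_of_measurePreserving mpR
          (g := fun ω => (ω p).2 * (f (B ω) * g' p (fstF ω)))
          (by fun_prop : Continuous _).aestronglyMeasurable, st]
    _ = ∫ ω, (fun ω => -sin θ * (f' p (B ω) * g' p (fstF ω))) (R ω)
          ∂(Measure.pi fun _ : ι => pairG) := by
        have := cg' p
        have := cf' p
        rw [integral_comp_of_measurePreserving mpR
          (g := fun ω => -sin θ * (f' p (B ω) * g' p (fstF ω)))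
          (by fun_prop : Continuous _).aestronglyMeasurable]
    _ = -sin θ * ∫ ω, f' p (fstF ω) * g' p (rotF θ ω) ∂(Measure.pi fun _ : ι => pairG) := by
        rw [← integral_const_mul]
        simp only [eB, eF]

end Pi

section Marginals
variable {ι : Type*} [Fintype ι]

/-- The pair disorder. -/
abbrev pairPi (ι : Type*) [Fintype ι] : Measure (ι → ℝ × ℝ) := Measure.pi fun _ => pairG

/-- The standard Gaussian measure on `ι → ℝ`. -/
abbrev stdPi (ι : Type*) [Fintype ι] : Measure (ι → ℝ) := Measure.pi fun _ => stdG

lemma measurePreserving_fstF : MeasurePreserving (fstF (ι := ι)) (pairPi ι) (stdPi ι) :=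
  measurePreserving_pi (fun _ : ι => pairG) (fun _ : ι => stdG) (f := fun _ q => q.1)
    fun _ => measurePreserving_fst

lemma measurePreserving_rotF (θ : ℝ) :
    MeasurePreserving (rotF (ι := ι) θ) (pairPi ι) (stdPi ι) :=
  measurePreserving_fstF.comp (measurePreserving_rot θ)

lemma integral_fst_mul_rot_half_pi (f g : (ι → ℝ) → ℝ) :
    ∫ ω, f (fstF ω) * g (rotF (π / 2) ω) ∂pairPi ι =
      (∫ x, f x ∂stdPi ι) * ∫ x, g x ∂stdPi ι := by
  rw [← integral_prod_mul]
  have := (measurePreserving_arrowProdEquivProdArrow ℝ ℝ ι (fun _ => stdG) (fun _ => stdG))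
  rw [← this.integral_comp (MeasurableEquiv.measurableEmbedding _)]
  refine integral_congr_ae (ae_of_all _ fun ω => ?_)
  have e : rotF (π / 2) ω = fun p => (ω p).2 := by
    ext p; simp [rotF]
  simp only [e]
  rfl

end Marginals

section LogSumExp
variable {ι S : Type*} [Fintype ι] [Fintype S]

/-- The linear form with coefficients `a`. -/
def lin (a g : ι → ℝ) : ℝ := ∑ p, a p * g p

/-- The partition function of a family of linear forms. -/
def psum (a : S → ι → ℝ) (g : ι → ℝ) : ℝ := ∑ x, exp (lin (a x) g)

/-- The Gibbs weights of a family of linear forms. -/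
def gw (a : S → ι → ℝ) (g : ι → ℝ) (x : S) : ℝ := exp (lin (a x) g) / psum a g

/-- The free energy of a family of linear forms. -/
def lse (a : S → ι → ℝ) (g : ι → ℝ) : ℝ := log (psum a g)

@[fun_prop] lemma continuous_lin (a : ι → ℝ) : Continuous (lin a) := by
  unfold lin; fun_prop

@[fun_prop] lemma continuous_psum (a : S → ι → ℝ) : Continuous (psum a) := by
  unfold psum; fun_prop

lemma psum_nonneg (a : S → ι → ℝ) (g : ι → ℝ) : 0 ≤ psum a g :=
  Finset.sum_nonneg fun _ _ => (exp_pos _).le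

lemma gw_nonneg (a : S → ι → ℝ) (g : ι → ℝ) (x : S) : 0 ≤ gw a g x :=
  div_nonneg (exp_pos _).le (psum_nonneg a g)

lemma abs_lin_le (a g : ι → ℝ) : |lin a g| ≤ (∑ p, |a p|) * ∑ p, |g p| := by
  refine (Finset.abs_sum_le_sum_abs _ _).trans ?_
  rw [Finset.sum_mul]
  refine Finset.sum_le_sum fun p _ => ?_
  rw [abs_mul]
  gcongr
  exact Finset.single_le_sum (f := fun p => |g p|) (fun _ _ => abs_nonneg _) (Finset.mem_univ p)

/-- A bound for all coefficients. -/
def coefBound (a : S → ι → ℝ) : ℝ := ∑ x, ∑ p, |a x p|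

lemma coefBound_nonneg (a : S → ι → ℝ) : 0 ≤ coefBound a :=
  Finset.sum_nonneg fun _ _ => Finset.sum_nonneg fun _ _ => abs_nonneg _

lemma sum_abs_le_coefBound (a : S → ι → ℝ) (x : S) : ∑ p, |a x p| ≤ coefBound a :=
  Finset.single_le_sum (f := fun x => ∑ p, |a x p|)
    (fun _ _ => Finset.sum_nonneg fun _ _ => abs_nonneg _) (Finset.mem_univ x)

lemma abs_coef_le (a : S → ι → ℝ) (x : S) (p : ι) : |a x p| ≤ coefBound a :=
  (Finset.single_le_sum (f := fun p => |a x p|) (fun _ _ => abs_nonneg _)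
    (Finset.mem_univ p)).trans (sum_abs_le_coefBound a x)

variable [Nonempty S]

lemma psum_pos (a : S → ι → ℝ) (g : ι → ℝ) : 0 < psum a g :=
  Finset.sum_pos (fun _ _ => exp_pos _) Finset.univ_nonempty

@[fun_prop] lemma continuous_gw (a : S → ι → ℝ) (x : S) : Continuous fun g => gw a g x := by
  unfold gw
  exact Continuous.div (by fun_prop) (by fun_prop) fun g => (psum_pos a g).ne'

@[fun_prop] lemma continuous_lse (a : S → ι → ℝ) : Continuous (lse a) := by
  unfold lse
  exact Continuous.log (by fun_prop) fun g => (psum_pos a g).ne'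

lemma sum_gw (a : S → ι → ℝ) (g : ι → ℝ) : ∑ x, gw a g x = 1 := by
  unfold gw
  rw [← Finset.sum_div]
  exact div_self (psum_pos a g).ne'

lemma gw_le_one (a : S → ι → ℝ) (g : ι → ℝ) (x : S) : gw a g x ≤ 1 := by
  rw [← sum_gw a g]
  exact Finset.single_le_sum (fun x _ => gw_nonneg a g x) (Finset.mem_univ x)

lemma hasFDerivAt_lse (a : S → ι → ℝ) (g : ι → ℝ) :
    HasFDerivAt (lse a)
      (∑ p, (∑ x, gw a g x * a x p) •
        ContinuousLinearMap.proj (R := ℝ) (φ := fun _ : ι => ℝ) p) g := by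
  have h1 : ∀ x, HasFDerivAt (lin (a x))
      (∑ p, (a x p) • ContinuousLinearMap.proj (R := ℝ) (φ := fun _ : ι => ℝ) p) g := by
    intro x
    have := HasFDerivAt.fun_sum (u := Finset.univ) (x := g) (A := fun p g => a x p * g p)
      (A' := fun p => (a x p) • ContinuousLinearMap.proj (R := ℝ) (φ := fun _ : ι => ℝ) p)
      fun p _ => ((ContinuousLinearMap.proj (R := ℝ) (φ := fun _ : ι => ℝ) p).hasFDerivAt).const_mul
        (a x p)
    exact this
  have h2 : HasFDerivAt (psum a)
      (∑ x, exp (lin (a x) g) • ∑ p, (a x p) •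
        ContinuousLinearMap.proj (R := ℝ) (φ := fun _ : ι => ℝ) p) g :=
    HasFDerivAt.fun_sum fun x _ => (h1 x).exp
  have h3 := h2.log (psum_pos a g).ne'
  refine h3.congr_fderiv ?_
  ext v
  simp only [_root_.sum_apply, smul_apply, ContinuousLinearMap.proj_apply, smul_eq_mul, gw,
    Finset.mul_sum, Finset.sum_mul]
  rw [Finset.sum_comm]
  refine Finset.sum_congr rfl fun p _ => Finset.sum_congr rfl fun x _ => ?_
  ring

lemma abs_lse_le (a : S → ι → ℝ) (g : ι → ℝ) :
    |lse a g| ≤ log (Fintype.card S) + coefBound a * ∑ p, |g p| := by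
  have hs : 0 ≤ ∑ p, |g p| := Finset.sum_nonneg fun _ _ => abs_nonneg _
  have hl : ∀ x, |lin (a x) g| ≤ coefBound a * ∑ p, |g p| := fun x =>
    (abs_lin_le _ _).trans (by gcongr; exact sum_abs_le_coefBound a x)
  have hc : (1 : ℝ) ≤ Fintype.card S := by
    exact_mod_cast Fintype.card_pos
  have hlog : 0 ≤ log (Fintype.card S) := log_nonneg hc
  rw [abs_le]
  constructor
  · obtain ⟨x⟩ := ‹Nonempty S›
    have : lin (a x) g ≤ lse a g := by
      rw [lse, le_log_iff_exp_le (psum_pos a g)]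
      exact Finset.single_le_sum (f := fun x => exp (lin (a x) g)) (fun _ _ => (exp_pos _).le)
        (Finset.mem_univ x)
    linarith [(abs_le.1 (hl x)).1]
  · rw [lse, log_le_iff_le_exp (psum_pos a g), Real.exp_add, exp_log (by linarith)]
    calc psum a g ≤ ∑ _x : S, exp (coefBound a * ∑ p, |g p|) :=
          Finset.sum_le_sum fun x _ => exp_le_exp.2 ((le_abs_self _).trans (hl x))
      _ = _ := by simp

lemma abs_sum_gw_coef_le (a : S → ι → ℝ) (g : ι → ℝ) (p : ι) :
    |∑ x, gw a g x * a x p| ≤ coefBound a := by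
  refine (Finset.abs_sum_le_sum_abs _ _).trans ?_
  calc ∑ x, |gw a g x * a x p| ≤ ∑ x, gw a g x * coefBound a := by
        refine Finset.sum_le_sum fun x _ => ?_
        rw [abs_mul, abs_of_nonneg (gw_nonneg a g x)]
        exact mul_le_mul_of_nonneg_left (abs_coef_le a x p) (gw_nonneg a g x)
    _ = coefBound a := by rw [← Finset.sum_mul, sum_gw, one_mul]

lemma sum_coef_mul_coef (a : S → ι → ℝ) (g g' : ι → ℝ) :
    ∑ p, (∑ x, gw a g x * a x p) * (∑ y, gw a g' y * a y p) =
      ∑ x, ∑ y, gw a g x * gw a g' y * ∑ p, a x p * a y p := by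
  simp_rw [Finset.sum_mul_sum, Finset.mul_sum]
  rw [Finset.sum_comm]
  refine Finset.sum_congr rfl fun x _ => ?_
  rw [Finset.sum_comm]
  refine Finset.sum_congr rfl fun y _ => Finset.sum_congr rfl fun p _ => ?_
  ring

lemma mul_exp_mono {C k K s : ℝ} (hs : 0 ≤ s) (hC : C ≤ K) (hk : k ≤ K) (hK : 0 ≤ K) :
    C * exp (k * s) ≤ K * exp (K * s) := by
  gcongr

/-- Angular derivative of the covariance of the free energy. -/
lemma hasDerivAt_lse_covariance (a : S → ι → ℝ) (θ : ℝ) :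
    HasDerivAt (fun θ => ∫ ω, lse a (fstF ω) * lse a (rotF θ ω) ∂pairPi ι)
      (-sin θ * ∫ ω, ∑ x, ∑ y, gw a (fstF ω) x * gw a (rotF θ ω) y * ∑ p, a x p * a y p
        ∂pairPi ι) θ := by
  have hb := coefBound_nonneg a
  have hlog : 0 ≤ log (Fintype.card S) := log_natCast_nonneg _
  set K := log (Fintype.card S) + coefBound a + 1 with hK
  have h1 : ∀ x : ι → ℝ, |lse a x| ≤ K * exp (K * ∑ p, |x p|) := by
    intro x
    have hs : 0 ≤ ∑ p, |x p| := Finset.sum_nonneg fun _ _ => abs_nonneg _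
    calc |lse a x| ≤ log (Fintype.card S) + coefBound a * ∑ p, |x p| := abs_lse_le a x
      _ ≤ K * (∑ p, |x p| + 1) := by nlinarith
      _ ≤ K * exp (1 * ∑ p, |x p|) := by
          rw [one_mul]
          exact mul_le_mul_of_nonneg_left (add_one_le_exp _) (by linarith)
      _ ≤ _ := mul_exp_mono hs le_rfl (by linarith) (by linarith)
  have h2 : ∀ (p : ι) (x : ι → ℝ), |∑ y, gw a x y * a y p| ≤ K * exp (K * ∑ p, |x p|) := by
    intro p x
    have hs : 0 ≤ ∑ p, |x p| := Finset.sum_nonneg fun _ _ => abs_nonneg _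
    have := mul_exp_mono (C := coefBound a) (k := 0) (K := K) hs (by linarith) (by linarith)
      (by linarith)
    rw [zero_mul, Real.exp_zero, mul_one] at this
    exact (abs_sum_gw_coef_le a x p).trans this
  have := hasDerivAt_covariance (f := lse a) (g := lse a)
    (f' := fun p x => ∑ y, gw a x y * a y p) (g' := fun p x => ∑ y, gw a x y * a y p)
    (hasFDerivAt_lse a) (hasFDerivAt_lse a) (fun p => by fun_prop) (fun p => by fun_prop)
    h1 h1 h2 h2 θ
  simpa only [sum_coef_mul_coef] using this

/-- Product of exponential moments of opposite signs for a free energy with bounded gradient. -/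
lemma integral_exp_lse_mul_le (a : S → ι → ℝ) {D : ℝ} (hD : ∀ x, ∑ p, a x p ^ 2 ≤ D) (l : ℝ) :
    (∫ g, exp (l * lse a g) ∂stdPi ι) * (∫ g, exp (-l * lse a g) ∂stdPi ι) ≤
      exp (l ^ 2 * D) := by
  have hb := coefBound_nonneg a
  have hlog : 0 ≤ log (Fintype.card S) := log_natCast_nonneg _
  set A := exp (|l| * log (Fintype.card S)) with hA
  have hApos : 0 < A := exp_pos _
  set K := (1 + |l| * coefBound a) * A + |l| * coefBound a with hKdef
  have hlb : 0 ≤ |l| * coefBound a := by positivity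
  have hexp : ∀ (l' : ℝ), |l'| = |l| → ∀ x : ι → ℝ,
      exp (l' * lse a x) ≤ A * exp (|l| * coefBound a * ∑ p, |x p|) := by
    intro l' hl' x
    rw [hA, ← Real.exp_add]
    refine exp_le_exp.2 ((le_abs_self _).trans ?_)
    rw [abs_mul, hl', mul_assoc, ← mul_add]
    exact mul_le_mul_of_nonneg_left (abs_lse_le a x) (abs_nonneg _)
  have h1 : ∀ (l' : ℝ), |l'| = |l| → ∀ x : ι → ℝ,
      |exp (l' * lse a x)| ≤ K * exp (K * ∑ p, |x p|) := by
    intro l' hl' x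
    have hs : 0 ≤ ∑ p, |x p| := Finset.sum_nonneg fun _ _ => abs_nonneg _
    rw [abs_of_pos (exp_pos _)]
    refine (hexp l' hl' x).trans (mul_exp_mono hs ?_ ?_ ?_)
    · nlinarith
    · nlinarith
    · positivity
  have h2 : ∀ (l' : ℝ), |l'| = |l| → ∀ (p : ι) (x : ι → ℝ),
      |exp (l' * lse a x) * (l' * ∑ y, gw a x y * a y p)| ≤ K * exp (K * ∑ p, |x p|) := by
    intro l' hl' p x
    have hs : 0 ≤ ∑ p, |x p| := Finset.sum_nonneg fun _ _ => abs_nonneg _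
    rw [abs_mul, abs_mul, hl', abs_of_pos (exp_pos _)]
    calc exp (l' * lse a x) * (|l| * |∑ y, gw a x y * a y p|)
        ≤ (A * exp (|l| * coefBound a * ∑ p, |x p|)) * (|l| * coefBound a) := by
          gcongr
          · exact hexp l' hl' x
          · exact abs_sum_gw_coef_le a x p
      _ = (A * (|l| * coefBound a)) * exp (|l| * coefBound a * ∑ p, |x p|) := by ring
      _ ≤ _ := by
          refine mul_exp_mono hs ?_ ?_ ?_
          · nlinarith
          · nlinarith
          · positivity
  have hder : ∀ (l' : ℝ) (x : ι → ℝ), HasFDerivAt (fun x => exp (l' * lse a x))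
      (∑ p, (exp (l' * lse a x) * (l' * ∑ y, gw a x y * a y p)) •
        ContinuousLinearMap.proj (R := ℝ) (φ := fun _ : ι => ℝ) p) x := by
    intro l' x
    refine (((hasFDerivAt_lse a x).const_mul l').exp).congr_fderiv ?_
    ext v
    simp only [_root_.sum_apply, smul_apply, ContinuousLinearMap.proj_apply, smul_eq_mul,
      Finset.mul_sum]
    refine Finset.sum_congr rfl fun p _ => ?_
    simp only [Finset.sum_mul, Finset.mul_sum]
    refine Finset.sum_congr rfl fun x _ => ?_
    ring
  set V : ℝ → ℝ := fun θ => ∫ ω, exp (l * lse a (fstF ω)) * exp (-l * lse a (rotF θ ω)) ∂pairPi ι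
    with hV
  have dV : ∀ θ, HasDerivAt V (-sin θ * ∫ ω, ∑ p,
      (exp (l * lse a (fstF ω)) * (l * ∑ y, gw a (fstF ω) y * a y p)) *
      (exp (-l * lse a (rotF θ ω)) * (-l * ∑ y, gw a (rotF θ ω) y * a y p)) ∂pairPi ι) θ :=
    hasDerivAt_covariance (hder l) (hder (-l))
      (fun p => by fun_prop) (fun p => by fun_prop) (h1 l rfl) (h1 (-l) (abs_neg l))
      (h2 l rfl) (h2 (-l) (abs_neg l))
  have hdot : ∀ g g' : ι → ℝ, ∑ p, (∑ x, gw a g x * a x p) * (∑ y, gw a g' y * a y p) ≤ D := by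
    intro g g'
    rw [sum_coef_mul_coef]
    calc ∑ x, ∑ y, gw a g x * gw a g' y * ∑ p, a x p * a y p
        ≤ ∑ x, ∑ y, gw a g x * gw a g' y * D := by
          refine Finset.sum_le_sum fun x _ => Finset.sum_le_sum fun y _ => ?_
          refine mul_le_mul_of_nonneg_left ?_ (mul_nonneg (gw_nonneg _ _ _) (gw_nonneg _ _ _))
          have : ∑ p, a x p * a y p ≤ ∑ p, (a x p ^ 2 + a y p ^ 2) / 2 :=
            Finset.sum_le_sum fun p _ => by nlinarith [sq_nonneg (a x p - a y p)]
          rw [← Finset.sum_div, Finset.sum_add_distrib] at this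
          linarith [hD x, hD y]
      _ = D := by
          simp only [← Finset.sum_mul, ← Finset.mul_sum, sum_gw, one_mul]
  have iV : ∀ θ, Integrable
      (fun ω => exp (l * lse a (fstF ω)) * exp (-l * lse a (rotF θ ω))) (pairPi ι) := by
    intro θ
    have hK0 : 0 ≤ K := by positivity
    refine integrable_of_le_exp_pairNorm (by fun_prop) (K * K) (K + K) fun ω => ?_
    rw [abs_mul, add_mul K K (pairNorm ω), Real.exp_add]
    calc _ ≤ (K * exp (K * pairNorm ω)) * (K * exp (K * pairNorm ω)) := by
          gcongr
          · refine (h1 l rfl _).trans ?_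
            gcongr; exact sum_abs_fstF_le ω
          · refine (h1 (-l) (abs_neg l) _).trans ?_
            gcongr; exact sum_abs_rotF_le θ ω
      _ = _ := by ring
  have bV : ∀ θ ∈ Set.Icc 0 (π / 2), -sin θ * (∫ ω, ∑ p,
      (exp (l * lse a (fstF ω)) * (l * ∑ y, gw a (fstF ω) y * a y p)) *
      (exp (-l * lse a (rotF θ ω)) * (-l * ∑ y, gw a (rotF θ ω) y * a y p)) ∂pairPi ι) ≤
      l ^ 2 * D * sin θ * V θ := by
    intro θ hθ
    have hs : 0 ≤ sin θ := sin_nonneg_of_nonneg_of_le_pi hθ.1 (by linarith [hθ.2, pi_pos])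
    have : -(∫ ω, ∑ p, (exp (l * lse a (fstF ω)) * (l * ∑ y, gw a (fstF ω) y * a y p)) *
      (exp (-l * lse a (rotF θ ω)) * (-l * ∑ y, gw a (rotF θ ω) y * a y p)) ∂pairPi ι) ≤
      l ^ 2 * D * V θ := by
      rw [← integral_neg, hV]
      simp only
      rw [← integral_const_mul]
      refine integral_mono (Integrable.neg ?_) ((iV θ).const_mul _) fun ω => ?_
      · have hK0 : 0 ≤ K := by positivity
        refine integrable_finsetSum _ fun p _ => ?_
        refine integrable_of_le_exp_pairNorm (by fun_prop) (K * K) (K + K) fun ω => ?_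
        rw [abs_mul, add_mul K K (pairNorm ω), Real.exp_add]
        calc _ ≤ (K * exp (K * pairNorm ω)) * (K * exp (K * pairNorm ω)) := by
              gcongr
              · refine (h2 l rfl p _).trans ?_
                gcongr; exact sum_abs_fstF_le ω
              · refine (h2 (-l) (abs_neg l) p _).trans ?_
                gcongr; exact sum_abs_rotF_le θ ω
          _ = _ := by ring
      · have e : -(∑ p, (exp (l * lse a (fstF ω)) * (l * ∑ y, gw a (fstF ω) y * a y p)) *
            (exp (-l * lse a (rotF θ ω)) * (-l * ∑ y, gw a (rotF θ ω) y * a y p))) =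
            l ^ 2 * (exp (l * lse a (fstF ω)) * exp (-l * lse a (rotF θ ω))) *
              ∑ p, (∑ x, gw a (fstF ω) x * a x p) * (∑ y, gw a (rotF θ ω) y * a y p) := by
          rw [← Finset.sum_neg_distrib, Finset.mul_sum]
          refine Finset.sum_congr rfl fun p _ => ?_
          ring
        change -(∑ p, (exp (l * lse a (fstF ω)) * (l * ∑ y, gw a (fstF ω) y * a y p)) *
            (exp (-l * lse a (rotF θ ω)) * (-l * ∑ y, gw a (rotF θ ω) y * a y p))) ≤ _
        rw [e]
        have := mul_le_mul_of_nonneg_left (hdot (fstF ω) (rotF θ ω))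
          (by positivity : 0 ≤ l ^ 2 * (exp (l * lse a (fstF ω)) * exp (-l * lse a (rotF θ ω))))
        linarith
    nlinarith
  have mono : AntitoneOn (fun θ => V θ * exp (l ^ 2 * D * cos θ)) (Set.Icc 0 (π / 2)) := by
    have hdd : ∀ θ, HasDerivAt (fun θ => V θ * exp (l ^ 2 * D * cos θ)) _ θ := fun θ =>
      (dV θ).mul (((hasDerivAt_cos θ).const_mul (l ^ 2 * D)).exp)
    refine antitoneOn_of_deriv_nonpos (convex_Icc _ _)
      (fun θ _ => (hdd θ).continuousAt.continuousWithinAt)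
      (fun θ _ => (hdd θ).differentiableAt.differentiableWithinAt) fun θ hθ => ?_
    rw [interior_Icc] at hθ
    rw [(hdd θ).deriv]
    have := bV θ (Set.Ioo_subset_Icc_self hθ)
    have h0 := exp_pos (l ^ 2 * D * cos θ)
    nlinarith [mul_le_mul_of_nonneg_right this h0.le]
  have hfin := mono (Set.left_mem_Icc.2 (by positivity)) (Set.right_mem_Icc.2 (by positivity))
    (by positivity : (0 : ℝ) ≤ π / 2)
  have v0 : V 0 = 1 := by
    simp only [hV]
    have : ∀ ω : ι → ℝ × ℝ, rotF 0 ω = fstF ω := fun ω => by ext p; simp [rotF, fstF]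
    simp [this, ← Real.exp_add]
  have v1 : V (π / 2) = (∫ g, exp (l * lse a g) ∂stdPi ι) * (∫ g, exp (-l * lse a g) ∂stdPi ι) :=
    integral_fst_mul_rot_half_pi (fun g => exp (l * lse a g)) (fun g => exp (-l * lse a g))
  simp only [v0, v1, cos_zero, cos_pi_div_two, mul_zero, Real.exp_zero, mul_one, one_mul] at hfin
  exact hfin

end LogSumExp

section GaussianMoments
variable {ι : Type*} [Fintype ι]

lemma integral_exp_lin (a : ι → ℝ) :
    ∫ g, exp (lin a g) ∂stdPi ι = exp ((∑ p, a p ^ 2) / 2) := by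
  simp only [lin, Real.exp_sum]
  rw [integral_fintype_prod_eq_prod (𝕜 := ℝ) (fun p x => exp (a p * x))]
  simp only [integral_exp_mul_stdG]
  rw [← Real.exp_sum, Finset.sum_div]

lemma integrable_exp_lin (a : ι → ℝ) : Integrable (fun g => exp (lin a g)) (stdPi ι) := by
  simp only [lin, Real.exp_sum]
  refine Integrable.fintype_prod (𝕜 := ℝ) (f := fun p x => exp (a p * x)) fun p => ?_
  refine Integrable.of_integral_ne_zero ?_
  rw [integral_exp_mul_stdG]
  exact (exp_pos _).ne'

lemma exp_lin_mul_exp_lin (a c : ι → ℝ) (g : ι → ℝ) :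
    exp (lin a g) * exp (lin c g) = exp (lin (fun p => a p + c p) g) := by
  rw [← Real.exp_add]
  congr 1
  simp only [lin, ← Finset.sum_add_distrib, add_mul]

end GaussianMoments

section Overlap
variable {n : ℕ}

lemma spin_mul_self (b : Bool) : spin b * spin b = 1 := by
  cases b <;> simp [spin]

lemma abs_spin (b : Bool) : |spin b| = 1 := by
  cases b <;> simp [spin]

/-- The unnormalised overlap of two configurations. -/
def ov (σ τ : Config n) : ℝ := ∑ i, spin (σ i) * spin (τ i)

/-- Coefficients of the Hamiltonian with coupling strength `b`. -/
def skc (n : ℕ) (b : ℝ) (σ : Config n) (p : Fin n × Fin n) : ℝ :=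
  if p.1 < p.2 then b * spin (σ p.1) * spin (σ p.2) else 0

lemma ov_comm (σ τ : Config n) : ov σ τ = ov τ σ := by
  simp only [ov, mul_comm]

lemma ov_self (σ : Config n) : ov σ σ = n := by
  simp [ov, spin_mul_self]

lemma abs_ov_le (σ τ : Config n) : |ov σ τ| ≤ n := by
  refine (Finset.abs_sum_le_sum_abs _ _).trans ?_
  simp [abs_mul, abs_spin]

lemma ov_sq (σ τ : Config n) :
    ov σ τ ^ 2 = ∑ i, ∑ j, (spin (σ i) * spin (σ j)) * (spin (τ i) * spin (τ j)) := by
  rw [sq, ov, Finset.sum_mul_sum]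
  refine Finset.sum_congr rfl fun i _ => Finset.sum_congr rfl fun j _ => ?_
  ring

lemma sum_offDiag_symm (f : Fin n → Fin n → ℝ) (hf : ∀ i j, f i j = f j i) :
    ∑ i, ∑ j, f i j = 2 * (∑ i, ∑ j, if i < j then f i j else 0) + ∑ i, f i i := by
  have h1 : ∀ i j, f i j = (if i < j then f i j else 0) + (if j < i then f j i else 0) +
      (if i = j then f i i else 0) := by
    intro i j
    rcases lt_trichotomy i j with h | h | h
    · simp [h, h.not_gt, h.ne]
    · subst h; simp
    · simp [h, h.not_gt, h.ne', hf i j]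
  calc ∑ i, ∑ j, f i j = ∑ i, ∑ j, ((if i < j then f i j else 0) + (if j < i then f j i else 0) +
      (if i = j then f i i else 0)) := by
        refine Finset.sum_congr rfl fun i _ => Finset.sum_congr rfl fun j _ => h1 i j
    _ = _ := by
        simp only [Finset.sum_add_distrib]
        rw [Finset.sum_comm (f := fun i j => if j < i then f j i else 0)]
        simp
        ring

lemma skc_dot (b : ℝ) (σ τ : Config n) :
    ∑ p, skc n b σ p * skc n b τ p = b ^ 2 * (ov σ τ ^ 2 - n) / 2 := by
  rw [ov_sq, sum_offDiag_symm _ (fun i j => by ring), Fintype.sum_prod_type]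
  simp only [spin_mul_self, mul_one, Finset.sum_const, Finset.card_univ, Fintype.card_fin,
    nsmul_eq_mul]
  have : ∀ i j, skc n b σ (i, j) * skc n b τ (i, j) =
      b ^ 2 * (if i < j then (spin (σ i) * spin (σ j)) * (spin (τ i) * spin (τ j)) else 0) := by
    intro i j
    simp only [skc]
    split_ifs <;> ring
  simp only [this, ← Finset.mul_sum]
  ring

lemma skc_sq (b : ℝ) (σ : Config n) :
    ∑ p, skc n b σ p ^ 2 = b ^ 2 * (n ^ 2 - n) / 2 := by
  have := skc_dot b σ σ
  rw [ov_self] at this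
  simpa only [sq] using this

/-- Mean of the partition function. -/
def meanZ (n : ℕ) (b : ℝ) : ℝ := 2 ^ n * exp (b ^ 2 * (n ^ 2 - n) / 4)

lemma meanZ_pos (n : ℕ) (b : ℝ) : 0 < meanZ n b := by unfold meanZ; positivity

lemma card_config : Fintype.card (Config n) = 2 ^ n := by simp [Config]

lemma integral_psum (n : ℕ) (b : ℝ) :
    ∫ g, psum (skc n b) g ∂stdPi (Fin n × Fin n) = meanZ n b := by
  unfold psum
  rw [integral_finsetSum _ fun _ _ => integrable_exp_lin _]
  simp only [integral_exp_lin, skc_sq, Finset.sum_const, nsmul_eq_mul, Finset.card_univ,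
    card_config, meanZ]
  push_cast
  ring_nf

lemma integrable_psum (n : ℕ) (b : ℝ) :
    Integrable (psum (skc n b)) (stdPi (Fin n × Fin n)) :=
  integrable_finsetSum _ fun _ _ => integrable_exp_lin _

/-- Gibbs average of a function of two replicas in the same disorder. -/
def gib2 (b : ℝ) (f : Config n → Config n → ℝ) (g : Fin n × Fin n → ℝ) : ℝ :=
  ∑ σ, ∑ τ, gw (skc n b) g σ * gw (skc n b) g τ * f σ τ

lemma psum_sq_mul_gib2 (b : ℝ) (f : Config n → Config n → ℝ) (g : Fin n × Fin n → ℝ) :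
    psum (skc n b) g ^ 2 * gib2 b f g =
      ∑ σ, ∑ τ, f σ τ * exp (lin (fun p => skc n b σ p + skc n b τ p) g) := by
  have h := (psum_pos (skc n b) g).ne'
  simp only [gib2, gw, Finset.mul_sum, ← exp_lin_mul_exp_lin]
  refine Finset.sum_congr rfl fun i _ => Finset.sum_congr rfl fun j _ => ?_
  field_simp

lemma integrable_psum_sq_mul_gib2 (b : ℝ) (f : Config n → Config n → ℝ) :
    Integrable (fun g => psum (skc n b) g ^ 2 * gib2 b f g) (stdPi (Fin n × Fin n)) := by
  simp only [psum_sq_mul_gib2]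
  exact integrable_finsetSum _ fun _ _ => integrable_finsetSum _ fun _ _ =>
    (integrable_exp_lin _).const_mul _

lemma integral_psum_sq_mul_gib2 (b : ℝ) (f : Config n → Config n → ℝ) :
    ∫ g, psum (skc n b) g ^ 2 * gib2 b f g ∂stdPi (Fin n × Fin n) =
      meanZ n b ^ 2 * ((∑ σ : Config n, ∑ τ, f σ τ * exp (b ^ 2 * (ov σ τ ^ 2 - n) / 2)) / 4 ^ n) := by
  simp only [psum_sq_mul_gib2]
  rw [integral_finsetSum _ fun _ _ => integrable_finsetSum _ fun _ _ =>
    (integrable_exp_lin _).const_mul _]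
  have e4 : (4 : ℝ) ^ n = 2 ^ n * 2 ^ n := by rw [← mul_pow]; norm_num
  rw [Finset.sum_div, Finset.mul_sum]
  refine Finset.sum_congr rfl fun σ _ => ?_
  rw [integral_finsetSum _ fun _ _ => (integrable_exp_lin _).const_mul _]
  rw [Finset.sum_div, Finset.mul_sum]
  refine Finset.sum_congr rfl fun τ _ => ?_
  rw [integral_const_mul, integral_exp_lin]
  have : ∑ p, (skc n b σ p + skc n b τ p) ^ 2 =
      b ^ 2 * (n ^ 2 - n) + b ^ 2 * (ov σ τ ^ 2 - n) := by
    have h1 := skc_sq b σ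
    have h2 := skc_sq b τ
    have h3 := skc_dot b σ τ
    simp only [add_sq, Finset.sum_add_distrib, mul_assoc, ← Finset.mul_sum]
    linarith
  rw [this, meanZ, add_div, Real.exp_add, e4, mul_pow, ← Real.exp_nat_mul]
  push_cast
  field_simp
  ring_nf

end Overlap

section Hubbard

lemma integral_exp_sq_stdG {s : ℝ} (hs : s < 1) :
    ∫ x, exp (s * x ^ 2 / 2) ∂stdG = (√(1 - s))⁻¹ := by
  have h1 : (0 : ℝ) < 1 - s := by linarith
  rw [integral_gaussianReal_eq_integral_smul (by norm_num)]
  have : ∀ x : ℝ, gaussianPDFReal 0 1 x • exp (s * x ^ 2 / 2) =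
      (√(2 * π))⁻¹ * exp (-((1 - s) / 2) * x ^ 2) := by
    intro x
    simp only [gaussianPDFReal, smul_eq_mul, NNReal.coe_one, mul_one, sub_zero]
    rw [mul_assoc, ← Real.exp_add]
    ring_nf
  simp only [this]
  rw [integral_const_mul, integral_gaussian]
  rw [show π / ((1 - s) / 2) = (2 * π) / (1 - s) by field_simp, Real.sqrt_div (by positivity)]
  field_simp

lemma integrable_exp_sq_stdG {s : ℝ} (hs : s < 1) :
    Integrable (fun x => exp (s * x ^ 2 / 2)) stdG := by
  refine Integrable.of_integral_ne_zero ?_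
  rw [integral_exp_sq_stdG hs]
  have : 0 < √(1 - s) := Real.sqrt_pos.2 (by linarith)
  positivity

lemma sum_exp_mul_ov {n : ℕ} (σ : Config n) (x : ℝ) :
    ∑ τ, exp (x * ov σ τ) = (2 * cosh x) ^ n := by
  have : ∀ τ : Config n, exp (x * ov σ τ) = ∏ i, exp (x * (spin (σ i) * spin (τ i))) := by
    intro τ
    rw [← Real.exp_sum, ov, Finset.mul_sum]
  simp only [this]
  have h := (Finset.prod_univ_sum (fun _ : Fin n => (Finset.univ : Finset Bool))
    (fun i c => exp (x * (spin (σ i) * spin c)))).symm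
  rw [Fintype.piFinset_univ] at h
  rw [h]
  have : ∀ i, ∑ c, exp (x * (spin (σ i) * spin c)) = 2 * cosh x := by
    intro i
    rw [Real.cosh_eq]
    cases σ i <;> simp [spin] <;> ring
  rw [Finset.prod_congr rfl fun i _ => this i]
  simp

lemma sum_exp_ov_sq_le {n : ℕ} (hn : 1 ≤ n) (σ : Config n) {s : ℝ} (hs0 : 0 ≤ s) (hs : s < 1) :
    ∑ τ, exp (s * ov σ τ ^ 2 / (2 * n)) ≤ 2 ^ n * (√(1 - s))⁻¹ := by
  have hn0 : (0 : ℝ) < n := by exact_mod_cast hn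
  set r := √(s / n) with hr
  have hr2 : r ^ 2 = s / n := Real.sq_sqrt (by positivity)
  have h1 : ∀ τ, exp (s * ov σ τ ^ 2 / (2 * n)) = ∫ x, exp (r * ov σ τ * x) ∂stdG := by
    intro τ
    rw [integral_exp_mul_stdG, mul_pow, hr2]
    congr 1
    field_simp
  have hi : ∀ t : ℝ, Integrable (fun x => exp (t * x)) stdG := by
    intro t
    refine Integrable.of_integral_ne_zero ?_
    rw [integral_exp_mul_stdG]
    exact (exp_pos _).ne'
  simp only [h1]
  rw [← integral_finsetSum _ fun τ _ => hi _]
  have h2 : ∀ x : ℝ, ∑ τ, exp (r * ov σ τ * x) ≤ 2 ^ n * exp (s * x ^ 2 / 2) := by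
    intro x
    have : ∀ τ, exp (r * ov σ τ * x) = exp (r * x * ov σ τ) := fun τ => by ring_nf
    simp only [this, sum_exp_mul_ov, mul_pow]
    gcongr
    calc cosh (r * x) ^ n ≤ exp ((r * x) ^ 2 / 2) ^ n := by
          gcongr
          exact Real.cosh_le_exp_half_sq _
      _ = exp (s * x ^ 2 / 2) := by
          rw [← Real.exp_nat_mul, mul_pow, hr2]
          congr 1
          field_simp
  calc ∫ x, ∑ τ, exp (r * ov σ τ * x) ∂stdG ≤ ∫ x, 2 ^ n * exp (s * x ^ 2 / 2) ∂stdG :=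
        integral_mono (integrable_finsetSum _ fun τ _ => hi _)
          ((integrable_exp_sq_stdG hs).const_mul _) h2
    _ = _ := by rw [integral_const_mul, integral_exp_sq_stdG hs]

end Hubbard

lemma measureReal_good_ge {Ω : Type*} [MeasurableSpace Ω] (P : Measure Ω) [IsProbabilityMeasure P]
    {W R : Ω → ℝ} (hWm : Measurable W) (hRm : Measurable R) (hW : ∀ ω, 0 ≤ W ω)
    (hR : ∀ ω, 0 ≤ R ω) (iW : Integrable W P) (iW2 : Integrable (fun ω => W ω ^ 2) P)
    (iWR : Integrable (fun ω => W ω ^ 2 * R ω) P) {B B' : ℝ} (hB : 0 < B) (hB' : 0 < B')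
    (h1 : ∫ ω, W ω ∂P = 1) (h2 : ∫ ω, W ω ^ 2 ∂P ≤ B) (h3 : ∫ ω, W ω ^ 2 * R ω ∂P ≤ B') :
    1 / (4 * B) ≤ P.real {ω | 1 / 4 ≤ W ω ∧ R ω ≤ 16 * B'} := by
  set A := {ω | 1 / 4 ≤ W ω ∧ R ω ≤ 16 * B'} with hA
  have hAm : MeasurableSet A :=
    (measurableSet_le measurable_const hWm).inter (measurableSet_le hRm measurable_const)
  have key : ∀ ω, W ω ≤ 1 / 4 + W ω ^ 2 * R ω / (4 * B') + W ω ^ 2 / (4 * B) +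
      B * A.indicator 1 ω := by
    intro ω
    have t1 : 0 ≤ W ω ^ 2 * R ω / (4 * B') := by have := hR ω; positivity
    have t2 : 0 ≤ W ω ^ 2 / (4 * B) := by positivity
    have t3 : 0 ≤ B * A.indicator 1 ω :=
      mul_nonneg hB.le (Set.indicator_nonneg (fun _ _ => zero_le_one) _)
    by_cases ha : W ω < 1 / 4
    · linarith
    push Not at ha
    by_cases hr : R ω ≤ 16 * B'
    · have : A.indicator (1 : Ω → ℝ) ω = 1 := by
        have hm : ω ∈ A := And.intro ha hr
        simp [hm]
      rw [this]
      have : W ω ≤ W ω ^ 2 / (4 * B) + B := by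
        have e : W ω ^ 2 / (4 * B) + B - W ω = (W ω - 2 * B) ^ 2 / (4 * B) := by
          field_simp; ring
        have : 0 ≤ (W ω - 2 * B) ^ 2 / (4 * B) := by positivity
        linarith
      linarith
    · push Not at hr
      have : W ω ≤ W ω ^ 2 * R ω / (4 * B') := by
        rw [le_div_iff₀ (by positivity)]
        have a1 : W ω ^ 2 * (16 * B') ≤ W ω ^ 2 * R ω := by gcongr
        nlinarith [mul_nonneg (mul_nonneg (hW ω) hB'.le) (sub_nonneg.2 ha)]
      linarith
  have iI : Integrable (fun ω => B * A.indicator (1 : Ω → ℝ) ω) P :=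
    (((integrable_const (1 : ℝ)).indicator hAm)).const_mul B
  have i1 : Integrable (fun _ : Ω => (1 / 4 : ℝ)) P := integrable_const _
  have i2 : Integrable (fun ω => W ω ^ 2 * R ω / (4 * B')) P := iWR.div_const _
  have i3 : Integrable (fun ω => W ω ^ 2 / (4 * B)) P := iW2.div_const _
  have i12 : Integrable (fun ω => 1 / 4 + W ω ^ 2 * R ω / (4 * B')) P := i1.add i2
  have i123 : Integrable (fun ω => 1 / 4 + W ω ^ 2 * R ω / (4 * B') + W ω ^ 2 / (4 * B)) P :=
    i12.add i3
  have := integral_mono iW (i123.add iI) key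
  simp only [Pi.add_apply] at this
  rw [h1, integral_add i123 iI, integral_add i12 i3, integral_add i1 i2, integral_const_mul, integral_indicator_one hAm, integral_const, probReal_univ,
    one_smul] at this
  simp only [integral_div] at this
  have a2 : (∫ ω, W ω ^ 2 * R ω ∂P) / (4 * B') ≤ 1 / 4 := by
    rw [div_le_div_iff₀ (by positivity) (by norm_num)]; linarith
  have a3 : (∫ ω, W ω ^ 2 ∂P) / (4 * B) ≤ 1 / 4 := by
    rw [div_le_div_iff₀ (by positivity) (by norm_num)]; linarith
  rw [div_le_iff₀ (by positivity)]
  linarith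

section Replicas
variable {S : Type*} [Fintype S] {m : ℕ}

lemma sum_pi_prod (w : Fin m → S → ℝ) :
    ∑ r : Fin m → S, ∏ c, w c (r c) = ∏ c, ∑ s, w c s := by
  classical
  have h := (Finset.prod_univ_sum (fun _ : Fin m => (Finset.univ : Finset S)) w).symm
  rwa [Fintype.piFinset_univ] at h

lemma sum_pi_prod_mul_mul {w : S → ℝ} (hw : ∑ s, w s = 1) {a b : Fin m} (hab : a ≠ b)
    (f g : S → ℝ) :
    ∑ r : Fin m → S, (∏ c, w (r c)) * (f (r a) * g (r b)) =
      (∑ s, w s * f s) * ∑ s, w s * g s := by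
  have e : ∀ r : Fin m → S, (∏ c, w (r c)) * (f (r a) * g (r b)) =
      ∏ c, (w (r c) * ((if c = a then f (r c) else 1) * (if c = b then g (r c) else 1))) := by
    intro r
    rw [Finset.prod_mul_distrib, Finset.prod_mul_distrib]
    simp
  simp only [e]
  rw [sum_pi_prod fun c s => w s * ((if c = a then f s else 1) * (if c = b then g s else 1))]
  have e2 : ∀ c, ∑ s, w s * ((if c = a then f s else 1) * (if c = b then g s else 1)) =
      (if c = a then ∑ s, w s * f s else 1) * (if c = b then ∑ s, w s * g s else 1) := by
    intro c
    by_cases h1 : c = a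
    · have : c ≠ b := fun h => hab (h1.symm.trans h)
      simp [h1, hab]
    · by_cases h2 : c = b
      · simp [h2, hab.symm]
      · simp [h1, h2, hw]
  simp only [e2, Finset.prod_mul_distrib]
  simp

end Replicas

section Replicated
variable {n m : ℕ}

/-- Sum of squared overlaps over all pairs of replicas. -/
def totOv (r : Fin m → Config n) : ℝ := ∑ a, ∑ b, ov (r a) (r b) ^ 2

/-- Coefficients of the replicated Hamiltonian. -/
def repc (b : ℝ) (r : Fin m → Config n) (p : Fin n × Fin n) : ℝ := ∑ a, skc n b (r a) p

lemma repc_sq_le (b : ℝ) (r : Fin m → Config n) :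
    ∑ p, repc b r p ^ 2 ≤ b ^ 2 / 2 * totOv r := by
  have : ∑ p, repc b r p ^ 2 = ∑ a, ∑ c, ∑ p, skc n b (r a) p * skc n b (r c) p := by
    simp only [repc, sq, Finset.sum_mul_sum]
    rw [Finset.sum_comm]
    exact Finset.sum_congr rfl fun a _ => Finset.sum_comm
  rw [this, totOv, Finset.mul_sum]
  refine Finset.sum_le_sum fun a _ => ?_
  rw [Finset.mul_sum]
  refine Finset.sum_le_sum fun c _ => ?_
  rw [skc_dot]
  have : 0 ≤ b ^ 2 * n := by positivity
  linarith

lemma exp_lin_repc (b : ℝ) (r : Fin m → Config n) (g : Fin n × Fin n → ℝ) :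
    exp (lin (repc b r) g) = psum (skc n b) g ^ m * ∏ c, gw (skc n b) g (r c) := by
  have h := (psum_pos (skc n b) g).ne'
  simp only [gw, Finset.prod_div_distrib, Finset.prod_const, Finset.card_univ, Fintype.card_fin,
    ← Real.exp_sum]
  rw [mul_div_cancel₀ _ (pow_ne_zero _ h)]
  congr 1
  simp only [lin, repc, Finset.sum_mul]
  rw [Finset.sum_comm]

lemma sum_gw_mul_sq_ov (b : ℝ) (g : Fin n × Fin n → ℝ) {a c : Fin m} (hac : a ≠ c) :
    ∑ r : Fin m → Config n, (∏ k, gw (skc n b) g (r k)) * ov (r a) (r c) ^ 2 =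
      gib2 b (fun σ τ => ov σ τ ^ 2) g := by
  simp only [gib2, ov_sq, Finset.mul_sum]
  rw [Finset.sum_comm]
  have : ∀ i, ∑ r : Fin m → Config n, ∑ j, (∏ k, gw (skc n b) g (r k)) *
      (spin (r a i) * spin (r a j) * (spin (r c i) * spin (r c j))) =
      ∑ j, (∑ s, gw (skc n b) g s * (spin (s i) * spin (s j))) *
        ∑ s, gw (skc n b) g s * (spin (s i) * spin (s j)) := by
    intro i
    rw [Finset.sum_comm]
    refine Finset.sum_congr rfl fun j _ => ?_
    rw [← sum_pi_prod_mul_mul (sum_gw _ _) hac]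
  simp only [this, Finset.sum_mul_sum]
  have h2 : ∀ σ : Config n, ∑ τ : Config n, ∑ i, ∑ j, gw (skc n b) g σ * gw (skc n b) g τ *
      (spin (σ i) * spin (σ j) * (spin (τ i) * spin (τ j))) = ∑ i, ∑ j, ∑ τ : Config n,
      gw (skc n b) g σ * gw (skc n b) g τ *
      (spin (σ i) * spin (σ j) * (spin (τ i) * spin (τ j))) := by
    intro σ
    rw [Finset.sum_comm]
    exact Finset.sum_congr rfl fun i _ => Finset.sum_comm
  simp only [h2]
  rw [Finset.sum_comm (s := (Finset.univ : Finset (Config n)))]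
  refine Finset.sum_congr rfl fun i _ => ?_
  rw [Finset.sum_comm (s := (Finset.univ : Finset (Config n)))]
  refine Finset.sum_congr rfl fun j _ => Finset.sum_congr rfl fun σ _ =>
    Finset.sum_congr rfl fun τ _ => ?_
  ring

lemma sum_gw_mul_totOv_le (b : ℝ) (g : Fin n × Fin n → ℝ) {M : ℝ}
    (hM : gib2 b (fun σ τ => ov σ τ ^ 2) g ≤ M) (hn : (n : ℝ) ≤ M) :
    ∑ r : Fin n → Config n, (∏ k, gw (skc n b) g (r k)) * totOv r ≤ 2 * M * n ^ 2 := by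
  have hn0 : (0 : ℝ) ≤ n := Nat.cast_nonneg n
  have h1 : ∀ a c : Fin n, ∑ r : Fin n → Config n, (∏ k, gw (skc n b) g (r k)) *
      ov (r a) (r c) ^ 2 ≤ M + if a = c then (n : ℝ) ^ 2 else 0 := by
    intro a c
    by_cases h : a = c
    · subst h
      simp only [ov_self, ← Finset.sum_mul]
      rw [sum_pi_prod fun _ => gw (skc n b) g]
      simp [sum_gw]
      linarith
    · rw [sum_gw_mul_sq_ov b g h]
      simpa [h] using hM
  calc ∑ r : Fin n → Config n, (∏ k, gw (skc n b) g (r k)) * totOv r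
      = ∑ a, ∑ c, ∑ r : Fin n → Config n, (∏ k, gw (skc n b) g (r k)) * ov (r a) (r c) ^ 2 := by
        simp only [totOv, Finset.mul_sum]
        rw [Finset.sum_comm]
        exact Finset.sum_congr rfl fun a _ => Finset.sum_comm
    _ ≤ ∑ a : Fin n, ∑ c : Fin n, (M + if a = c then (n : ℝ) ^ 2 else 0) :=
        Finset.sum_le_sum fun a _ => Finset.sum_le_sum fun c _ => h1 a c
    _ = n ^ 2 * M + n * n ^ 2 := by
        simp [Finset.sum_add_distrib]
        ring
    _ ≤ _ := by nlinarith [mul_le_mul_of_nonneg_left hn (sq_nonneg (n : ℝ))]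

/-- Replicated configurations with small total overlap. -/
abbrev SmallOv (n : ℕ) (M : ℝ) : Type := {r : Fin n → Config n // totOv r ≤ 4 * M * n ^ 2}

instance (M : ℝ) : Fintype (SmallOv n M) := by
  classical
  exact Subtype.fintype _

/-- Coefficients of the replicated Hamiltonian, restricted to small total overlap. -/
def smallc (b M : ℝ) (r : SmallOv n M) : Fin n × Fin n → ℝ := repc b r.1

lemma psum_smallc (b M : ℝ) (g : Fin n × Fin n → ℝ) :
    psum (smallc (n := n) b M) g =
      psum (skc n b) g ^ n * ∑ r : SmallOv n M, ∏ c, gw (skc n b) g (r.1 c) := by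
  simp only [psum.eq_1 (smallc b M), smallc, exp_lin_repc, Finset.mul_sum]

lemma sum_smallOv_eq (M : ℝ) (f : (Fin n → Config n) → ℝ) [DecidablePred fun r : Fin n → Config n => totOv r ≤ 4 * M * n ^ 2] :
    ∑ r : SmallOv n M, f r.1 = ∑ r, if totOv r ≤ 4 * M * n ^ 2 then f r else 0 := by
  rw [← Finset.sum_filter, ← Finset.sum_subtype_eq_sum_filter]
  refine Finset.sum_congr ?_ fun _ _ => rfl
  ext; simp

lemma psum_smallc_le (b M : ℝ) (g : Fin n × Fin n → ℝ) :
    psum (smallc (n := n) b M) g ≤ psum (skc n b) g ^ n := by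
  classical
  rw [psum_smallc]
  refine mul_le_of_le_one_right (pow_nonneg (psum_nonneg _ _) _) ?_
  rw [sum_smallOv_eq M fun r => ∏ c, gw (skc n b) g (r c)]
  have h := sum_pi_prod fun _ : Fin n => gw (skc n b) g
  simp only [sum_gw, Finset.prod_const_one] at h
  rw [← h]
  refine Finset.sum_le_sum fun r _ => ?_
  split_ifs
  · exact le_rfl
  · exact Finset.prod_nonneg fun _ _ => gw_nonneg _ _ _

lemma le_psum_smallc (hn : 1 ≤ n) (b : ℝ) {M : ℝ} (g : Fin n × Fin n → ℝ)
    (hM : gib2 b (fun σ τ => ov σ τ ^ 2) g ≤ M) (hnM : (n : ℝ) ≤ M) :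
    psum (skc n b) g ^ n / 2 ≤ psum (smallc (n := n) b M) g := by
  classical
  have hn0 : (0 : ℝ) < n := by exact_mod_cast hn
  rw [psum_smallc, div_eq_mul_inv]
  refine mul_le_mul_of_nonneg_left ?_ (pow_nonneg (psum_nonneg _ _) _)
  rw [sum_smallOv_eq M fun r => ∏ c, gw (skc n b) g (r c)]
  have h := sum_pi_prod fun _ : Fin n => gw (skc n b) g
  simp only [sum_gw, Finset.prod_const_one] at h
  have hMn : 0 < 4 * M * n ^ 2 := by
    have : 0 < M := hn0.trans_le hnM
    positivity
  have h1 : ∀ r : Fin n → Config n, (∏ k, gw (skc n b) g (r k)) ≤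
      (if totOv r ≤ 4 * M * n ^ 2 then ∏ k, gw (skc n b) g (r k) else 0) +
        (∏ k, gw (skc n b) g (r k)) * totOv r / (4 * M * n ^ 2) := by
    intro r
    have hp : 0 ≤ ∏ k, gw (skc n b) g (r k) := Finset.prod_nonneg fun _ _ => gw_nonneg _ _ _
    have ht : 0 ≤ totOv r :=
      Finset.sum_nonneg fun _ _ => Finset.sum_nonneg fun _ _ => sq_nonneg _
    split_ifs with hc
    · have : 0 ≤ (∏ k, gw (skc n b) g (r k)) * totOv r / (4 * M * n ^ 2) := by positivity
      linarith
    · push Not at hc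
      rw [zero_add, le_div_iff₀ hMn]
      gcongr
  have h2 := Finset.sum_le_sum fun r (_ : r ∈ Finset.univ) => h1 r
  rw [Finset.sum_add_distrib, ← Finset.sum_div, h] at h2
  have h3 : (∑ r : Fin n → Config n, (∏ k, gw (skc n b) g (r k)) * totOv r) / (4 * M * n ^ 2) ≤
      1 / 2 := by
    rw [div_le_div_iff₀ hMn (by norm_num)]
    linarith [sum_gw_mul_totOv_le b g hM hnM]
  linarith

end Replicated

lemma integrable_exp_mul_lse {ι S : Type*} [Fintype ι] [Fintype S] [Nonempty S]
    (a : S → ι → ℝ) (l : ℝ) : Integrable (fun g => exp (l * lse a g)) (stdPi ι) := by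
  have hc : Continuous fun g => exp (l * lse a g) := by fun_prop
  rw [← (measurePreserving_fstF (ι := ι)).integrable_comp hc.aestronglyMeasurable]
  refine integrable_of_le_exp_pairNorm (hc.comp continuous_fstF)
    (exp (|l| * log (Fintype.card S))) (|l| * coefBound a) fun ω => ?_
  rw [Function.comp, abs_of_pos (exp_pos _), ← Real.exp_add]
  refine exp_le_exp.2 ((le_abs_self _).trans ?_)
  rw [abs_mul, mul_assoc, ← mul_add]
  refine mul_le_mul_of_nonneg_left ((abs_lse_le a _).trans ?_) (abs_nonneg _)
  have := mul_le_mul_of_nonneg_left (sum_abs_fstF_le ω) (coefBound_nonneg a)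
  linarith

section Concentration
variable {n : ℕ}

lemma measureReal_psum_le (hn : 1 ≤ n) (b : ℝ) {M : ℝ} (hnM : (n : ℝ) ≤ M) {p : ℝ} (hp : 0 < p)
    (hA : p ≤ (stdPi (Fin n × Fin n)).real
      {g | 1 / 4 ≤ psum (skc n b) g / meanZ n b ∧ gib2 b (fun σ τ => ov σ τ ^ 2) g ≤ M})
    (v : ℝ) {l : ℝ} (hl : 0 ≤ l) :
    (stdPi (Fin n × Fin n)).real {g | psum (skc n b) g ≤ meanZ n b * exp (-v)} ≤
      exp (l ^ 2 * (2 * b ^ 2 * M) - l * (v - 3)) / p := by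
  have hn0 : (0 : ℝ) < n := by exact_mod_cast hn
  have hn1 : (1 : ℝ) ≤ n := by exact_mod_cast hn
  have hz := meanZ_pos n b
  set μ := stdPi (Fin n × Fin n)
  set A := {g | 1 / 4 ≤ psum (skc n b) g / meanZ n b ∧ gib2 b (fun σ τ => ov σ τ ^ 2) g ≤ M}
    with hAdef
  have hne : A.Nonempty := by
    by_contra h
    rw [Set.not_nonempty_iff_eq_empty] at h
    rw [h, measureReal_empty] at hA
    linarith
  have : Nonempty (SmallOv n M) := by
    obtain ⟨g, hg⟩ := hne
    by_contra h
    rw [not_nonempty_iff] at h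
    have h1 := le_psum_smallc hn b g hg.2 hnM
    have h2 : psum (smallc (n := n) b M) g = 0 := by
      unfold psum; exact Finset.sum_of_isEmpty _
    have := pow_pos (psum_pos (skc n b) g) n
    linarith
  set φ := lse (smallc (n := n) b M) with hφ
  set k := l / n with hk
  have hk0 : 0 ≤ k := by positivity
  have hkn : k * n = l := by rw [hk]; field_simp
  have hD := integral_exp_lse_mul_le (smallc (n := n) b M) (D := 2 * b ^ 2 * M * n ^ 2) (fun r => by
    refine (repc_sq_le b r.1).trans ?_
    have := mul_le_mul_of_nonneg_left r.2 (by positivity : 0 ≤ b ^ 2 / 2)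
    linarith) k
  have hEll : 0 < meanZ n b := hz
  have e1 : exp (k * (n * (log (meanZ n b) - log 4) - log 2)) * p ≤ ∫ g, exp (k * φ g) ∂μ := by
    refine le_trans ?_ (mul_meas_ge_le_integral_of_nonneg (ae_of_all _ fun g => (exp_pos _).le)
      (integrable_exp_mul_lse _ _) (exp (k * (n * (log (meanZ n b) - log 4) - log 2))))
    gcongr
    refine hA.trans (measureReal_mono ?_)
    intro g hg
    refine exp_le_exp.2 (mul_le_mul_of_nonneg_left ?_ hk0)
    have h1 := le_psum_smallc hn b g hg.2 hnM
    have h2 := log_le_log (by have := pow_pos (psum_pos (skc n b) g) n; positivity) h1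
    rw [log_div (pow_pos (psum_pos (skc n b) g) n).ne' two_ne_zero, log_pow] at h2
    have h3 : meanZ n b / 4 ≤ psum (skc n b) g := by
      have := hg.1
      rw [le_div_iff₀ hz] at this
      linarith
    have h4 := log_le_log (by positivity) h3
    rw [log_div hz.ne' (by norm_num)] at h4
    have h5 := mul_le_mul_of_nonneg_left h4 hn0.le
    have h6 : φ g = log (psum (smallc b M) g) := rfl
    linarith
  have e2 : exp (-k * (n * (log (meanZ n b) - v))) *
      μ.real {g | psum (skc n b) g ≤ meanZ n b * exp (-v)} ≤ ∫ g, exp (-k * φ g) ∂μ := by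
    refine le_trans ?_ (mul_meas_ge_le_integral_of_nonneg (ae_of_all _ fun g => (exp_pos _).le)
      (integrable_exp_mul_lse _ _) (exp (-k * (n * (log (meanZ n b) - v)))))
    refine mul_le_mul_of_nonneg_left (measureReal_mono (fun g hg => ?_)) (exp_pos _).le
    refine exp_le_exp.2 ?_
    have h1 := log_le_log (psum_pos _ _) (psum_smallc_le b M g)
    rw [log_pow] at h1
    have h2 := log_le_log (psum_pos _ _) (show psum (skc n b) g ≤ meanZ n b * exp (-v) from hg)
    rw [log_mul hz.ne' (exp_pos _).ne', log_exp] at h2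
    have h3 := mul_le_mul_of_nonneg_left h2 hn0.le
    have h4 : φ g ≤ n * (log (meanZ n b) - v) := by
      have : φ g ≤ n * log (psum (skc n b) g) := h1
      linarith
    nlinarith
  have hq : 0 ≤ μ.real {g | psum (skc n b) g ≤ meanZ n b * exp (-v)} := measureReal_nonneg
  have e3 := (mul_le_mul e1 e2 (by positivity) (integral_nonneg fun g => (exp_pos _).le)).trans hD
  rw [le_div_iff₀ hp]
  have hlog4 : log 4 ≤ 2 * log 2 := by
    rw [show (4 : ℝ) = 2 ^ 2 by norm_num, log_pow]; norm_num
  have hlog2 : log 2 ≤ 1 := by have := log_two_lt_d9; linarith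
  have e5 : l * (v - 3) ≤ k * (n * (log (meanZ n b) - log 4) - log 2) +
      -k * (n * (log (meanZ n b) - v)) := by
    have : k * (n * (log (meanZ n b) - log 4) - log 2) + -k * (n * (log (meanZ n b) - v)) =
      k * (n * (v - log 4) - log 2) := by ring
    rw [this, ← hkn, mul_assoc]
    refine mul_le_mul_of_nonneg_left ?_ hk0
    nlinarith
  have e6 : exp (l * (v - 3)) * (μ.real {g | psum (skc n b) g ≤ meanZ n b * exp (-v)} * p) ≤
      exp (k ^ 2 * (2 * b ^ 2 * M * n ^ 2)) := by
    refine le_trans ?_ e3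
    refine (mul_le_mul_of_nonneg_right (exp_le_exp.2 e5) (by positivity)).trans_eq ?_
    rw [Real.exp_add]; ring
  rw [Real.exp_sub, le_div_iff₀ (exp_pos _), mul_comm]
  refine e6.trans_eq ?_
  rw [← hkn]; ring_nf

end Concentration

section Tail
variable {n : ℕ}

@[fun_prop] lemma continuous_gib2 (b : ℝ) (f : Config n → Config n → ℝ) :
    Continuous (gib2 b f) := by
  unfold gib2; fun_prop

lemma gib2_nonneg (b : ℝ) {f : Config n → Config n → ℝ} (hf : ∀ σ τ, 0 ≤ f σ τ)
    (g : Fin n × Fin n → ℝ) : 0 ≤ gib2 b f g :=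
  Finset.sum_nonneg fun _ _ => Finset.sum_nonneg fun _ _ =>
    mul_nonneg (mul_nonneg (gw_nonneg _ _ _) (gw_nonneg _ _ _)) (hf _ _)

lemma gib2_mono (b : ℝ) {f f' : Config n → Config n → ℝ} (hf : ∀ σ τ, f σ τ ≤ f' σ τ)
    (g : Fin n × Fin n → ℝ) : gib2 b f g ≤ gib2 b f' g :=
  Finset.sum_le_sum fun _ _ => Finset.sum_le_sum fun _ _ =>
    mul_le_mul_of_nonneg_left (hf _ _) (mul_nonneg (gw_nonneg _ _ _) (gw_nonneg _ _ _))

lemma gib2_const (b c : ℝ) (g : Fin n × Fin n → ℝ) : gib2 b (fun _ _ => c) g = c := by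
  simp only [gib2, ← Finset.sum_mul, ← Finset.mul_sum, sum_gw, one_mul]

lemma integrable_gib2 (b : ℝ) (f : Config n → Config n → ℝ) :
    Integrable (gib2 b f) (stdPi (Fin n × Fin n)) := by
  set C := ∑ σ, ∑ τ, |f σ τ|
  have hC : ∀ σ τ, |f σ τ| ≤ C := fun σ τ =>
    (Finset.single_le_sum (f := fun τ => |f σ τ|) (fun _ _ => abs_nonneg _)
      (Finset.mem_univ τ)).trans (Finset.single_le_sum (f := fun σ => ∑ τ, |f σ τ|)
      (fun _ _ => Finset.sum_nonneg fun _ _ => abs_nonneg _) (Finset.mem_univ σ))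
  refine Integrable.of_bound (continuous_gib2 b f).aestronglyMeasurable C (ae_of_all _ fun g => ?_)
  rw [Real.norm_eq_abs, abs_le]
  constructor
  · rw [← gib2_const b (-C) g]
    exact gib2_mono b (fun σ τ => (abs_le.1 (hC σ τ)).1) g
  · rw [← gib2_const b C g]
    exact gib2_mono b (fun σ τ => (abs_le.1 (hC σ τ)).2) g

lemma integral_normalized_sq_le (hn : 1 ≤ n) {b η c : ℝ} (hη : 0 < η) (hη1 : η ≤ 1) (hc : 0 ≤ c)
    {f : Config n → Config n → ℝ}
    (hf : ∀ σ τ : Config n, f σ τ * exp (b ^ 2 * (ov σ τ ^ 2 - n) / 2) ≤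
      c * exp ((1 - η ^ 2 / 2) * ov σ τ ^ 2 / (2 * n))) :
    ∫ g, (psum (skc n b) g / meanZ n b) ^ 2 * gib2 b f g ∂stdPi (Fin n × Fin n) ≤ c * (2 / η) := by
  have hz := meanZ_pos n b
  have e : ∀ g, (psum (skc n b) g / meanZ n b) ^ 2 * gib2 b f g =
      (psum (skc n b) g ^ 2 * gib2 b f g) / meanZ n b ^ 2 := fun g => by ring
  simp only [e]
  rw [integral_div, integral_psum_sq_mul_gib2, mul_div_cancel_left₀ _ (pow_pos hz 2).ne']
  have hs : (√(1 - (1 - η ^ 2 / 2)))⁻¹ ≤ 2 / η := by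
    rw [← inv_div η 2]
    refine inv_anti₀ (half_pos hη) ?_
    refine Real.le_sqrt_of_sq_le ?_
    nlinarith [sq_nonneg η]
  have h1 : ∑ σ : Config n, ∑ τ, f σ τ * exp (b ^ 2 * (ov σ τ ^ 2 - n) / 2) ≤
      ∑ _σ : Config n, c * (2 ^ n * (2 / η)) := by
    refine Finset.sum_le_sum fun σ _ => ?_
    calc _ ≤ ∑ τ, c * exp ((1 - η ^ 2 / 2) * ov σ τ ^ 2 / (2 * n)) :=
          Finset.sum_le_sum fun τ _ => hf σ τ
      _ = c * ∑ τ, exp ((1 - η ^ 2 / 2) * ov σ τ ^ 2 / (2 * n)) := by rw [Finset.mul_sum]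
      _ ≤ c * (2 ^ n * (√(1 - (1 - η ^ 2 / 2)))⁻¹) := by
          gcongr
          exact sum_exp_ov_sq_le hn σ (by nlinarith) (by nlinarith)
      _ ≤ _ := by gcongr
  rw [div_le_iff₀ (by positivity)]
  refine h1.trans_eq ?_
  have e4 : (4 : ℝ) ^ n = 2 ^ n * 2 ^ n := by rw [← mul_pow]; norm_num
  simp only [Finset.sum_const, Finset.card_univ, card_config, nsmul_eq_mul, e4]
  push_cast
  ring

lemma integrable_normalized_sq (b : ℝ) (f : Config n → Config n → ℝ) :
    Integrable (fun g => (psum (skc n b) g / meanZ n b) ^ 2 * gib2 b f g)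
      (stdPi (Fin n × Fin n)) := by
  have e : ∀ g, (psum (skc n b) g / meanZ n b) ^ 2 * gib2 b f g =
      (psum (skc n b) g ^ 2 * gib2 b f g) / meanZ n b ^ 2 := fun g => by ring
  simp only [e]
  exact (integrable_psum_sq_mul_gib2 b f).div_const _

/-- Tail bound for the overlap of two replicas in the same disorder. -/
lemma integral_gib2_tail_le (hn : 1 ≤ n) {b η : ℝ} (hη : 0 < η) (hη1 : η ≤ 1)
    (hb : b ^ 2 * n ≤ 1 - η ^ 2) (q : ℝ) {v : ℝ} (hv : 3 ≤ v) :
    ∫ g, gib2 b (fun σ τ => if q < ov σ τ ^ 2 then 1 else 0) g ∂stdPi (Fin n × Fin n) ≤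
      8 / η * exp (-((v - 3) ^ 2 * η ^ 3 / 1024)) +
        2 / η * exp (2 * v - η ^ 2 * q / (4 * n)) := by
  have hn0 : (0 : ℝ) < n := by exact_mod_cast hn
  have hz := meanZ_pos n b
  have hexp : ∀ σ τ : Config n, b ^ 2 * (ov σ τ ^ 2 - n) / 2 + η ^ 2 * ov σ τ ^ 2 / (4 * n) ≤
      (1 - η ^ 2 / 2) * ov σ τ ^ 2 / (2 * n) := by
    intro σ τ
    have h1 : b ^ 2 ≤ (1 - η ^ 2) / n := by rwa [le_div_iff₀ hn0]
    have h2 : b ^ 2 * ov σ τ ^ 2 ≤ (1 - η ^ 2) / n * ov σ τ ^ 2 := by gcongr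
    have h3 : (1 - η ^ 2 / 2) * ov σ τ ^ 2 / (2 * n) =
        (1 - η ^ 2) / n * ov σ τ ^ 2 / 2 + η ^ 2 * ov σ τ ^ 2 / (4 * n) := by field_simp; ring
    have h4 : 0 ≤ b ^ 2 * n := by positivity
    rw [h3]; linarith
  have hc : Continuous fun g => psum (skc n b) g / meanZ n b := by fun_prop
  set μ := stdPi (Fin n × Fin n)
  -- the good event
  have hA := measureReal_good_ge μ (W := fun g => psum (skc n b) g / meanZ n b)
    (R := gib2 b (fun σ τ => ov σ τ ^ 2)) hc.measurable (continuous_gib2 b _).measurable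
    (fun g => div_nonneg (psum_nonneg _ _) hz.le) (gib2_nonneg b fun _ _ => sq_nonneg _)
    ((integrable_psum n b).div_const _)
    (by simpa [gib2_const] using integrable_normalized_sq b (fun _ _ : Config n => (1 : ℝ)))
    (integrable_normalized_sq b _) (B := 2 / η) (B' := 4 * n / η ^ 2 * (2 / η)) (by positivity)
    (by positivity)
    (by rw [integral_div, integral_psum, div_self hz.ne'])
    (by
      have := integral_normalized_sq_le hn (b := b) hη hη1 zero_le_one
        (f := fun _ _ => 1) (fun σ τ => by
          rw [one_mul, one_mul]
          refine exp_le_exp.2 (le_trans ?_ (hexp σ τ))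
          have : 0 ≤ η ^ 2 * ov σ τ ^ 2 / (4 * n) := by positivity
          linarith)
      simpa [gib2_const] using this)
    (by
      refine integral_normalized_sq_le hn (b := b) hη hη1 (by positivity) (fun σ τ => ?_)
      have h1 : ov σ τ ^ 2 ≤ 4 * n / η ^ 2 * exp (η ^ 2 * ov σ τ ^ 2 / (4 * n)) := by
        have := (add_one_le_exp (η ^ 2 * ov σ τ ^ 2 / (4 * n)))
        calc ov σ τ ^ 2 = 4 * n / η ^ 2 * (η ^ 2 * ov σ τ ^ 2 / (4 * n)) := by field_simp
          _ ≤ _ := by gcongr; linarith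
      calc ov σ τ ^ 2 * exp (b ^ 2 * (ov σ τ ^ 2 - n) / 2)
          ≤ 4 * n / η ^ 2 * exp (η ^ 2 * ov σ τ ^ 2 / (4 * n)) *
            exp (b ^ 2 * (ov σ τ ^ 2 - n) / 2) := by gcongr
        _ = 4 * n / η ^ 2 * exp (b ^ 2 * (ov σ τ ^ 2 - n) / 2 + η ^ 2 * ov σ τ ^ 2 / (4 * n)) := by
            rw [Real.exp_add]; ring
        _ ≤ _ := by gcongr; exact hexp σ τ)
  set M : ℝ := 16 * (4 * n / η ^ 2 * (2 / η)) with hM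
  have hM' : M = 128 * n / η ^ 3 := by rw [hM]; field_simp; ring
  have hη3 : η ^ 3 ≤ 1 := pow_le_one₀ hη.le hη1
  have hnM : (n : ℝ) ≤ M := by
    rw [hM', le_div_iff₀ (by positivity)]
    nlinarith
  have hp : (0 : ℝ) < 1 / (4 * (2 / η)) := by positivity
  have hl : 0 ≤ (v - 3) * η ^ 3 / 512 := by
    have : 0 ≤ v - 3 := by linarith
    positivity
  have hconc := measureReal_psum_le hn b hnM hp hA v hl
  have hconc' : μ.real {g | psum (skc n b) g ≤ meanZ n b * exp (-v)} ≤
      8 / η * exp (-((v - 3) ^ 2 * η ^ 3 / 1024)) := by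
    refine hconc.trans ?_
    rw [div_div_eq_mul_div, div_one, show 4 * (2 / η) = 8 / η by ring, mul_comm]
    gcongr
    have hbM : 2 * b ^ 2 * M ≤ 256 / η ^ 3 := by
      rw [hM', ← mul_div_assoc]
      gcongr
      nlinarith [sq_nonneg η]
    have h1 : ((v - 3) * η ^ 3 / 512) ^ 2 * (2 * b ^ 2 * M) ≤
        ((v - 3) * η ^ 3 / 512) ^ 2 * (256 / η ^ 3) := by gcongr
    have h2 : ((v - 3) * η ^ 3 / 512) ^ 2 * (256 / η ^ 3) = (v - 3) ^ 2 * η ^ 3 / 1024 := by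
      field_simp; ring
    have h3 : (v - 3) * η ^ 3 / 512 * (v - 3) = 2 * ((v - 3) ^ 2 * η ^ 3 / 1024) := by ring
    linarith
  set f : Config n → Config n → ℝ := fun σ τ => if q < ov σ τ ^ 2 then 1 else 0 with hf
  have hf0 : ∀ σ τ, 0 ≤ f σ τ := fun σ τ => by simp only [hf]; split_ifs <;> norm_num
  have hf1 : ∀ σ τ, f σ τ ≤ 1 := fun σ τ => by simp only [hf]; split_ifs <;> norm_num
  have hsec : ∫ g, (psum (skc n b) g / meanZ n b) ^ 2 * gib2 b f g ∂μ ≤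
      exp (-(η ^ 2 * q / (4 * n))) * (2 / η) := by
    refine integral_normalized_sq_le hn (b := b) hη hη1 (by positivity) (fun σ τ => ?_)
    simp only [hf]
    split_ifs with h
    · rw [one_mul, ← Real.exp_add]
      refine exp_le_exp.2 ?_
      have : η ^ 2 * q / (4 * n) ≤ η ^ 2 * ov σ τ ^ 2 / (4 * n) := by gcongr
      linarith [hexp σ τ]
    · rw [zero_mul]; positivity
  set E := {g | psum (skc n b) g ≤ meanZ n b * exp (-v)} with hE
  have hEm : MeasurableSet E :=
    measurableSet_le (continuous_psum _).measurable measurable_const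
  have key : ∀ g, gib2 b f g ≤ E.indicator 1 g +
      exp (2 * v) * ((psum (skc n b) g / meanZ n b) ^ 2 * gib2 b f g) := by
    intro g
    have g0 := gib2_nonneg b hf0 g
    have g1 : gib2 b f g ≤ 1 := (gib2_mono b hf1 g).trans_eq (gib2_const b 1 g)
    by_cases hg : g ∈ E
    · rw [Set.indicator_of_mem hg, Pi.one_apply]
      have : 0 ≤ exp (2 * v) * ((psum (skc n b) g / meanZ n b) ^ 2 * gib2 b f g) := by positivity
      linarith
    · rw [Set.indicator_of_notMem hg, zero_add]
      have hg' : meanZ n b * exp (-v) < psum (skc n b) g := not_le.1 hg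
      have h1 : exp (-v) ≤ psum (skc n b) g / meanZ n b := by
        rw [le_div_iff₀ hz]; linarith
      have h2 : exp (-v) ^ 2 ≤ (psum (skc n b) g / meanZ n b) ^ 2 := by gcongr
      have h3 : exp (2 * v) * exp (-v) ^ 2 = 1 := by
        rw [← Real.exp_nat_mul, ← Real.exp_add]; simp
      calc gib2 b f g = exp (2 * v) * (exp (-v) ^ 2 * gib2 b f g) := by
            rw [← mul_assoc, h3, one_mul]
        _ ≤ _ := by gcongr
  have iI : Integrable (E.indicator (1 : (Fin n × Fin n → ℝ) → ℝ)) μ := (integrable_const (1 : ℝ)).indicator hEm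
  have i2 : Integrable (fun g => exp (2 * v) *
      ((psum (skc n b) g / meanZ n b) ^ 2 * gib2 b f g)) μ :=
    (integrable_normalized_sq b f).const_mul _
  refine (integral_mono (integrable_gib2 b f) (iI.add i2) key).trans ?_
  simp only [Pi.add_apply]
  rw [integral_add iI i2, integral_indicator_one hEm, integral_const_mul]
  refine add_le_add hconc' ?_
  calc _ ≤ exp (2 * v) * (exp (-(η ^ 2 * q / (4 * n))) * (2 / η)) := by gcongr
    _ = _ := by rw [sub_eq_add_neg, Real.exp_add]; ring

/-- The overlap moments in a single disorder. -/
def Mom (n : ℕ) (b : ℝ) (k : ℕ) : ℝ :=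
  ∫ g, gib2 b (fun σ τ => ov σ τ ^ k) g ∂stdPi (Fin n × Fin n)

lemma Mom_even_nonneg (n : ℕ) (b : ℝ) (k : ℕ) : 0 ≤ Mom n b (2 * k) :=
  integral_nonneg fun g => gib2_nonneg b (fun _ _ => by rw [pow_mul]; positivity) g

lemma Mom_succ_le (b : ℝ) (q : ℝ) (hq : 0 ≤ q) (k : ℕ) :
    Mom n b (2 * k + 2) ≤ q * Mom n b (2 * k) + n ^ (2 * k + 2) *
      ∫ g, gib2 b (fun σ τ => if q < ov σ τ ^ 2 then 1 else 0) g ∂stdPi (Fin n × Fin n) := by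
  unfold Mom
  rw [← integral_const_mul, ← integral_const_mul, ← integral_add
    ((integrable_gib2 b _).const_mul _) ((integrable_gib2 b _).const_mul _)]
  refine integral_mono (integrable_gib2 b _) (((integrable_gib2 b _).const_mul _).add
    ((integrable_gib2 b _).const_mul _)) fun g => ?_
  have : q * gib2 b (fun σ τ : Config n => ov σ τ ^ (2 * k)) g + n ^ (2 * k + 2) *
      gib2 b (fun σ τ => if q < ov σ τ ^ 2 then 1 else 0) g = gib2 b (fun σ τ : Config n =>
        q * ov σ τ ^ (2 * k) + n ^ (2 * k + 2) * (if q < ov σ τ ^ 2 then 1 else 0)) g := by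
    simp only [gib2, Finset.mul_sum, ← Finset.sum_add_distrib]
    refine Finset.sum_congr rfl fun _ _ => Finset.sum_congr rfl fun _ _ => ?_
    ring
  simp only [Pi.add_apply]
  rw [this]
  refine gib2_mono b (fun σ τ => ?_) g
  have h0 : 0 ≤ ov σ τ ^ (2 * k) := by rw [pow_mul]; positivity
  split_ifs with h
  · have : ov σ τ ^ (2 * k + 2) ≤ n ^ (2 * k + 2) := by
      calc ov σ τ ^ (2 * k + 2) = |ov σ τ| ^ (2 * k + 2) := by
            rw [← Even.pow_abs (⟨k + 1, by ring⟩ : Even (2 * k + 2))]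
        _ ≤ _ := by gcongr; exact abs_ov_le σ τ
    have : 0 ≤ q * ov σ τ ^ (2 * k) := by positivity
    linarith
  · push Not at h
    rw [pow_add]
    nlinarith

end Tail

lemma eventually_pow_mul_exp_neg_le {c r : ℝ} (hc : 0 < c) (hr : 0 < r) (m : ℕ) :
    ∀ᶠ y : ℝ in atTop, y ^ m * exp (-(c * y)) ≤ r := by
  have h1 : Tendsto (fun y : ℝ => c * y) atTop atTop := tendsto_id.const_mul_atTop hc
  have h2 := (tendsto_pow_mul_exp_neg_atTop_nhds_zero m).comp h1
  have h3 := h2.eventually_le_const (show 0 < r * c ^ m by positivity)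
  filter_upwards [h3] with y hy
  simp only [Function.comp, mul_pow] at hy
  have hcm : 0 < c ^ m := by positivity
  have : c ^ m * (y ^ m * exp (-(c * y))) ≤ c ^ m * r := by linarith
  exact le_of_mul_le_mul_left this hcm

/-- Large deviations of the overlap are negligible compared to any power of the size. -/
lemma exists_tail_bound {δ κ : ℝ} (hδ : 0 < δ) (hκ : 0 < κ) :
    ∃ n₀ : ℕ, ∀ n : ℕ, n₀ ≤ n → ∀ b ε : ℝ, 0 < ε → ε ≤ 1 → b ^ 2 * n ≤ 1 - ε → κ ≤ n * ε ^ 3 →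
      (n : ℝ) ^ 6 * ∫ g, gib2 b (fun σ τ : Config n => if δ * ε * n ^ 2 < ov σ τ ^ 2 then 1 else 0) g
        ∂stdPi (Fin n × Fin n) ≤ 1 := by
  set k := κ ^ ((1 : ℝ) / 6) with hk
  have hk0 : 0 < k := by positivity
  have hk6 : k ^ 6 = κ := by
    rw [hk, ← rpow_natCast, ← rpow_mul hκ.le]; norm_num
  set c := min (δ ^ 2 * k ^ 11 / 2 ^ 20) (δ * k ^ 4 / 8) with hc
  have hc0 : 0 < c := by rw [hc]; positivity
  have hy : Tendsto (fun n : ℕ => (n : ℝ) ^ ((1 : ℝ) / 6)) atTop atTop :=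
    (tendsto_rpow_atTop (by norm_num)).comp tendsto_natCast_atTop_atTop
  have hev := hy.eventually ((eventually_pow_mul_exp_neg_le hc0 (show 0 < k / 10 by positivity)
    37).and ((eventually_ge_atTop 1).and (eventually_ge_atTop (96 / (δ * k ^ 4)))))
  obtain ⟨n₀, hn₀⟩ := eventually_atTop.1 hev
  refine ⟨max n₀ 1, fun n hn b ε hε hε1 hb hκn => ?_⟩
  have hn1 : 1 ≤ n := (le_max_right _ _).trans hn
  have hn0 : (0 : ℝ) < n := by exact_mod_cast hn1
  obtain ⟨h1, h2, h3⟩ := hn₀ n ((le_max_left _ _).trans hn)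
  set y := (n : ℝ) ^ ((1 : ℝ) / 6) with hydef
  have hy6 : y ^ 6 = n := by
    rw [hydef, ← rpow_natCast, ← rpow_mul hn0.le]; norm_num
  have hy0 : 0 < y := by linarith
  set η := √ε with hη
  have hη0 : 0 < η := Real.sqrt_pos.2 hε
  have hη2 : η ^ 2 = ε := Real.sq_sqrt hε.le
  have hη1 : η ≤ 1 := Real.sqrt_le_one.2 hε1
  have hηy : k ≤ η * y := by
    refine le_of_pow_le_pow_left₀ (n := 6) (by norm_num) (by positivity) ?_
    rw [hk6, mul_pow, hy6, show η ^ 6 = (η ^ 2) ^ 3 by ring, hη2]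
    linarith
  set v := δ * η ^ 4 * n / 16 with hv
  have hv' : v = δ * (η * y) ^ 4 * y ^ 2 / 16 := by rw [hv, ← hy6]; ring
  have hk4 : k ^ 4 ≤ (η * y) ^ 4 := by gcongr
  have hvy : δ * k ^ 4 * y / 16 ≤ v := by
    have hyy : y ≤ y ^ 2 := by nlinarith
    rw [hv']
    gcongr
  have hv6 : 6 ≤ v := by
    refine le_trans ?_ hvy
    rw [div_le_iff₀ (by positivity)] at h3
    linarith
  have htail := integral_gib2_tail_le (n := n) (b := b) hn1 hη0 hη1 (by rwa [hη2]) (δ * ε * n ^ 2)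
    (show 3 ≤ v by linarith)
  have e1 : exp (-((v - 3) ^ 2 * η ^ 3 / 1024)) ≤ exp (-(c * y)) := by
    refine exp_le_exp.2 (neg_le_neg ?_)
    have a1 : v ^ 2 / 4 ≤ (v - 3) ^ 2 := by nlinarith
    have a2 : v ^ 2 / 4 * η ^ 3 / 1024 ≤ (v - 3) ^ 2 * η ^ 3 / 1024 := by gcongr
    refine le_trans ?_ a2
    have a3 : v ^ 2 / 4 * η ^ 3 / 1024 = δ ^ 2 * (η * y) ^ 11 / 2 ^ 20 * y := by
      rw [hv']; ring
    rw [a3]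
    calc c * y ≤ δ ^ 2 * k ^ 11 / 2 ^ 20 * y := by
          gcongr
          exact min_le_left _ _
      _ ≤ _ := by gcongr
  have e2 : exp (2 * v - η ^ 2 * (δ * ε * n ^ 2) / (4 * n)) ≤ exp (-(c * y)) := by
    refine exp_le_exp.2 ?_
    have a1 : η ^ 2 * (δ * ε * n ^ 2) / (4 * n) = 4 * v := by
      rw [hv, ← hη2]; field_simp; ring
    have a2 : c * y ≤ 2 * v := by
      calc c * y ≤ δ * k ^ 4 / 8 * y := by
            gcongr
            exact min_le_right _ _
        _ = 2 * (δ * k ^ 4 * y / 16) := by ring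
        _ ≤ _ := by gcongr
    linarith
  have hinv : 1 / η ≤ y / k := by
    rw [div_le_div_iff₀ hη0 hk0]; linarith
  calc _ ≤ (n : ℝ) ^ 6 * (8 / η * exp (-(c * y)) + 2 / η * exp (-(c * y))) := by
        refine mul_le_mul_of_nonneg_left (htail.trans ?_) (by positivity)
        gcongr
    _ = (n : ℝ) ^ 6 * (10 * (1 / η) * exp (-(c * y))) := by ring
    _ ≤ (n : ℝ) ^ 6 * (10 * (y / k) * exp (-(c * y))) := by gcongr
    _ = 10 / k * (y ^ 37 * exp (-(c * y))) := by rw [← hy6]; ring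
    _ ≤ 10 / k * (k / 10) := by gcongr
    _ = 1 := by field_simp

/-- Descent of overlap moments. -/
lemma exists_Mom_descent {δ κ : ℝ} (hδ : 0 < δ) (hκ : 0 < κ) :
    ∃ n₀ : ℕ, ∀ n : ℕ, n₀ ≤ n → ∀ b ε : ℝ, 0 < ε → ε ≤ 1 → b ^ 2 * n ≤ 1 - ε → κ ≤ n * ε ^ 3 →
      Mom n b 4 ≤ δ * ε * n ^ 2 * Mom n b 2 + 1 ∧ Mom n b 6 ≤ δ * ε * n ^ 2 * Mom n b 4 + 1 := by
  obtain ⟨n₀, h⟩ := exists_tail_bound hδ hκ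
  refine ⟨max n₀ 1, fun n hn b ε hε hε1 hb hκn => ?_⟩
  have hn1 : (1 : ℝ) ≤ n := by exact_mod_cast (le_max_right _ _).trans hn
  have h1 := h n ((le_max_left _ _).trans hn) b ε hε hε1 hb hκn
  have hq : 0 ≤ δ * ε * n ^ 2 := by positivity
  have h2 := Mom_succ_le (n := n) b _ hq 1
  have h3 := Mom_succ_le (n := n) b _ hq 2
  have h0 : 0 ≤ ∫ g, gib2 b (fun σ τ : Config n => if δ * ε * n ^ 2 < ov σ τ ^ 2 then 1 else 0) g
        ∂stdPi (Fin n × Fin n) :=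
    integral_nonneg fun g => gib2_nonneg b (fun _ _ => by split_ifs <;> norm_num) g
  have h4 : (n : ℝ) ^ 4 ≤ (n : ℝ) ^ 6 := pow_le_pow_right₀ hn1 (by norm_num)
  norm_num at h2 h3
  exact ⟨by nlinarith, by linarith⟩

section RealBounds

lemma abs_exp_sub_quadratic_le {z B : ℝ} (hz : |z| ≤ B) :
    |exp z - (1 + z + z ^ 2 / 2)| ≤ exp B * |z| ^ 3 := by
  have h := Complex.norm_exp_sub_sum_le_norm_mul_exp (z : ℂ) 3
  have e : Complex.exp (z : ℂ) - ∑ m ∈ Finset.range 3, (z : ℂ) ^ m / (m.factorial : ℂ) =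
      ((exp z - (1 + z + z ^ 2 / 2) : ℝ) : ℂ) := by
    simp [Finset.sum_range_succ, Nat.factorial]
  rw [e, Complex.norm_real, Complex.norm_real, Real.norm_eq_abs, Real.norm_eq_abs] at h
  refine h.trans ?_
  rw [mul_comm]
  gcongr

lemma abs_exp_sub_linear_le {z B : ℝ} (hz : |z| ≤ B) :
    |exp z - (1 + z)| ≤ exp B * |z| ^ 2 := by
  have h := Complex.norm_exp_sub_sum_le_norm_mul_exp (z : ℂ) 2
  have e : Complex.exp (z : ℂ) - ∑ m ∈ Finset.range 2, (z : ℂ) ^ m / (m.factorial : ℂ) =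
      ((exp z - (1 + z) : ℝ) : ℂ) := by
    simp [Finset.sum_range_succ, Nat.factorial]
  rw [e, Complex.norm_real, Complex.norm_real, Real.norm_eq_abs, Real.norm_eq_abs] at h
  refine h.trans ?_
  rw [mul_comm]
  gcongr

lemma sum_six_pow_le (m : ℕ) {a b c d e f : ℝ} (ha : 0 ≤ a) (hb : 0 ≤ b) (hc : 0 ≤ c) (hd : 0 ≤ d)
    (he : 0 ≤ e) (hf : 0 ≤ f) :
    (a + b + c + d + e + f) ^ (m + 1) ≤
      6 ^ m * (a ^ (m + 1) + b ^ (m + 1) + c ^ (m + 1) + d ^ (m + 1) + e ^ (m + 1) + f ^ (m + 1)) := by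
  have := pow_sum_div_card_le_sum_pow (s := (Finset.univ : Finset (Fin 6)))
    (f := ![a, b, c, d, e, f]) (fun i _ => by fin_cases i <;> simp <;> assumption) m
  simp only [Fin.sum_univ_six, Finset.card_univ, Fintype.card_fin] at this
  rw [div_le_iff₀ (by positivity)] at this
  simp at this
  linarith

lemma abs_six_le (a b c d e f : ℝ) :
    |a + b + c + d + e + f| ≤ |a| + |b| + |c| + |d| + |e| + |f| := by
  refine (abs_add_le _ _).trans ?_
  gcongr
  refine (abs_add_le _ _).trans ?_
  gcongr
  refine (abs_add_le _ _).trans ?_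
  gcongr
  refine (abs_add_le _ _).trans ?_
  gcongr
  exact abs_add_le _ _

variable {a b c d e f : ℝ}

/-- Error constant in the expansions of the four-point functions. -/
def fourK : ℝ := 36 * exp 6

lemma fourK_pos : 0 < fourK := by unfold fourK; positivity

lemma exp_six_cubic (ha : |a| ≤ 1) (hb : |b| ≤ 1) (hc : |c| ≤ 1) (hd : |d| ≤ 1) (he : |e| ≤ 1)
    (hf : |f| ≤ 1) :
    |exp (a + b + c + d + e + f) - (1 + (a + b + c + d + e + f) + (a + b + c + d + e + f) ^ 2 / 2)| ≤
      fourK * (|a| ^ 3 + |b| ^ 3 + |c| ^ 3 + |d| ^ 3 + |e| ^ 3 + |f| ^ 3) := by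
  have h1 := abs_six_le a b c d e f
  refine (abs_exp_sub_quadratic_le (B := 6) (by linarith)).trans ?_
  have h2 := sum_six_pow_le 2 (abs_nonneg a) (abs_nonneg b) (abs_nonneg c) (abs_nonneg d)
    (abs_nonneg e) (abs_nonneg f)
  have h3 : |a + b + c + d + e + f| ^ 3 ≤ (|a| + |b| + |c| + |d| + |e| + |f|) ^ 3 := by gcongr
  calc _ ≤ exp 6 * (6 ^ 2 * (|a| ^ 3 + |b| ^ 3 + |c| ^ 3 + |d| ^ 3 + |e| ^ 3 + |f| ^ 3)) := by
        gcongr; exact h3.trans h2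
    _ = _ := by unfold fourK; ring

lemma exp_six_quadratic (ha : |a| ≤ 1) (hb : |b| ≤ 1) (hc : |c| ≤ 1) (hd : |d| ≤ 1) (he : |e| ≤ 1)
    (hf : |f| ≤ 1) :
    |exp (a + b + c + d + e + f) - (1 + (a + b + c + d + e + f))| ≤
      fourK * (a ^ 2 + b ^ 2 + c ^ 2 + d ^ 2 + e ^ 2 + f ^ 2) := by
  have h1 := abs_six_le a b c d e f
  refine (abs_exp_sub_linear_le (B := 6) (by linarith)).trans ?_
  have h2 := sum_six_pow_le 1 (abs_nonneg a) (abs_nonneg b) (abs_nonneg c) (abs_nonneg d)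
    (abs_nonneg e) (abs_nonneg f)
  have h3 : |a + b + c + d + e + f| ^ 2 ≤ (|a| + |b| + |c| + |d| + |e| + |f|) ^ 2 := by gcongr
  norm_num at h2
  calc _ ≤ exp 6 * (6 * (a ^ 2 + b ^ 2 + c ^ 2 + d ^ 2 + e ^ 2 + f ^ 2)) := by
        gcongr; exact h3.trans h2
    _ ≤ _ := by
        unfold fourK
        have : 0 ≤ exp 6 * (a ^ 2 + b ^ 2 + c ^ 2 + d ^ 2 + e ^ 2 + f ^ 2) := by positivity
        linarith

lemma abs_avg_eight_le {x1 x2 x3 x4 x5 x6 x7 x8 T : ℝ} (h1 : |x1| ≤ T) (h2 : |x2| ≤ T)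
    (h3 : |x3| ≤ T) (h4 : |x4| ≤ T) (h5 : |x5| ≤ T) (h6 : |x6| ≤ T) (h7 : |x7| ≤ T) (h8 : |x8| ≤ T) :
    |(x1 + x2 + x3 + x4 + x5 + x6 + x7 + x8) / 8| ≤ T ∧
      |(x1 + x2 + x3 + x4 - x5 - x6 - x7 - x8) / 8| ≤ T := by
  rw [abs_le] at h1 h2 h3 h4 h5 h6 h7 h8
  constructor <;> rw [abs_le] <;> constructor <;> linarith [h1.1, h1.2, h2.1, h2.2, h3.1, h3.2,
    h4.1, h4.2, h5.1, h5.2, h6.1, h6.2, h7.1, h7.2, h8.1, h8.2]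

/-- The Gaussian four-point function of two hyperbolic sines and two hyperbolic cosines
(normalised), as a function of the covariances `12, 13, 14, 23, 24, 34`. -/
def fourS (a b c d e f : ℝ) : ℝ :=
  (exp (a + b + c + d + e + f) + exp (a + b + -c + d + -e + -f) + exp (a + -b + c + -d + e + -f) +
    exp (a + -b + -c + -d + -e + f) - exp (-a + b + c + -d + -e + f) -
    exp (-a + b + -c + -d + e + -f) - exp (-a + -b + c + d + -e + -f) -
    exp (-a + -b + -c + d + e + f)) / 8

/-- The Gaussian four-point function of four hyperbolic cosines (normalised). -/
def fourC (a b c d e f : ℝ) : ℝ :=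
  (exp (a + b + c + d + e + f) + exp (a + b + -c + d + -e + -f) + exp (a + -b + c + -d + e + -f) +
    exp (a + -b + -c + -d + -e + f) + exp (-a + b + c + -d + -e + f) +
    exp (-a + b + -c + -d + e + -f) + exp (-a + -b + c + d + -e + -f) +
    exp (-a + -b + -c + d + e + f)) / 8

lemma abs_fourS_sub_le (ha : |a| ≤ 1) (hb : |b| ≤ 1) (hc : |c| ≤ 1) (hd : |d| ≤ 1) (he : |e| ≤ 1)
    (hf : |f| ≤ 1) :
    |fourS a b c d e f - (a + b * d + c * e)| ≤
      fourK * (|a| ^ 3 + |b| ^ 3 + |c| ^ 3 + |d| ^ 3 + |e| ^ 3 + |f| ^ 3) := by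
  have na := (abs_neg a).trans_le ha
  have nb := (abs_neg b).trans_le hb
  have nc := (abs_neg c).trans_le hc
  have nd := (abs_neg d).trans_le hd
  have ne := (abs_neg e).trans_le he
  have nf := (abs_neg f).trans_le hf
  have h1 := exp_six_cubic ha hb hc hd he hf
  have h2 := exp_six_cubic ha hb nc hd ne nf
  have h3 := exp_six_cubic ha nb hc nd he nf
  have h4 := exp_six_cubic ha nb nc nd ne hf
  have h5 := exp_six_cubic na hb hc nd ne hf
  have h6 := exp_six_cubic na hb nc nd he nf
  have h7 := exp_six_cubic na nb hc hd ne nf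
  have h8 := exp_six_cubic na nb nc hd he hf
  simp only [abs_neg] at h2 h3 h4 h5 h6 h7 h8
  refine le_trans (le_of_eq ?_) (abs_avg_eight_le h1 h2 h3 h4 h5 h6 h7 h8).2
  congr 1
  unfold fourS
  ring

lemma abs_fourC_sub_le (ha : |a| ≤ 1) (hb : |b| ≤ 1) (hc : |c| ≤ 1) (hd : |d| ≤ 1) (he : |e| ≤ 1)
    (hf : |f| ≤ 1) :
    |fourC a b c d e f - 1| ≤ fourK * (a ^ 2 + b ^ 2 + c ^ 2 + d ^ 2 + e ^ 2 + f ^ 2) := by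
  have na := (abs_neg a).trans_le ha
  have nb := (abs_neg b).trans_le hb
  have nc := (abs_neg c).trans_le hc
  have nd := (abs_neg d).trans_le hd
  have ne := (abs_neg e).trans_le he
  have nf := (abs_neg f).trans_le hf
  have h1 := exp_six_quadratic ha hb hc hd he hf
  have h2 := exp_six_quadratic ha hb nc hd ne nf
  have h3 := exp_six_quadratic ha nb hc nd he nf
  have h4 := exp_six_quadratic ha nb nc nd ne hf
  have h5 := exp_six_quadratic na hb hc nd ne hf
  have h6 := exp_six_quadratic na hb nc nd he nf
  have h7 := exp_six_quadratic na nb hc hd ne nf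
  have h8 := exp_six_quadratic na nb nc hd he hf
  simp only [neg_sq] at h2 h3 h4 h5 h6 h7 h8
  refine le_trans (le_of_eq ?_) (abs_avg_eight_le h1 h2 h3 h4 h5 h6 h7 h8).1
  congr 1
  unfold fourC
  ring

end RealBounds

section FourPoint
variable {ι : Type*} [Fintype ι]

/-- Linear forms on the pair disorder. -/
def plin (u ω : ι → ℝ × ℝ) : ℝ := ∑ p, ((u p).1 * (ω p).1 + (u p).2 * (ω p).2)

@[fun_prop] lemma continuous_plin (u : ι → ℝ × ℝ) : Continuous (plin u) := by
  unfold plin; fun_prop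

lemma plin_add (u w ω : ι → ℝ × ℝ) : plin (u + w) ω = plin u ω + plin w ω := by
  simp only [plin, ← Finset.sum_add_distrib]
  refine Finset.sum_congr rfl fun p _ => ?_
  simp only [Pi.add_apply, Prod.fst_add, Prod.snd_add]; ring

lemma plin_neg (u ω : ι → ℝ × ℝ) : plin (-u) ω = -plin u ω := by
  simp only [plin, ← Finset.sum_neg_distrib]
  refine Finset.sum_congr rfl fun p _ => ?_
  simp only [Pi.neg_apply, Prod.fst_neg, Prod.snd_neg]; ring

lemma plin_zero (ω : ι → ℝ × ℝ) : plin 0 ω = 0 := by simp [plin]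

lemma plin_comm (u ω : ι → ℝ × ℝ) : plin u ω = plin ω u := by
  simp only [plin, mul_comm]

lemma plin_neg_right (u ω : ι → ℝ × ℝ) : plin ω (-u) = -plin ω u := by
  rw [plin_comm, plin_neg, plin_comm]

lemma integral_exp_plin (u : ι → ℝ × ℝ) :
    ∫ ω, exp (plin u ω) ∂pairPi ι = exp (plin u u / 2) := by
  simp only [plin, Real.exp_sum]
  rw [integral_fintype_prod_eq_prod (𝕜 := ℝ)
    (fun p (x : ℝ × ℝ) => exp ((u p).1 * x.1 + (u p).2 * x.2))]
  have : ∀ p, ∫ x : ℝ × ℝ, exp ((u p).1 * x.1 + (u p).2 * x.2) ∂pairG =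
      exp (((u p).1 * (u p).1 + (u p).2 * (u p).2) / 2) := by
    intro p
    simp only [Real.exp_add]
    rw [integral_prod_mul (fun x => exp ((u p).1 * x)) (fun x => exp ((u p).2 * x)),
      integral_exp_mul_stdG, integral_exp_mul_stdG, ← Real.exp_add]
    congr 1; ring
  simp only [this]
  rw [← Real.exp_sum, Finset.sum_div]

lemma integrable_exp_plin (u : ι → ℝ × ℝ) : Integrable (fun ω => exp (plin u ω)) (pairPi ι) := by
  refine Integrable.of_integral_ne_zero ?_
  rw [integral_exp_plin]
  exact (exp_pos _).ne'

lemma integrable_cosh_plin (u : ι → ℝ × ℝ) :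
    Integrable (fun ω => cosh (plin u ω)) (pairPi ι) := by
  have := ((integrable_exp_plin u).add (integrable_exp_plin (-u))).div_const 2
  refine this.congr (ae_of_all _ fun ω => ?_)
  simp [plin_neg, Real.cosh_eq]

lemma integral_cosh_plin (u : ι → ℝ × ℝ) :
    ∫ ω, cosh (plin u ω) ∂pairPi ι = exp (plin u u / 2) := by
  have e : ∀ ω, cosh (plin u ω) = (exp (plin u ω) + exp (plin (-u) ω)) / 2 := fun ω => by
    rw [plin_neg, Real.cosh_eq]
  simp only [e]
  rw [integral_div, integral_add (integrable_exp_plin u) (integrable_exp_plin (-u)),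
    integral_exp_plin, integral_exp_plin, plin_neg, plin_neg_right, neg_neg]
  ring

/-- Normalised hyperbolic cosine of a Gaussian linear form. -/
def cw (u ω : ι → ℝ × ℝ) : ℝ := exp (-(plin u u / 2)) * cosh (plin u ω)

/-- Normalised hyperbolic sine of a Gaussian linear form. -/
def sw (u ω : ι → ℝ × ℝ) : ℝ := exp (-(plin u u / 2)) * sinh (plin u ω)

@[fun_prop] lemma continuous_cw (u : ι → ℝ × ℝ) : Continuous (cw u) := by
  unfold cw
  have : Continuous cosh := Real.continuous_cosh
  fun_prop

@[fun_prop] lemma continuous_sw (u : ι → ℝ × ℝ) : Continuous (sw u) := by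
  unfold sw
  have : Continuous sinh := Real.continuous_sinh
  fun_prop

lemma cw_zero (ω : ι → ℝ × ℝ) : cw 0 ω = 1 := by simp [cw, plin_zero]

lemma half_le_cw {u : ι → ℝ × ℝ} (hu : plin u u ≤ 1) (ω : ι → ℝ × ℝ) : 1 / 2 ≤ cw u ω := by
  have h1 : 1 / 2 ≤ exp (-(plin u u / 2)) := by
    have := add_one_le_exp (-(plin u u / 2))
    linarith
  have h2 := one_le_cosh (plin u ω)
  unfold cw
  nlinarith

lemma four_identity (x y z w : ι → ℝ × ℝ) (ω : ι → ℝ × ℝ) (s : ℝ) :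
    exp (-((plin x x + plin y y + plin z z + plin w w) / 2)) *
      (cosh (plin (x + y + z + w) ω) + cosh (plin (x + y + z + -w) ω) +
        cosh (plin (x + y + -z + w) ω) + cosh (plin (x + y + -z + -w) ω) +
        s * (cosh (plin (x + -y + z + w) ω) + cosh (plin (x + -y + z + -w) ω) +
        cosh (plin (x + -y + -z + w) ω) + cosh (plin (x + -y + -z + -w) ω))) / 8 =
      ((1 + s) * (cw x ω * cw y ω) + (1 - s) * (sw x ω * sw y ω)) / 2 * cw z ω * cw w ω := by
  have h : exp (-((plin x x + plin y y + plin z z + plin w w) / 2)) =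
      exp (-(plin x x / 2)) * exp (-(plin y y / 2)) * exp (-(plin z z / 2)) *
        exp (-(plin w w / 2)) := by
    simp only [← Real.exp_add]; congr 1; ring
  rw [h]
  simp only [plin_add, plin_neg, cosh_add, sinh_add, cosh_neg, sinh_neg, cw, sw]
  ring

lemma exp_neg_mul_integral (x y z w : ι → ℝ × ℝ) (a b c : ℝ) (ha : a ^ 2 = 1) (hb : b ^ 2 = 1)
    (hc : c ^ 2 = 1) (u : ι → ℝ × ℝ) (hu : ∀ ω, plin u ω = plin x ω + a * plin y ω +
      b * plin z ω + c * plin w ω) :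
    exp (-((plin x x + plin y y + plin z z + plin w w) / 2)) * exp (plin u u / 2) =
      exp (a * plin x y + b * plin x z + c * plin x w + a * b * plin y z + a * c * plin y w +
        b * c * plin z w) := by
  rw [← Real.exp_add]
  congr 1
  have e : plin u u = plin x x + a ^ 2 * plin y y + b ^ 2 * plin z z + c ^ 2 * plin w w +
      2 * (a * plin x y + b * plin x z + c * plin x w + a * b * plin y z + a * c * plin y w +
        b * c * plin z w) := by
    rw [hu, plin_comm x u, plin_comm y u, plin_comm z u, plin_comm w u, hu, hu, hu, hu,
      plin_comm y x, plin_comm z x, plin_comm w x, plin_comm z y, plin_comm w y, plin_comm w z]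
    ring
  rw [e, ha, hb, hc]
  ring

lemma integral_four_aux (x y z w : ι → ℝ × ℝ) (s : ℝ) :
    ∫ ω, ((1 + s) * (cw x ω * cw y ω) + (1 - s) * (sw x ω * sw y ω)) / 2 * cw z ω * cw w ω
      ∂pairPi ι = (1 + s) / 2 * fourC (plin x y) (plin x z) (plin x w) (plin y z) (plin y w)
        (plin z w) + (1 - s) / 2 * fourS (plin x y) (plin x z) (plin x w) (plin y z) (plin y w)
        (plin z w) := by
  simp only [← four_identity]
  have i := integrable_cosh_plin (ι := ι)
  have j1 : Integrable (fun ω => cosh (plin (x + y + z + w) ω) + cosh (plin (x + y + z + -w) ω))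
      (pairPi ι) := (i _).add (i _)
  have j2 : Integrable (fun ω => cosh (plin (x + y + z + w) ω) + cosh (plin (x + y + z + -w) ω) + cosh (plin (x + y + -z + w) ω))
      (pairPi ι) := j1.add (i _)
  have j3 : Integrable (fun ω => cosh (plin (x + y + z + w) ω) + cosh (plin (x + y + z + -w) ω) + cosh (plin (x + y + -z + w) ω) + cosh (plin (x + y + -z + -w) ω))
      (pairPi ι) := j2.add (i _)
  have k1 : Integrable (fun ω => cosh (plin (x + -y + z + w) ω) + cosh (plin (x + -y + z + -w) ω))
      (pairPi ι) := (i _).add (i _)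
  have k2 : Integrable (fun ω => cosh (plin (x + -y + z + w) ω) + cosh (plin (x + -y + z + -w) ω) + cosh (plin (x + -y + -z + w) ω))
      (pairPi ι) := k1.add (i _)
  have k3 : Integrable (fun ω => cosh (plin (x + -y + z + w) ω) + cosh (plin (x + -y + z + -w) ω) + cosh (plin (x + -y + -z + w) ω) + cosh (plin (x + -y + -z + -w) ω))
      (pairPi ι) := k2.add (i _)
  have e1 := exp_neg_mul_integral x y z w 1 1 1 (by norm_num) (by norm_num) (by norm_num)
    (x + y + z + w) (fun ω => by simp only [plin_add, plin_neg]; ring)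
  have e2 := exp_neg_mul_integral x y z w 1 1 (-1) (by norm_num) (by norm_num) (by norm_num)
    (x + y + z + -w) (fun ω => by simp only [plin_add, plin_neg]; ring)
  have e3 := exp_neg_mul_integral x y z w 1 (-1) 1 (by norm_num) (by norm_num) (by norm_num)
    (x + y + -z + w) (fun ω => by simp only [plin_add, plin_neg]; ring)
  have e4 := exp_neg_mul_integral x y z w 1 (-1) (-1) (by norm_num) (by norm_num) (by norm_num)
    (x + y + -z + -w) (fun ω => by simp only [plin_add, plin_neg]; ring)
  have e5 := exp_neg_mul_integral x y z w (-1) 1 1 (by norm_num) (by norm_num) (by norm_num)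
    (x + -y + z + w) (fun ω => by simp only [plin_add, plin_neg]; ring)
  have e6 := exp_neg_mul_integral x y z w (-1) 1 (-1) (by norm_num) (by norm_num) (by norm_num)
    (x + -y + z + -w) (fun ω => by simp only [plin_add, plin_neg]; ring)
  have e7 := exp_neg_mul_integral x y z w (-1) (-1) 1 (by norm_num) (by norm_num) (by norm_num)
    (x + -y + -z + w) (fun ω => by simp only [plin_add, plin_neg]; ring)
  have e8 := exp_neg_mul_integral x y z w (-1) (-1) (-1) (by norm_num) (by norm_num) (by norm_num)
    (x + -y + -z + -w) (fun ω => by simp only [plin_add, plin_neg]; ring)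
  rw [integral_div, integral_const_mul]
  have t1 : ∫ ω, (cosh (plin (x + y + z + w) ω) + cosh (plin (x + y + z + -w) ω) +
        cosh (plin (x + y + -z + w) ω) + cosh (plin (x + y + -z + -w) ω) +
        s * (cosh (plin (x + -y + z + w) ω) + cosh (plin (x + -y + z + -w) ω) +
        cosh (plin (x + -y + -z + w) ω) + cosh (plin (x + -y + -z + -w) ω))) ∂pairPi ι =
      exp (plin (x + y + z + w) (x + y + z + w) / 2) +
      exp (plin (x + y + z + -w) (x + y + z + -w) / 2) +
      exp (plin (x + y + -z + w) (x + y + -z + w) / 2) +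
      exp (plin (x + y + -z + -w) (x + y + -z + -w) / 2) +
      s * (exp (plin (x + -y + z + w) (x + -y + z + w) / 2) +
      exp (plin (x + -y + z + -w) (x + -y + z + -w) / 2) +
      exp (plin (x + -y + -z + w) (x + -y + -z + w) / 2) +
      exp (plin (x + -y + -z + -w) (x + -y + -z + -w) / 2)) := by
    rw [integral_add j3 (k3.const_mul s), integral_add j2 (i _), integral_add j1 (i _),
      integral_add (i _) (i _), integral_const_mul, integral_add k2 (i _), integral_add k1 (i _),
      integral_add (i _) (i _)]
    simp only [integral_cosh_plin]
  rw [t1]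
  simp only [mul_add, mul_left_comm _ s, e1, e2, e3, e4, e5, e6, e7, e8, fourC, fourS]
  ring_nf

lemma integral_sw_sw_cw_cw (x y z w : ι → ℝ × ℝ) :
    ∫ ω, sw x ω * sw y ω * cw z ω * cw w ω ∂pairPi ι =
      fourS (plin x y) (plin x z) (plin x w) (plin y z) (plin y w) (plin z w) := by
  have := integral_four_aux x y z w (-1)
  norm_num at this
  simpa using this

lemma integral_cw_cw_cw_cw (x y z w : ι → ℝ × ℝ) :
    ∫ ω, cw x ω * cw y ω * cw z ω * cw w ω ∂pairPi ι =
      fourC (plin x y) (plin x z) (plin x w) (plin y z) (plin y w) (plin z w) := by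
  have := integral_four_aux x y z w 1
  norm_num at this
  simpa using this

lemma integrable_cw_cw_cw_cw (x y z w : ι → ℝ × ℝ) :
    Integrable (fun ω => cw x ω * cw y ω * cw z ω * cw w ω) (pairPi ι) := by
  refine Integrable.of_integral_ne_zero ?_
  rw [integral_cw_cw_cw_cw]
  unfold fourC
  positivity

lemma abs_sw_le (u ω : ι → ℝ × ℝ) : |sw u ω| ≤ cw u ω := by
  unfold sw cw
  rw [abs_mul, abs_of_pos (exp_pos _)]
  gcongr
  rw [abs_le, Real.cosh_eq, Real.sinh_eq]
  constructor <;> linarith [exp_pos (plin u ω), exp_pos (-plin u ω)]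

lemma cw_pos (u ω : ι → ℝ × ℝ) : 0 < cw u ω := mul_pos (exp_pos _) (cosh_pos _)

lemma integrable_sw_sw_cw_cw (x y z w : ι → ℝ × ℝ) :
    Integrable (fun ω => sw x ω * sw y ω * cw z ω * cw w ω) (pairPi ι) := by
  refine (integrable_cw_cw_cw_cw x y z w).mono'
    (Continuous.aestronglyMeasurable (by fun_prop)) (ae_of_all _ fun ω => ?_)
  have := cw_pos z ω
  have := cw_pos w ω
  rw [Real.norm_eq_abs, abs_mul, abs_mul, abs_mul, abs_of_pos (cw_pos z ω), abs_of_pos (cw_pos w ω)]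
  gcongr
  · exact (cw_pos x ω).le
  · exact abs_sw_le x ω
  · exact abs_sw_le y ω

end FourPoint

section WeightSums
variable {S : Type*} [Fintype S] {m : S → ℝ} {M : ℝ}

lemma sum_three_first (hm : ∑ x, m x = M) (D : S → S → ℝ) :
    ∑ x, ∑ y, ∑ z, m x * m y * m z * D x y = M * ∑ x, ∑ y, m x * m y * D x y := by
  simp only [Finset.mul_sum]
  refine Finset.sum_congr rfl fun x _ => Finset.sum_congr rfl fun y _ => ?_
  rw [← hm, Finset.sum_mul]
  exact Finset.sum_congr rfl fun z _ => by ring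

lemma sum_three_second (hm : ∑ x, m x = M) (D : S → S → ℝ) :
    ∑ x, ∑ y, ∑ z, m x * m y * m z * D x z = M * ∑ x, ∑ y, m x * m y * D x y := by
  rw [← sum_three_first hm]
  refine Finset.sum_congr rfl fun x _ => ?_
  rw [Finset.sum_comm]
  exact Finset.sum_congr rfl fun z _ => Finset.sum_congr rfl fun y _ => by ring

lemma sum_three_third (hm : ∑ x, m x = M) (D : S → S → ℝ) :
    ∑ x, ∑ y, ∑ z, m x * m y * m z * D y z = M * ∑ x, ∑ y, m x * m y * D x y := by
  rw [← hm, Finset.sum_mul]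
  refine Finset.sum_congr rfl fun x _ => ?_
  simp only [Finset.mul_sum]
  exact Finset.sum_congr rfl fun z _ => Finset.sum_congr rfl fun y _ => by ring

lemma sum_three_all (hm : ∑ x, m x = M) (D : S → S → ℝ) :
    ∑ x, ∑ y, ∑ z, m x * m y * m z * (D x y + D x z + D y z) =
      3 * M * ∑ x, ∑ y, m x * m y * D x y := by
  simp only [mul_add, Finset.sum_add_distrib, sum_three_first hm, sum_three_second hm,
    sum_three_third hm]
  ring

lemma sum_four_all (hm : ∑ x, m x = M) (D : S → S → ℝ) :
    ∑ x, ∑ y, ∑ z, ∑ w, m x * m y * m z * m w * (D x y + D x z + D x w + D y z + D y w + D z w) =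
      6 * M ^ 2 * ∑ x, ∑ y, m x * m y * D x y := by
  have h1 : ∀ x, ∑ y, ∑ z, ∑ w, m x * m y * m z * m w *
      (D x y + D x z + D x w + D y z + D y w + D z w) =
      (∑ y, ∑ z, ∑ w, m y * m z * m w * (D y z + D y w + D z w)) * m x +
      3 * M ^ 2 * ∑ y, m x * m y * D x y := by
    intro x
    have a1 : ∑ y, ∑ z, ∑ w, m x * m y * m z * m w * D x y = M ^ 2 * ∑ y, m x * m y * D x y := by
      rw [Finset.mul_sum]
      refine Finset.sum_congr rfl fun y _ => ?_
      rw [pow_two, ← hm, Finset.sum_mul_sum, Finset.sum_mul]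
      refine Finset.sum_congr rfl fun z _ => ?_
      rw [Finset.sum_mul]
      exact Finset.sum_congr rfl fun w _ => by ring
    have a2 : ∑ y, ∑ z, ∑ w, m x * m y * m z * m w * D x z = M ^ 2 * ∑ y, m x * m y * D x y := by
      rw [← a1, Finset.sum_comm]
      exact Finset.sum_congr rfl fun z _ => Finset.sum_congr rfl fun y _ =>
        Finset.sum_congr rfl fun w _ => by ring
    have a3 : ∑ y, ∑ z, ∑ w, m x * m y * m z * m w * D x w = M ^ 2 * ∑ y, m x * m y * D x y := by
      rw [← a2]
      refine Finset.sum_congr rfl fun y _ => ?_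
      rw [Finset.sum_comm]
      exact Finset.sum_congr rfl fun z _ => Finset.sum_congr rfl fun w _ => by ring
    rw [Finset.sum_mul]
    simp only [Finset.sum_mul]
    have : ∀ y z w, m x * m y * m z * m w * (D x y + D x z + D x w + D y z + D y w + D z w) =
        m y * m z * m w * (D y z + D y w + D z w) * m x + (m x * m y * m z * m w * D x y +
        m x * m y * m z * m w * D x z + m x * m y * m z * m w * D x w) := fun y z w => by ring
    simp only [this, Finset.sum_add_distrib, a1, a2, a3]
    ring
  simp only [h1, Finset.sum_add_distrib, ← Finset.mul_sum, hm, sum_three_all hm]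
  ring

end WeightSums

lemma abs_inv_mul_expansion_le {X Y : ℝ} (hX : 1 / 2 ≤ X) (hY : 1 / 2 ≤ Y) :
    |(X * Y)⁻¹ - (1 - (X - 1) - (Y - 1))| ≤ 10 * ((X - 1) ^ 2 + (Y - 1) ^ 2) := by
  have hX0 : 0 < X := by linarith
  have hY0 : 0 < Y := by linarith
  have e : (X * Y)⁻¹ - (1 - (X - 1) - (Y - 1)) =
      ((X - 1) ^ 2 * (Y - 1) / Y * X⁻¹ + (Y - 1) ^ 2 * ((X - 1) / X) * Y⁻¹) +
        ((X - 1) ^ 2 + (X - 1) * (Y - 1) + (Y - 1) ^ 2) * (X⁻¹ * Y⁻¹) := by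
    field_simp; ring
  have b : ∀ Z : ℝ, 1 / 2 ≤ Z → |(Z - 1) / Z| ≤ 1 := fun Z hZ => by
    rw [abs_div, abs_of_pos (by linarith : 0 < Z), div_le_one (by linarith), abs_le]
    constructor <;> linarith
  have iv : ∀ Z : ℝ, 1 / 2 ≤ Z → 0 < Z⁻¹ ∧ Z⁻¹ ≤ 2 := fun Z hZ => by
    refine ⟨inv_pos.2 (by linarith), ?_⟩
    rw [inv_le_comm₀ (by linarith) (by norm_num)]; linarith
  obtain ⟨iX, iX2⟩ := iv X hX
  obtain ⟨iY, iY2⟩ := iv Y hY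
  rw [e]
  have t1 : |(X - 1) ^ 2 * (Y - 1) / Y * X⁻¹| ≤ (X - 1) ^ 2 * 1 * 2 := by
    rw [mul_div_assoc, abs_mul, abs_mul, abs_of_pos iX, abs_of_nonneg (sq_nonneg (X - 1))]
    gcongr
    exact b Y hY
  have t2 : |(Y - 1) ^ 2 * ((X - 1) / X) * Y⁻¹| ≤ (Y - 1) ^ 2 * 1 * 2 := by
    rw [abs_mul, abs_mul, abs_of_pos iY, abs_of_nonneg (sq_nonneg (Y - 1))]
    gcongr
    exact b X hX
  have t3 : |((X - 1) ^ 2 + (X - 1) * (Y - 1) + (Y - 1) ^ 2) * (X⁻¹ * Y⁻¹)| ≤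
      (3 / 2 * ((X - 1) ^ 2 + (Y - 1) ^ 2)) * (2 * 2) := by
    rw [abs_mul, abs_of_pos (mul_pos iX iY)]
    have : |(X - 1) ^ 2 + (X - 1) * (Y - 1) + (Y - 1) ^ 2| ≤
        3 / 2 * ((X - 1) ^ 2 + (Y - 1) ^ 2) := by
      rw [abs_le]
      constructor <;> nlinarith [sq_nonneg (X - 1 + (Y - 1)), sq_nonneg (X - 1 - (Y - 1))]
    gcongr
  have := abs_add_le ((X - 1) ^ 2 * (Y - 1) / Y * X⁻¹) ((Y - 1) ^ 2 * ((X - 1) / X) * Y⁻¹)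
  have := abs_add_le ((X - 1) ^ 2 * (Y - 1) / Y * X⁻¹ + (Y - 1) ^ 2 * ((X - 1) / X) * Y⁻¹)
    (((X - 1) ^ 2 + (X - 1) * (Y - 1) + (Y - 1) ^ 2) * (X⁻¹ * Y⁻¹))
  nlinarith [sq_nonneg (X - 1), sq_nonneg (Y - 1)]

section Row
variable {Ω S : Type*} [MeasurableSpace Ω] [Fintype S] {μ : Measure Ω}

lemma integral_sum_sum {T : Type*} [Fintype T] {f : S → T → Ω → ℝ}
    (hf : ∀ x y, Integrable (f x y) μ) :
    ∫ ω, ∑ x, ∑ y, f x y ω ∂μ = ∑ x, ∑ y, ∫ ω, f x y ω ∂μ := by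
  rw [integral_finsetSum _ fun x _ => integrable_finsetSum _ fun y _ => hf x y]
  exact Finset.sum_congr rfl fun x _ => integral_finsetSum _ fun y _ => hf x y

lemma integrable_sum_sum {T : Type*} [Fintype T] {f : S → T → Ω → ℝ}
    (hf : ∀ x y, Integrable (f x y) μ) : Integrable (fun ω => ∑ x, ∑ y, f x y ω) μ :=
  integrable_finsetSum _ fun x _ => integrable_finsetSum _ fun y _ => hf x y

lemma sum_mul_sub_one {p : S → ℝ} (hp : ∑ x, p x = 1) (c : S → ℝ) :
    ∑ z, p z * c z - 1 = ∑ z, p z * (c z - 1) := by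
  simp only [mul_sub, mul_one, Finset.sum_sub_distrib, hp]

/-- Second-order expansion of a ratio of weighted sums of random variables close to one. -/
lemma abs_row_expansion_le {p q : S → ℝ} {ϖ K D L2 : S → S → ℝ} {L3 : S → S → S → ℝ}
    {c : S → Ω → ℝ} {α : S → S → Ω → ℝ} {κ : ℝ}
    (hp0 : ∀ x, 0 ≤ p x) (hq0 : ∀ x, 0 ≤ q x) (hp : ∑ x, p x = 1) (hq : ∑ x, q x = 1)
    (hϖ0 : ∀ x y, 0 ≤ ϖ x y) (hϖ : ∀ x y, ϖ x y ≤ (p x + q x) * (p y + q y))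
    (hc : ∀ z ω, 1 / 2 ≤ c z ω) (hcm : ∀ z, AEStronglyMeasurable (c z) μ)
    (i2 : ∀ x y, Integrable (α x y) μ)
    (i3 : ∀ x y z, Integrable (fun ω => α x y ω * (c z ω - 1)) μ)
    (i4 : ∀ x y z w, Integrable (fun ω => α x y ω * ((c z ω - 1) * (c w ω - 1))) μ)
    (hA : ∀ ω, |∑ x, ∑ y, p x * q y * K x y * α x y ω| ≤ ∑ x, ∑ y, ϖ x y * K x y * α x y ω)
    (hD : ∀ x y, 0 ≤ D x y) (hκ : 0 ≤ κ)
    (H2 : ∀ x y, |K x y * (∫ ω, α x y ω ∂μ - L2 x y)| ≤ κ * D x y)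
    (H3 : ∀ x y z, |K x y * (∫ ω, α x y ω * (c z ω - 1) ∂μ - L3 x y z)| ≤
      κ * (D x y + D x z + D y z))
    (H4 : ∀ x y z w, |K x y * ∫ ω, α x y ω * ((c z ω - 1) * (c w ω - 1)) ∂μ| ≤
      κ * (D x y + D x z + D x w + D y z + D y w + D z w)) :
    |∫ ω, (∑ x, ∑ y, p x * q y * K x y * α x y ω) *
        ((∑ z, p z * c z ω) * (∑ z, q z * c z ω))⁻¹ ∂μ -
      (∑ x, ∑ y, p x * q y * K x y * L2 x y -
        ∑ x, ∑ y, ∑ z, p x * q y * (p z + q z) * K x y * L3 x y z)| ≤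
      300 * κ * ∑ x, ∑ y, (p x + q x) * (p y + q y) * D x y := by
  set m : S → ℝ := fun x => p x + q x with hm
  have hm0 : ∀ x, 0 ≤ m x := fun x => add_nonneg (hp0 x) (hq0 x)
  have hpm : ∀ x, p x ≤ m x := fun x => le_add_of_nonneg_right (hq0 x)
  have hqm : ∀ x, q x ≤ m x := fun x => le_add_of_nonneg_left (hp0 x)
  have hmsum : ∑ x, m x = 2 := by simp only [hm, Finset.sum_add_distrib, hp, hq]; norm_num
  set W := ∑ x, ∑ y, m x * m y * D x y with hW
  set A : Ω → ℝ := fun ω => ∑ x, ∑ y, p x * q y * K x y * α x y ω with hAdef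
  set X : Ω → ℝ := fun ω => ∑ z, p z * c z ω with hX
  set Y : Ω → ℝ := fun ω => ∑ z, q z * c z ω with hY
  have half : ∀ r : S → ℝ, (∀ x, 0 ≤ r x) → ∑ x, r x = 1 → ∀ ω, 1 / 2 ≤ ∑ z, r z * c z ω := by
    intro r h0 h1 ω
    calc (1 / 2 : ℝ) = ∑ z, r z * (1 / 2) := by rw [← Finset.sum_mul, h1, one_mul]
      _ ≤ _ := Finset.sum_le_sum fun z _ => mul_le_mul_of_nonneg_left (hc z ω) (h0 z)
  have hX2 := half p hp0 hp
  have hY2 := half q hq0 hq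
  have iA : Integrable A μ := integrable_sum_sum fun x y => (i2 x y).const_mul _
  have hAde : ∀ ω, A ω * ((X ω - 1) + (Y ω - 1)) =
      ∑ x, ∑ y, ∑ z, p x * q y * m z * K x y * (α x y ω * (c z ω - 1)) := by
    intro ω
    simp only [hX, hY, sum_mul_sub_one hp, sum_mul_sub_one hq, ← Finset.sum_add_distrib, hAdef,
      Finset.sum_mul]
    refine Finset.sum_congr rfl fun x _ => Finset.sum_congr rfl fun y _ => ?_
    rw [Finset.mul_sum]
    exact Finset.sum_congr rfl fun z _ => by simp only [hm]; ring
  have iAde : Integrable (fun ω => A ω * ((X ω - 1) + (Y ω - 1))) μ := by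
    simp only [hAde]
    exact integrable_sum_sum fun x y => integrable_finsetSum _ fun z _ => (i3 x y z).const_mul _
  have hB : ∀ ω, (∑ x, ∑ y, ϖ x y * K x y * α x y ω) * ((X ω - 1) ^ 2 + (Y ω - 1) ^ 2) =
      ∑ x, ∑ y, ∑ z, ∑ w, ϖ x y * (p z * p w + q z * q w) * K x y *
        (α x y ω * ((c z ω - 1) * (c w ω - 1))) := by
    intro ω
    have sq : ∀ r : S → ℝ, (∑ z, r z * (c z ω - 1)) ^ 2 =
        ∑ z, ∑ w, r z * r w * ((c z ω - 1) * (c w ω - 1)) := fun r => by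
      rw [pow_two, Finset.sum_mul_sum]
      exact Finset.sum_congr rfl fun z _ => Finset.sum_congr rfl fun w _ => by ring
    simp only [hX, hY, sum_mul_sub_one hp, sum_mul_sub_one hq, sq]
    simp only [← Finset.sum_add_distrib, Finset.sum_mul]
    refine Finset.sum_congr rfl fun x _ => Finset.sum_congr rfl fun y _ => ?_
    rw [Finset.mul_sum]
    refine Finset.sum_congr rfl fun z _ => ?_
    rw [Finset.mul_sum]
    exact Finset.sum_congr rfl fun w _ => by ring
  have iB : Integrable (fun ω => (∑ x, ∑ y, ϖ x y * K x y * α x y ω) *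
      ((X ω - 1) ^ 2 + (Y ω - 1) ^ 2)) μ := by
    simp only [hB]
    exact integrable_sum_sum fun x y => integrable_sum_sum fun z w => (i4 x y z w).const_mul _
  have hXm : AEStronglyMeasurable X μ :=
    Finset.aestronglyMeasurable_fun_sum _ fun z _ => (hcm z).const_mul _
  have hYm : AEStronglyMeasurable Y μ :=
    Finset.aestronglyMeasurable_fun_sum _ fun z _ => (hcm z).const_mul _
  have iR : Integrable (fun ω => A ω * (X ω * Y ω)⁻¹) μ := by
    refine (iA.norm.mul_const 4).mono' (iA.1.mul ?_) (ae_of_all _ fun ω => ?_)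
    · exact ((hXm.mul hYm).aemeasurable.inv).aestronglyMeasurable
    · rw [norm_mul]
      gcongr
      have h1 := hX2 ω
      have h2 := hY2 ω
      have h3 : 1 / 4 ≤ X ω * Y ω := by nlinarith
      rw [Real.norm_eq_abs, abs_of_pos (inv_pos.2 (by linarith)),
        inv_le_comm₀ (by linarith) (by norm_num)]
      linarith
  have rem : |∫ ω, A ω * (X ω * Y ω)⁻¹ ∂μ - (∫ ω, A ω ∂μ -
      ∫ ω, A ω * ((X ω - 1) + (Y ω - 1)) ∂μ)| ≤ 10 * (κ * (24 * W)) := by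
    have iAA : Integrable (fun ω => A ω - A ω * ((X ω - 1) + (Y ω - 1))) μ := iA.sub iAde
    rw [← integral_sub iA iAde, ← integral_sub iR iAA, ← Real.norm_eq_abs]
    refine (norm_integral_le_of_norm_le (iB.const_mul 10) (ae_of_all _ fun ω => ?_)).trans ?_
    · have e : A ω * (X ω * Y ω)⁻¹ - (A ω - A ω * ((X ω - 1) + (Y ω - 1))) =
        A ω * ((X ω * Y ω)⁻¹ - (1 - (X ω - 1) - (Y ω - 1))) := by ring
      rw [e, Real.norm_eq_abs, abs_mul]
      have := mul_le_mul (hA ω) (abs_inv_mul_expansion_le (hX2 ω) (hY2 ω)) (abs_nonneg _)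
        ((abs_nonneg _).trans (hA ω))
      exact this.trans (le_of_eq (by ring))
    · rw [integral_const_mul]
      refine mul_le_mul_of_nonneg_left ?_ (by norm_num)
      simp only [hB]
      rw [integral_sum_sum fun x y => integrable_sum_sum fun z w => (i4 x y z w).const_mul _]
      have := sum_four_all hmsum D
      calc _ ≤ ∑ x, ∑ y, ∑ z, ∑ w, κ * (m x * m y * m z * m w *
            (D x y + D x z + D x w + D y z + D y w + D z w)) := by
            refine Finset.sum_le_sum fun x _ => Finset.sum_le_sum fun y _ => ?_
            rw [integral_sum_sum fun z w => (i4 x y z w).const_mul _]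
            refine Finset.sum_le_sum fun z _ => Finset.sum_le_sum fun w _ => ?_
            rw [integral_const_mul, mul_assoc]
            have h1 := (le_abs_self _).trans (H4 x y z w)
            have h2 : p z * p w + q z * q w ≤ m z * m w := by
              simp only [hm]
              nlinarith [mul_nonneg (hp0 z) (hq0 w), mul_nonneg (hq0 z) (hp0 w)]
            have h3 : 0 ≤ p z * p w + q z * q w :=
              add_nonneg (mul_nonneg (hp0 z) (hp0 w)) (mul_nonneg (hq0 z) (hq0 w))
            have h4 : ϖ x y * (p z * p w + q z * q w) ≤ m x * m y * (m z * m w) :=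
              mul_le_mul (hϖ x y) h2 h3 (mul_nonneg (hm0 x) (hm0 y))
            have h5 := (abs_nonneg _).trans (H4 x y z w)
            calc _ ≤ ϖ x y * (p z * p w + q z * q w) *
                  (κ * (D x y + D x z + D x w + D y z + D y w + D z w)) :=
                  mul_le_mul_of_nonneg_left h1 (mul_nonneg (hϖ0 x y) h3)
              _ ≤ _ := mul_le_mul_of_nonneg_right h4 h5
              _ = _ := by ring
        _ = κ * (24 * W) := by
            simp only [← Finset.mul_sum, this]; ring
  have t2 : |∫ ω, A ω ∂μ - ∑ x, ∑ y, p x * q y * K x y * L2 x y| ≤ κ * W := by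
    rw [hAdef, integral_sum_sum fun x y => (i2 x y).const_mul _]
    simp only [← Finset.sum_sub_distrib, hW, Finset.mul_sum]
    refine (Finset.abs_sum_le_sum_abs _ _).trans (Finset.sum_le_sum fun x _ => ?_)
    refine (Finset.abs_sum_le_sum_abs _ _).trans (Finset.sum_le_sum fun y _ => ?_)
    rw [integral_const_mul, ← mul_sub, mul_assoc, abs_mul,
      abs_of_nonneg (mul_nonneg (hp0 x) (hq0 y))]
    have h5 := (abs_nonneg _).trans (H2 x y)
    calc _ ≤ m x * m y * (κ * D x y) :=
          mul_le_mul (mul_le_mul (hpm x) (hqm y) (hq0 y) (hm0 x)) (H2 x y) (abs_nonneg _)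
            (mul_nonneg (hm0 x) (hm0 y))
      _ = _ := by ring
  have t3 : |∫ ω, A ω * ((X ω - 1) + (Y ω - 1)) ∂μ -
      ∑ x, ∑ y, ∑ z, p x * q y * m z * K x y * L3 x y z| ≤ κ * (6 * W) := by
    have e := sum_three_all hmsum D
    have e' : κ * (6 * W) = ∑ x, ∑ y, ∑ z, κ * (m x * m y * m z * (D x y + D x z + D y z)) := by
      simp only [← Finset.mul_sum, e]; ring
    simp only [hAde]
    rw [e', integral_sum_sum fun x y => integrable_finsetSum _ fun z _ => (i3 x y z).const_mul _]
    simp only [← Finset.sum_sub_distrib]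
    refine (Finset.abs_sum_le_sum_abs _ _).trans (Finset.sum_le_sum fun x _ => ?_)
    refine (Finset.abs_sum_le_sum_abs _ _).trans (Finset.sum_le_sum fun y _ => ?_)
    rw [integral_finsetSum _ fun z _ => (i3 x y z).const_mul _, ← Finset.sum_sub_distrib]
    refine (Finset.abs_sum_le_sum_abs _ _).trans (Finset.sum_le_sum fun z _ => ?_)
    rw [integral_const_mul, ← mul_sub, mul_assoc, abs_mul,
      abs_of_nonneg (mul_nonneg (mul_nonneg (hp0 x) (hq0 y)) (hm0 z))]
    calc _ ≤ m x * m y * m z * (κ * (D x y + D x z + D y z)) :=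
          mul_le_mul (mul_le_mul_of_nonneg_right (mul_le_mul (hpm x) (hqm y) (hq0 y) (hm0 x))
            (hm0 z)) (H3 x y z) (abs_nonneg _)
            (mul_nonneg (mul_nonneg (hm0 x) (hm0 y)) (hm0 z))
      _ = _ := by ring
  have hW0 : 0 ≤ κ * W := mul_nonneg hκ (Finset.sum_nonneg fun x _ => Finset.sum_nonneg fun y _ =>
    mul_nonneg (mul_nonneg (hm0 x) (hm0 y)) (hD x y))
  rw [abs_le] at *
  constructor <;> linarith [rem.1, rem.2, t2.1, t2.2, t3.1, t3.2]

end Row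

section ConcreteRow
variable {ι S : Type*} [Fintype ι] [Fintype S]

lemma plin_zero_right (u : ι → ℝ × ℝ) : plin u 0 = 0 := by rw [plin_comm, plin_zero]

lemma pow_mul_pow_le_add {x y : ℝ} (hx : 0 ≤ x) (hy : 0 ≤ y) (k j : ℕ) :
    x ^ k * y ^ j ≤ x ^ (k + j) + y ^ (k + j) := by
  rcases le_total x y with h | h
  · calc x ^ k * y ^ j ≤ y ^ k * y ^ j := by gcongr
      _ = y ^ (k + j) := by ring
      _ ≤ _ := le_add_of_nonneg_left (by positivity)
  · calc x ^ k * y ^ j ≤ x ^ k * x ^ j := by gcongr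
      _ = x ^ (k + j) := by ring
      _ ≤ _ := le_add_of_nonneg_right (by positivity)

lemma abs_pow_mul_pow_le {Q R P B : ℝ} (hB : 0 ≤ B) (hP : |P| ≤ B * |R|) (k j : ℕ) :
    |Q ^ k| * |P| ^ j ≤ B ^ j * |Q| ^ (k + j) + B ^ j * |R| ^ (k + j) := by
  rw [abs_pow]
  calc |Q| ^ k * |P| ^ j ≤ |Q| ^ k * (B * |R|) ^ j := by gcongr
    _ = B ^ j * (|Q| ^ k * |R| ^ j) := by ring
    _ ≤ B ^ j * (|Q| ^ (k + j) + |R| ^ (k + j)) := by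
        gcongr; exact pow_mul_pow_le_add (abs_nonneg _) (abs_nonneg _) k j
    _ = _ := by ring

lemma abs_mul_le_half_sq (P Q : ℝ) : |P * Q| ≤ (P ^ 2 + Q ^ 2) / 2 := by
  rw [abs_le]; constructor <;> nlinarith [sq_nonneg (P + Q), sq_nonneg (P - Q)]

/-- Positive semidefinite kernels: an off-diagonal block is dominated by the diagonal blocks. -/
lemma abs_sum_kernel_le {I : Type*} [Fintype I] (φ : I → S → ℝ) (p q s : S → ℝ) :
    |∑ x, ∑ y, p x * q y * (∑ i, φ i x * φ i y) * (s x * s y)| ≤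
      ∑ x, ∑ y, (p x * p y + q x * q y) / 2 * (∑ i, φ i x * φ i y) * (s x * s y) := by
  have key : ∀ r t : S → ℝ, ∑ x, ∑ y, r x * t y * (∑ i, φ i x * φ i y) * (s x * s y) =
      ∑ i, (∑ x, r x * φ i x * s x) * (∑ y, t y * φ i y * s y) := by
    intro r t
    simp only [Finset.sum_mul_sum]
    simp only [Finset.mul_sum, Finset.sum_mul]
    conv_rhs => rw [Finset.sum_comm]
    refine Finset.sum_congr rfl fun x _ => ?_
    conv_rhs => rw [Finset.sum_comm]
    exact Finset.sum_congr rfl fun y _ => Finset.sum_congr rfl fun i _ => by ring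
  have e : ∑ x, ∑ y, (p x * p y + q x * q y) / 2 * (∑ i, φ i x * φ i y) * (s x * s y) =
      ((∑ x, ∑ y, p x * p y * (∑ i, φ i x * φ i y) * (s x * s y)) +
        ∑ x, ∑ y, q x * q y * (∑ i, φ i x * φ i y) * (s x * s y)) / 2 := by
    simp only [← Finset.sum_add_distrib, Finset.sum_div]
    exact Finset.sum_congr rfl fun x _ => Finset.sum_congr rfl fun y _ => by ring
  rw [e, key, key, key, ← Finset.sum_add_distrib, Finset.sum_div]
  refine (Finset.abs_sum_le_sum_abs _ _).trans (Finset.sum_le_sum fun i _ => ?_)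
  exact (abs_mul_le_half_sq _ _).trans (le_of_eq (by ring))

lemma integrable_four_mul_sub {α : (ι → ℝ × ℝ) → ℝ}
    (h : ∀ z w, Integrable (fun ω => α ω * cw z ω * cw w ω) (pairPi ι)) :
    Integrable α (pairPi ι) ∧
      (∀ z, Integrable (fun ω => α ω * (cw z ω - 1)) (pairPi ι)) ∧
      ∀ z w, Integrable (fun ω => α ω * ((cw z ω - 1) * (cw w ω - 1))) (pairPi ι) := by
  have h0 : Integrable α (pairPi ι) := by simpa only [cw_zero, mul_one] using h 0 0
  have h1 : ∀ z, Integrable (fun ω => α ω * cw z ω) (pairPi ι) := fun z => by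
    simpa only [cw_zero, mul_one] using h z 0
  refine ⟨h0, fun z => ?_, fun z w => ?_⟩
  · exact ((h1 z).sub h0).congr (ae_of_all _ fun ω => by simp only [Pi.sub_apply]; ring)
  · exact ((((h z w).sub (h1 z)).sub (h1 w)).add h0).congr
      (ae_of_all _ fun ω => by simp only [Pi.sub_apply, Pi.add_apply]; ring)

lemma integral_four_mul_sub {α : (ι → ℝ × ℝ) → ℝ}
    (h : ∀ z w, Integrable (fun ω => α ω * cw z ω * cw w ω) (pairPi ι)) (z w : ι → ℝ × ℝ) :
    ∫ ω, α ω * (cw z ω - 1) ∂pairPi ι =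
        ∫ ω, α ω * cw z ω * cw 0 ω ∂pairPi ι - ∫ ω, α ω * cw 0 ω * cw 0 ω ∂pairPi ι ∧
      ∫ ω, α ω * ((cw z ω - 1) * (cw w ω - 1)) ∂pairPi ι =
        ∫ ω, α ω * cw z ω * cw w ω ∂pairPi ι - ∫ ω, α ω * cw z ω * cw 0 ω ∂pairPi ι -
        ∫ ω, α ω * cw 0 ω * cw w ω ∂pairPi ι + ∫ ω, α ω * cw 0 ω * cw 0 ω ∂pairPi ι := by
  constructor
  · rw [← integral_sub (h z 0) (h 0 0)]
    exact integral_congr_ae (ae_of_all _ fun ω => by simp only [cw_zero]; ring)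
  · have j1 : Integrable (fun ω => α ω * cw z ω * cw w ω - α ω * cw z ω * cw 0 ω) (pairPi ι) :=
      (h z w).sub (h z 0)
    have j2 : Integrable (fun ω => α ω * cw z ω * cw w ω - α ω * cw z ω * cw 0 ω -
        α ω * cw 0 ω * cw w ω) (pairPi ι) := j1.sub (h 0 w)
    rw [← integral_sub (h z w) (h z 0), ← integral_sub j1 (h 0 w), ← integral_add j2 (h 0 0)]
    exact integral_congr_ae (ae_of_all _ fun ω => by simp only [cw_zero]; ring)

variable {u : S → ι → ℝ × ℝ} {Q : S → S → ℝ} {B : ℝ} {p q : S → ℝ} {k : ℕ}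

/-- Cavity expansion of the cosine (even) observable. -/
lemma abs_row_cosh_le (hB : 0 ≤ B) (h1 : ∀ x y, |plin (u x) (u y)| ≤ 1)
    (hu : ∀ x y, |plin (u x) (u y)| ≤ B * |Q x y|) (hk : Even k)
    (hp0 : ∀ x, 0 ≤ p x) (hq0 : ∀ x, 0 ≤ q x) (hp : ∑ x, p x = 1) (hq : ∑ x, q x = 1) :
    |∫ ω, (∑ x, ∑ y, p x * q y * Q x y ^ k * (cw (u x) ω * cw (u y) ω)) *
        ((∑ z, p z * cw (u z) ω) * (∑ z, q z * cw (u z) ω))⁻¹ ∂pairPi ι -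
      ∑ x, ∑ y, p x * q y * Q x y ^ k| ≤
      300 * (28 * fourK) * ∑ x, ∑ y, (p x + q x) * (p y + q y) * (B ^ 2 * |Q x y| ^ (k + 2)) := by
  have hK := fourK_pos
  have ii := fun x y => integrable_four_mul_sub (α := fun ω => cw (u x) ω * cw (u y) ω)
    (fun z w => integrable_cw_cw_cw_cw (u x) (u y) z w)
  have jj := fun x y z w => integral_four_mul_sub (α := fun ω => cw (u x) ω * cw (u y) ω)
    (fun z w => integrable_cw_cw_cw_cw (u x) (u y) z w) z w
  have n0 : |(0 : ℝ)| ≤ 1 := by simp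
  have dom : ∀ x y z w, |Q x y ^ k| * plin (u z) (u w) ^ 2 ≤
      B ^ 2 * |Q x y| ^ (k + 2) + B ^ 2 * |Q z w| ^ (k + 2) := fun x y z w => by
    rw [← sq_abs]; exact abs_pow_mul_pow_le hB (hu z w) k 2
  have D0 : ∀ x y, 0 ≤ B ^ 2 * |Q x y| ^ (k + 2) := fun x y => by positivity
  have := abs_row_expansion_le (μ := pairPi ι) (p := p) (q := q) (ϖ := fun x y => p x * q y)
    (K := fun x y => Q x y ^ k) (D := fun x y => B ^ 2 * |Q x y| ^ (k + 2))
    (L2 := fun _ _ => 1) (L3 := fun _ _ _ => 0) (c := fun z ω => cw (u z) ω)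
    (α := fun x y ω => cw (u x) ω * cw (u y) ω) (κ := 28 * fourK) hp0 hq0 hp hq
    (fun x y => mul_nonneg (hp0 x) (hq0 y))
    (fun x y => mul_le_mul (le_add_of_nonneg_right (hq0 x)) (le_add_of_nonneg_left (hp0 y))
      (hq0 y) (add_nonneg (hp0 x) (hq0 x)))
    (fun z ω => half_le_cw ((le_abs_self _).trans (h1 z z)) ω)
    (fun z => (continuous_cw (u z)).aestronglyMeasurable)
    (fun x y => (ii x y).1) (fun x y z => (ii x y).2.1 (u z)) (fun x y z w => (ii x y).2.2 _ _)
    (fun ω => (abs_of_nonneg (Finset.sum_nonneg fun x _ => Finset.sum_nonneg fun y _ => by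
      have := cw_pos (u x) ω
      have := cw_pos (u y) ω
      have := hp0 x
      have := hq0 y
      have := hk.pow_nonneg (Q x y)
      positivity)).le)
    D0 (by positivity) ?_ ?_ ?_
  · simpa using this
  · intro x y
    have e := integral_cw_cw_cw_cw (u x) (u y) 0 0
    simp only [cw_zero, mul_one, plin_zero_right] at e
    rw [e, abs_mul]
    have := abs_fourC_sub_le (h1 x y) n0 n0 n0 n0 n0
    have d1 := dom x y x y
    calc _ ≤ |Q x y ^ k| * _ := mul_le_mul_of_nonneg_left this (abs_nonneg _)
      _ = fourK * (|Q x y ^ k| * plin (u x) (u y) ^ 2) := by ring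
      _ ≤ fourK * (28 * (B ^ 2 * |Q x y| ^ (k + 2))) :=
          mul_le_mul_of_nonneg_left (by linarith [D0 x y]) hK.le
      _ = _ := by ring
  · intro x y z
    rw [(jj x y (u z) 0).1, integral_cw_cw_cw_cw, integral_cw_cw_cw_cw, abs_mul]
    simp only [plin_zero_right, plin_zero, sub_zero]
    have e1 := abs_fourC_sub_le (h1 x y) (h1 x z) n0 (h1 y z) n0 n0
    have e2 := abs_fourC_sub_le (h1 x y) n0 n0 n0 n0 n0
    have e3 : |fourC (plin (u x) (u y)) (plin (u x) (u z)) 0 (plin (u y) (u z)) 0 0 -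
        fourC (plin (u x) (u y)) 0 0 0 0 0| ≤ 2 * (fourK * (plin (u x) (u y) ^ 2 +
          plin (u x) (u z) ^ 2 + plin (u y) (u z) ^ 2)) := by
      have : 0 ≤ fourK * (plin (u x) (u z) ^ 2 + plin (u y) (u z) ^ 2) := by positivity
      rw [abs_le] at *
      constructor <;> linarith [e1.1, e1.2, e2.1, e2.2]
    have d1 := dom x y x y
    have d2 := dom x y x z
    have d3 := dom x y y z
    calc _ ≤ |Q x y ^ k| * _ := mul_le_mul_of_nonneg_left e3 (abs_nonneg _)
      _ = 2 * fourK * (|Q x y ^ k| * plin (u x) (u y) ^ 2 + |Q x y ^ k| * plin (u x) (u z) ^ 2 +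
          |Q x y ^ k| * plin (u y) (u z) ^ 2) := by ring
      _ ≤ 2 * fourK * (14 * (B ^ 2 * |Q x y| ^ (k + 2) + B ^ 2 * |Q x z| ^ (k + 2) +
          B ^ 2 * |Q y z| ^ (k + 2))) := by
          gcongr; linarith [D0 x y, D0 x z, D0 y z]
      _ = _ := by ring
  · intro x y z w
    rw [(jj x y (u z) (u w)).2, integral_cw_cw_cw_cw, integral_cw_cw_cw_cw, integral_cw_cw_cw_cw,
      integral_cw_cw_cw_cw, abs_mul]
    simp only [plin_zero_right, plin_zero]
    have e1 := abs_fourC_sub_le (h1 x y) (h1 x z) (h1 x w) (h1 y z) (h1 y w) (h1 z w)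
    have e2 := abs_fourC_sub_le (h1 x y) (h1 x z) n0 (h1 y z) n0 n0
    have e3 := abs_fourC_sub_le (h1 x y) n0 (h1 x w) n0 (h1 y w) n0
    have e4 := abs_fourC_sub_le (h1 x y) n0 n0 n0 n0 n0
    set T := plin (u x) (u y) ^ 2 + plin (u x) (u z) ^ 2 + plin (u x) (u w) ^ 2 +
      plin (u y) (u z) ^ 2 + plin (u y) (u w) ^ 2 + plin (u z) (u w) ^ 2 with hT
    have m2 : fourK * (plin (u x) (u y) ^ 2 + plin (u x) (u z) ^ 2 + 0 ^ 2 +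
      plin (u y) (u z) ^ 2 + 0 ^ 2 + 0 ^ 2) ≤ fourK * T := by
      gcongr <;> nlinarith [sq_nonneg (plin (u x) (u w)), sq_nonneg (plin (u y) (u w)),
        sq_nonneg (plin (u z) (u w))]
    have m3 : fourK * (plin (u x) (u y) ^ 2 + 0 ^ 2 + plin (u x) (u w) ^ 2 + 0 ^ 2 +
      plin (u y) (u w) ^ 2 + 0 ^ 2) ≤ fourK * T := by
      gcongr <;> nlinarith [sq_nonneg (plin (u x) (u z)), sq_nonneg (plin (u y) (u z)),
        sq_nonneg (plin (u z) (u w))]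
    have m4 : fourK * (plin (u x) (u y) ^ 2 + 0 ^ 2 + 0 ^ 2 + 0 ^ 2 + 0 ^ 2 + 0 ^ 2) ≤
        fourK * T := by
      refine mul_le_mul_of_nonneg_left ?_ hK.le
      nlinarith [sq_nonneg (plin (u x) (u w)), sq_nonneg (plin (u y) (u w)),
        sq_nonneg (plin (u z) (u w)), sq_nonneg (plin (u x) (u z)), sq_nonneg (plin (u y) (u z))]
    have key : ∀ A B C D R : ℝ, |A - 1| ≤ R → |B - 1| ≤ R → |C - 1| ≤ R → |D - 1| ≤ R →
        |A - B - C + D| ≤ 4 * R := fun A B C D R ha hb hc hd => by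
      rw [abs_le] at *
      constructor <;> linarith [ha.1, ha.2, hb.1, hb.2, hc.1, hc.2, hd.1, hd.2]
    have e5 := key _ _ _ _ _ e1 (e2.trans m2) (e3.trans m3) (e4.trans m4)
    have d1 := dom x y x y
    have d2 := dom x y x z
    have d3 := dom x y x w
    have d4 := dom x y y z
    have d5 := dom x y y w
    have d6 := dom x y z w
    calc _ ≤ |Q x y ^ k| * _ := mul_le_mul_of_nonneg_left e5 (abs_nonneg _)
      _ = 4 * fourK * (|Q x y ^ k| * plin (u x) (u y) ^ 2 + |Q x y ^ k| * plin (u x) (u z) ^ 2 +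
          |Q x y ^ k| * plin (u x) (u w) ^ 2 + |Q x y ^ k| * plin (u y) (u z) ^ 2 +
          |Q x y ^ k| * plin (u y) (u w) ^ 2 + |Q x y ^ k| * plin (u z) (u w) ^ 2) := by
          rw [hT]; ring
      _ ≤ 4 * fourK * (7 * (B ^ 2 * |Q x y| ^ (k + 2) + B ^ 2 * |Q x z| ^ (k + 2) +
          B ^ 2 * |Q x w| ^ (k + 2) + B ^ 2 * |Q y z| ^ (k + 2) + B ^ 2 * |Q y w| ^ (k + 2) +
          B ^ 2 * |Q z w| ^ (k + 2))) := by
          gcongr; linarith [D0 x y, D0 x z, D0 y z, D0 x w, D0 y w, D0 z w]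
      _ = _ := by ring

/-- Cavity expansion of the sine (odd) observable. -/
lemma abs_row_sinh_le {I : Type*} [Fintype I] (φ : I → S → ℝ) (hB : 0 ≤ B)
    (h1 : ∀ x y, |plin (u x) (u y)| ≤ 1)
    (hu : ∀ x y, |plin (u x) (u y)| ≤ B * |Q x y|)
    (hφ : ∀ x y, Q x y ^ k = ∑ i, φ i x * φ i y)
    (hp0 : ∀ x, 0 ≤ p x) (hq0 : ∀ x, 0 ≤ q x) (hp : ∑ x, p x = 1) (hq : ∑ x, q x = 1) :
    |∫ ω, (∑ x, ∑ y, p x * q y * Q x y ^ k * (sw (u x) ω * sw (u y) ω)) *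
        ((∑ z, p z * cw (u z) ω) * (∑ z, q z * cw (u z) ω))⁻¹ ∂pairPi ι -
      (∑ x, ∑ y, p x * q y * Q x y ^ k * plin (u x) (u y) -
        ∑ x, ∑ y, ∑ z, p x * q y * (p z + q z) * Q x y ^ k *
          (plin (u x) (u z) * plin (u y) (u z)))| ≤
      300 * (28 * fourK) * ∑ x, ∑ y, (p x + q x) * (p y + q y) * (B ^ 3 * |Q x y| ^ (k + 3)) := by
  have hK := fourK_pos
  have ii := fun x y => integrable_four_mul_sub (α := fun ω => sw (u x) ω * sw (u y) ω)
    (fun z w => integrable_sw_sw_cw_cw (u x) (u y) z w)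
  have jj := fun x y z w => integral_four_mul_sub (α := fun ω => sw (u x) ω * sw (u y) ω)
    (fun z w => integrable_sw_sw_cw_cw (u x) (u y) z w) z w
  have n0 : |(0 : ℝ)| ≤ 1 := by simp
  have dom : ∀ x y z w, |Q x y ^ k| * |plin (u z) (u w)| ^ 3 ≤
      B ^ 3 * |Q x y| ^ (k + 3) + B ^ 3 * |Q z w| ^ (k + 3) := fun x y z w =>
    abs_pow_mul_pow_le hB (hu z w) k 3
  have D0 : ∀ x y, 0 ≤ B ^ 3 * |Q x y| ^ (k + 3) := fun x y => by positivity
  refine abs_row_expansion_le (μ := pairPi ι) (p := p) (q := q)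
    (ϖ := fun x y => (p x * p y + q x * q y) / 2)
    (K := fun x y => Q x y ^ k) (D := fun x y => B ^ 3 * |Q x y| ^ (k + 3))
    (L2 := fun x y => plin (u x) (u y)) (L3 := fun x y z => plin (u x) (u z) * plin (u y) (u z))
    (c := fun z ω => cw (u z) ω)
    (α := fun x y ω => sw (u x) ω * sw (u y) ω) (κ := 28 * fourK) hp0 hq0 hp hq
    (fun x y => ?_) (fun x y => ?_)
    (fun z ω => half_le_cw ((le_abs_self _).trans (h1 z z)) ω)
    (fun z => (continuous_cw (u z)).aestronglyMeasurable)
    (fun x y => (ii x y).1) (fun x y z => (ii x y).2.1 (u z)) (fun x y z w => (ii x y).2.2 _ _)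
    (fun ω => ?_) D0 (by positivity) ?_ ?_ ?_
  · have := hp0 x; have := hp0 y; have := hq0 x; have := hq0 y
    positivity
  · nlinarith [mul_nonneg (hp0 x) (hp0 y), mul_nonneg (hp0 x) (hq0 y), mul_nonneg (hq0 x) (hp0 y),
      mul_nonneg (hq0 x) (hq0 y)]
  · simp only [hφ]
    exact abs_sum_kernel_le φ p q fun x => sw (u x) ω
  · intro x y
    have e := integral_sw_sw_cw_cw (u x) (u y) 0 0
    simp only [cw_zero, mul_one, plin_zero_right] at e
    rw [e, abs_mul]
    have := abs_fourS_sub_le (h1 x y) n0 n0 n0 n0 n0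
    simp only [mul_zero, add_zero, abs_zero, ne_eq, OfNat.ofNat_ne_zero, not_false_eq_true,
      zero_pow] at this
    have d1 := dom x y x y
    calc _ ≤ |Q x y ^ k| * _ := mul_le_mul_of_nonneg_left this (abs_nonneg _)
      _ = fourK * (|Q x y ^ k| * |plin (u x) (u y)| ^ 3) := by ring
      _ ≤ fourK * (28 * (B ^ 3 * |Q x y| ^ (k + 3))) :=
          mul_le_mul_of_nonneg_left (by linarith [D0 x y]) hK.le
      _ = _ := by ring
  · intro x y z
    rw [(jj x y (u z) 0).1, integral_sw_sw_cw_cw, integral_sw_sw_cw_cw, abs_mul]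
    simp only [plin_zero_right, plin_zero]
    have e1 := abs_fourS_sub_le (h1 x y) (h1 x z) n0 (h1 y z) n0 n0
    have e2 := abs_fourS_sub_le (h1 x y) n0 n0 n0 n0 n0
    simp only [mul_zero, add_zero, abs_zero, ne_eq, OfNat.ofNat_ne_zero, not_false_eq_true,
      zero_pow] at e1 e2
    have e3 : |fourS (plin (u x) (u y)) (plin (u x) (u z)) 0 (plin (u y) (u z)) 0 0 -
        fourS (plin (u x) (u y)) 0 0 0 0 0 - plin (u x) (u z) * plin (u y) (u z)| ≤
        2 * (fourK * (|plin (u x) (u y)| ^ 3 +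
          |plin (u x) (u z)| ^ 3 + |plin (u y) (u z)| ^ 3)) := by
      have : 0 ≤ fourK * (|plin (u x) (u z)| ^ 3 + |plin (u y) (u z)| ^ 3) := by positivity
      rw [abs_le] at e1 e2 ⊢
      constructor <;> linarith [e1.1, e1.2, e2.1, e2.2]
    have d1 := dom x y x y
    have d2 := dom x y x z
    have d3 := dom x y y z
    calc _ ≤ |Q x y ^ k| * _ := mul_le_mul_of_nonneg_left e3 (abs_nonneg _)
      _ = 2 * fourK * (|Q x y ^ k| * |plin (u x) (u y)| ^ 3 +
          |Q x y ^ k| * |plin (u x) (u z)| ^ 3 +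
          |Q x y ^ k| * |plin (u y) (u z)| ^ 3) := by ring
      _ ≤ 2 * fourK * (14 * (B ^ 3 * |Q x y| ^ (k + 3) + B ^ 3 * |Q x z| ^ (k + 3) +
          B ^ 3 * |Q y z| ^ (k + 3))) := by
          gcongr; linarith [D0 x y, D0 x z, D0 y z]
      _ = _ := by ring
  · intro x y z w
    rw [(jj x y (u z) (u w)).2, integral_sw_sw_cw_cw, integral_sw_sw_cw_cw, integral_sw_sw_cw_cw,
      integral_sw_sw_cw_cw, abs_mul]
    simp only [plin_zero_right, plin_zero]
    have e1 := abs_fourS_sub_le (h1 x y) (h1 x z) (h1 x w) (h1 y z) (h1 y w) (h1 z w)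
    have e2 := abs_fourS_sub_le (h1 x y) (h1 x z) n0 (h1 y z) n0 n0
    have e3 := abs_fourS_sub_le (h1 x y) n0 (h1 x w) n0 (h1 y w) n0
    have e4 := abs_fourS_sub_le (h1 x y) n0 n0 n0 n0 n0
    simp only [mul_zero, add_zero, abs_zero, ne_eq, OfNat.ofNat_ne_zero, not_false_eq_true,
      zero_pow] at e2 e3 e4
    set T := |plin (u x) (u y)| ^ 3 + |plin (u x) (u z)| ^ 3 + |plin (u x) (u w)| ^ 3 +
      |plin (u y) (u z)| ^ 3 + |plin (u y) (u w)| ^ 3 + |plin (u z) (u w)| ^ 3 with hT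
    have t0 : ∀ x y, 0 ≤ |plin (u x) (u y)| ^ 3 := fun x y => by positivity
    have m2 : fourK * (|plin (u x) (u y)| ^ 3 + |plin (u x) (u z)| ^ 3 +
      |plin (u y) (u z)| ^ 3) ≤ fourK * T :=
      mul_le_mul_of_nonneg_left (by linarith [t0 x w, t0 y w, t0 z w]) hK.le
    have m3 : fourK * (|plin (u x) (u y)| ^ 3 + |plin (u x) (u w)| ^ 3 +
      |plin (u y) (u w)| ^ 3) ≤ fourK * T :=
      mul_le_mul_of_nonneg_left (by linarith [t0 x z, t0 y z, t0 z w]) hK.le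
    have m4 : fourK * |plin (u x) (u y)| ^ 3 ≤ fourK * T :=
      mul_le_mul_of_nonneg_left
        (by linarith [t0 x z, t0 y z, t0 z w, t0 x w, t0 y w]) hK.le
    have key : ∀ A B C D a b c R : ℝ, |A - (a + b + c)| ≤ R → |B - (a + b)| ≤ R →
        |C - (a + c)| ≤ R → |D - a| ≤ R →
        |A - B - C + D| ≤ 4 * R := fun A B C D a b c R ha hb hc hd => by
      rw [abs_le] at *
      constructor <;> linarith [ha.1, ha.2, hb.1, hb.2, hc.1, hc.2, hd.1, hd.2]
    have e5 := key _ _ _ _ _ _ _ _ e1 (e2.trans m2) (by simpa using e3.trans m3) (e4.trans m4)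
    have d1 := dom x y x y
    have d2 := dom x y x z
    have d3 := dom x y x w
    have d4 := dom x y y z
    have d5 := dom x y y w
    have d6 := dom x y z w
    calc _ ≤ |Q x y ^ k| * _ := mul_le_mul_of_nonneg_left e5 (abs_nonneg _)
      _ = 4 * fourK * (|Q x y ^ k| * |plin (u x) (u y)| ^ 3 +
          |Q x y ^ k| * |plin (u x) (u z)| ^ 3 +
          |Q x y ^ k| * |plin (u x) (u w)| ^ 3 + |Q x y ^ k| * |plin (u y) (u z)| ^ 3 +
          |Q x y ^ k| * |plin (u y) (u w)| ^ 3 + |Q x y ^ k| * |plin (u z) (u w)| ^ 3) := by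
          rw [hT]; ring
      _ ≤ 4 * fourK * (7 * (B ^ 3 * |Q x y| ^ (k + 3) + B ^ 3 * |Q x z| ^ (k + 3) +
          B ^ 3 * |Q x w| ^ (k + 3) + B ^ 3 * |Q y z| ^ (k + 3) + B ^ 3 * |Q y w| ^ (k + 3) +
          B ^ 3 * |Q z w| ^ (k + 3))) := by
          gcongr; linarith [D0 x y, D0 x z, D0 y z, D0 x w, D0 y w, D0 z w]
      _ = _ := by ring

end ConcreteRow

section Cavity
variable {n : ℕ}

/-- The couplings not involving the site `i`, followed by the couplings of the site `i`. -/
def cavIdx (i : Fin (n + 1)) : (Fin n × Fin n) ⊕ Fin n → Fin (n + 1) × Fin (n + 1) :=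
  Sum.elim (fun p => (i.succAbove p.1, i.succAbove p.2))
    (fun j => if i.succAbove j < i then (i.succAbove j, i) else (i, i.succAbove j))

lemma cavIdx_injective (i : Fin (n + 1)) : Function.Injective (cavIdx i) := by
  have hne := fun j => Fin.succAbove_ne i j
  have hne' := fun j => (Fin.succAbove_ne i j).symm
  have hinj : ∀ a b, i.succAbove a = i.succAbove b ↔ a = b := fun a b =>
    Fin.succAbove_right_injective.eq_iff
  rintro (⟨a, b⟩ | j) (⟨a', b'⟩ | j') h
  · simpa [cavIdx, hinj] using h
  · simp only [cavIdx, Sum.elim_inl, Sum.elim_inr] at h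
    split_ifs at h <;> simp [hne, hne'] at h
  · simp only [cavIdx, Sum.elim_inl, Sum.elim_inr] at h
    split_ifs at h <;> simp [hne, hne'] at h
  · simp only [cavIdx, Sum.elim_inr] at h
    split_ifs at h <;> simp [hne, hne', hinj] at h <;> simp [h]

/-- The disorder not involving the site `i`. -/
def cavBulk {α : Type*} (i : Fin (n + 1)) (g : Fin (n + 1) × Fin (n + 1) → α) :
    Fin n × Fin n → α := fun p => g (cavIdx i (Sum.inl p))

/-- The disorder of the site `i`. -/
def cavRow {α : Type*} (i : Fin (n + 1)) (g : Fin (n + 1) × Fin (n + 1) → α) :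
    Fin n → α := fun j => g (cavIdx i (Sum.inr j))

lemma measurePreserving_cav (i : Fin (n + 1)) :
    MeasurePreserving (fun ω : Fin (n + 1) × Fin (n + 1) → ℝ × ℝ => (cavBulk i ω, cavRow i ω))
      (pairPi _) ((pairPi (Fin n × Fin n)).prod (pairPi (Fin n))) :=
  ((measurePreserving_sumPiEquivProdPi_symm (X := fun _ : (Fin n × Fin n) ⊕ Fin n => ℝ × ℝ)
    (fun _ => pairG)).symm _).comp (measurePreserving_comp_injective pairG (cavIdx_injective i))

/-- The local field coefficients. -/
def rowc (b : ℝ) (σ : Config n) (j : Fin n) : ℝ := b * spin (σ j)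

/-- Adjoin a spin at the site `i`. -/
def addSpin (i : Fin (n + 1)) (s : Bool) (σ : Config n) : Config (n + 1) :=
  Fin.insertNth (α := fun _ => Bool) i s σ

/-- Remove the spin at the site `i`. -/
def dropSpin (i : Fin (n + 1)) (σ : Config (n + 1)) : Config n := fun j => σ (i.succAbove j)

lemma addSpin_same (i : Fin (n + 1)) (s : Bool) (σ : Config n) : addSpin i s σ i = s := by
  simp [addSpin]

lemma addSpin_succAbove (i : Fin (n + 1)) (s : Bool) (σ : Config n) (j : Fin n) :
    addSpin i s σ (i.succAbove j) = σ j := by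
  simp [addSpin]

lemma dropSpin_addSpin (i : Fin (n + 1)) (s : Bool) (σ : Config n) :
    dropSpin i (addSpin i s σ) = σ := by
  funext j; exact addSpin_succAbove i s σ j

lemma sum_addSpin (i : Fin (n + 1)) (F : Config (n + 1) → ℝ) :
    ∑ σ, F σ = ∑ σ, (F (addSpin i true σ) + F (addSpin i false σ)) := by
  rw [← (Fin.insertNthEquiv (fun _ => Bool) i).sum_comp, Fintype.sum_prod_type]
  rw [Fintype.sum_bool, ← Finset.sum_add_distrib]
  rfl

lemma ov_eq_dropSpin (i : Fin (n + 1)) (σ τ : Config (n + 1)) :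
    ov σ τ = spin (σ i) * spin (τ i) + ov (dropSpin i σ) (dropSpin i τ) := by
  unfold ov dropSpin
  rw [Fin.sum_univ_succAbove _ i]

lemma lin_skc_addSpin (b : ℝ) (i : Fin (n + 1)) (s : Bool) (σ : Config n)
    (g : Fin (n + 1) × Fin (n + 1) → ℝ) :
    lin (skc (n + 1) b (addSpin i s σ)) g =
      lin (skc n b σ) (cavBulk i g) + spin s * lin (rowc b σ) (cavRow i g) := by
  simp only [lin, skc, rowc, cavBulk, cavRow, cavIdx, Sum.elim_inl, Sum.elim_inr,
    Fintype.sum_prod_type]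
  rw [Fin.sum_univ_succAbove _ i]
  simp only [Fin.sum_univ_succAbove _ i, addSpin_same, addSpin_succAbove, lt_irrefl, if_false,
    Fin.succAbove_lt_succAbove_iff, zero_mul, zero_add, Finset.sum_add_distrib, Finset.mul_sum]
  rw [← add_assoc, ← Finset.sum_add_distrib, add_comm]
  congr 1
  refine Finset.sum_congr rfl fun j _ => ?_
  rcases lt_or_gt_of_ne (Fin.succAbove_ne i j) with h | h
  · simp only [h, if_true, not_lt.2 h.le, if_false]; ring
  · simp only [h, if_true, not_lt.2 h.le, if_false]; ring

lemma psum_cav (b : ℝ) (i : Fin (n + 1)) (g : Fin (n + 1) × Fin (n + 1) → ℝ) :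
    psum (skc (n + 1) b) g = psum (skc n b) (cavBulk i g) *
      (2 * ∑ σ, gw (skc n b) (cavBulk i g) σ * cosh (lin (rowc b σ) (cavRow i g))) := by
  have h := (psum_pos (skc n b) (cavBulk i g)).ne'
  rw [psum, sum_addSpin i, Finset.mul_sum, Finset.mul_sum]
  refine Finset.sum_congr rfl fun σ _ => ?_
  rw [lin_skc_addSpin, lin_skc_addSpin, gw, Real.exp_add, Real.exp_add, Real.cosh_eq]
  simp only [spin, if_true, Bool.false_eq_true, if_false, one_mul, neg_mul]
  field_simp

lemma sum_gw_cav (b : ℝ) (i : Fin (n + 1)) (g : Fin (n + 1) × Fin (n + 1) → ℝ) (ψ : Bool → ℝ)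
    (F : Config n → ℝ) :
    ∑ σ, gw (skc (n + 1) b) g σ * (ψ (σ i) * F (dropSpin i σ)) =
      (∑ σ, gw (skc n b) (cavBulk i g) σ * F σ *
        ((ψ true * exp (lin (rowc b σ) (cavRow i g)) +
          ψ false * exp (-lin (rowc b σ) (cavRow i g))) / 2)) *
      (∑ σ, gw (skc n b) (cavBulk i g) σ * cosh (lin (rowc b σ) (cavRow i g)))⁻¹ := by
  have h := (psum_pos (skc n b) (cavBulk i g)).ne'
  have h2 := (psum_pos (skc (n + 1) b) g).ne'
  rw [psum_cav b i] at h2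
  have h3 := right_ne_zero_of_mul (right_ne_zero_of_mul h2)
  rw [sum_addSpin i, Finset.sum_mul]
  refine Finset.sum_congr rfl fun σ _ => ?_
  rw [gw, gw, psum_cav b i, lin_skc_addSpin, lin_skc_addSpin, dropSpin_addSpin, dropSpin_addSpin,
    addSpin_same, addSpin_same, Real.exp_add, Real.exp_add]
  set C := ∑ σ, gw (skc n b) (cavBulk i g) σ * cosh (lin (rowc b σ) (cavRow i g))
  rw [gw]
  simp only [spin, if_true, Bool.false_eq_true, if_false, one_mul, neg_mul]
  field_simp

lemma sum_gw_gw_cav (b : ℝ) (i : Fin (n + 1)) (g g' : Fin (n + 1) × Fin (n + 1) → ℝ)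
    (ψ : Bool → ℝ) (f : Config n → Config n → ℝ) :
    ∑ σ, ∑ τ, gw (skc (n + 1) b) g σ * gw (skc (n + 1) b) g' τ *
        (ψ (σ i) * ψ (τ i) * f (dropSpin i σ) (dropSpin i τ)) =
      (∑ σ, ∑ τ, gw (skc n b) (cavBulk i g) σ * gw (skc n b) (cavBulk i g') τ * f σ τ *
        (((ψ true * exp (lin (rowc b σ) (cavRow i g)) +
          ψ false * exp (-lin (rowc b σ) (cavRow i g))) / 2) *
        ((ψ true * exp (lin (rowc b τ) (cavRow i g')) +
          ψ false * exp (-lin (rowc b τ) (cavRow i g'))) / 2))) *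
      ((∑ σ, gw (skc n b) (cavBulk i g) σ * cosh (lin (rowc b σ) (cavRow i g))) *
      (∑ σ, gw (skc n b) (cavBulk i g') σ * cosh (lin (rowc b σ) (cavRow i g'))))⁻¹ := by
  have e : ∀ σ, ∑ τ, gw (skc (n + 1) b) g σ * gw (skc (n + 1) b) g' τ *
        (ψ (σ i) * ψ (τ i) * f (dropSpin i σ) (dropSpin i τ)) =
      gw (skc (n + 1) b) g σ * (ψ (σ i) * (fun ρ => ∑ τ, gw (skc (n + 1) b) g' τ *
        (ψ (τ i) * f ρ (dropSpin i τ))) (dropSpin i σ)) := by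
    intro σ
    simp only [Finset.mul_sum]
    exact Finset.sum_congr rfl fun τ _ => by ring
  rw [Finset.sum_congr rfl fun σ _ => e σ, sum_gw_cav b i g ψ
    (fun ρ => ∑ τ, gw (skc (n + 1) b) g' τ * (ψ (τ i) * f ρ (dropSpin i τ)))]
  simp only [fun σ => sum_gw_cav b i g' ψ (f σ)]
  rw [mul_inv, mul_comm (∑ σ, gw (skc n b) (cavBulk i g) σ * cosh (lin (rowc b σ) (cavRow i g)))⁻¹,
    ← mul_assoc]
  congr 1
  rw [Finset.sum_mul]
  refine Finset.sum_congr rfl fun σ _ => ?_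
  rw [Finset.sum_mul, Finset.sum_mul, Finset.mul_sum, Finset.sum_mul]
  exact Finset.sum_congr rfl fun τ _ => by ring

end Cavity

section RowConfig
variable {n : ℕ}

/-- The monomial of the spins of a configuration along a tuple of sites. -/
def spinProd {k : ℕ} (I : Fin k → Fin n) (σ : Config n) : ℝ := ∏ l, spin (σ (I l))

lemma ov_pow (k : ℕ) (σ τ : Config n) :
    ov σ τ ^ k = ∑ I : Fin k → Fin n, spinProd I σ * spinProd I τ := by
  rw [ov, Fintype.sum_pow]
  exact Finset.sum_congr rfl fun I _ => Finset.prod_mul_distrib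

lemma sum_sum_ov_pow (k : ℕ) (r t : Config n → ℝ) :
    ∑ σ, ∑ τ, r σ * t τ * ov σ τ ^ k =
      ∑ I : Fin k → Fin n, (∑ σ, r σ * spinProd I σ) * (∑ τ, t τ * spinProd I τ) := by
  simp only [ov_pow, Finset.sum_mul_sum]
  simp only [Finset.mul_sum]
  rw [Finset.sum_congr rfl fun σ _ => Finset.sum_comm, Finset.sum_comm]
  exact Finset.sum_congr rfl fun I _ => Finset.sum_congr rfl fun σ _ =>
    Finset.sum_congr rfl fun τ _ => by ring

lemma sum_sum_ov_pow_nonneg (k : ℕ) (r : Config n → ℝ) :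
    0 ≤ ∑ σ, ∑ τ, r σ * r τ * ov σ τ ^ k := by
  rw [sum_sum_ov_pow]
  exact Finset.sum_nonneg fun I _ => mul_self_nonneg _

lemma sum_sum_add_ov_pow_le (k : ℕ) (r t : Config n → ℝ) :
    ∑ σ, ∑ τ, (r σ + t σ) * (r τ + t τ) * ov σ τ ^ k ≤
      2 * (∑ σ, ∑ τ, r σ * r τ * ov σ τ ^ k + ∑ σ, ∑ τ, t σ * t τ * ov σ τ ^ k) := by
  have h := sum_sum_ov_pow_nonneg k (fun σ => r σ - t σ)
  rw [← sub_nonneg]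
  refine h.trans (le_of_eq ?_)
  rw [← Finset.sum_add_distrib, Finset.mul_sum, ← Finset.sum_sub_distrib]
  refine Finset.sum_congr rfl fun σ _ => ?_
  rw [← Finset.sum_add_distrib, Finset.mul_sum, ← Finset.sum_sub_distrib]
  exact Finset.sum_congr rfl fun τ _ => by ring

/-- The coefficients of the local fields of a pair of correlated replicas. -/
def pairRow (b θ : ℝ) : Config n ⊕ Config n → Fin n → ℝ × ℝ :=
  Sum.elim (fun σ j => (b * spin (σ j), 0))
    (fun τ j => (b * spin (τ j) * cos θ, b * spin (τ j) * sin θ))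

/-- The configuration carried by an element of the disjoint union. -/
def cfg : Config n ⊕ Config n → Config n := Sum.elim id id

lemma plin_pairRow_inl (b θ : ℝ) (σ : Config n) (ω : Fin n → ℝ × ℝ) :
    plin (pairRow b θ (Sum.inl σ)) ω = lin (rowc b σ) (fstF ω) := by
  simp only [plin, pairRow, Sum.elim_inl, zero_mul, add_zero, lin, rowc, fstF]

lemma plin_pairRow_inr (b θ : ℝ) (σ : Config n) (ω : Fin n → ℝ × ℝ) :
    plin (pairRow b θ (Sum.inr σ)) ω = lin (rowc b σ) (rotF θ ω) := by
  simp only [plin, pairRow, Sum.elim_inr, lin, rowc, rotF]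
  exact Finset.sum_congr rfl fun j _ => by ring

lemma plin_inl_inl (b θ : ℝ) (σ τ : Config n) :
    plin (pairRow b θ (Sum.inl σ)) (pairRow b θ (Sum.inl τ)) = b ^ 2 * ov σ τ := by
  simp only [plin, pairRow, Sum.elim_inl, ov, Finset.mul_sum]
  exact Finset.sum_congr rfl fun j _ => by ring

lemma plin_inl_inr (b θ : ℝ) (σ τ : Config n) :
    plin (pairRow b θ (Sum.inl σ)) (pairRow b θ (Sum.inr τ)) = b ^ 2 * cos θ * ov σ τ := by
  simp only [plin, pairRow, Sum.elim_inl, Sum.elim_inr, ov, Finset.mul_sum]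
  exact Finset.sum_congr rfl fun j _ => by ring

lemma plin_inr_inl (b θ : ℝ) (σ τ : Config n) :
    plin (pairRow b θ (Sum.inr σ)) (pairRow b θ (Sum.inl τ)) = b ^ 2 * cos θ * ov σ τ := by
  rw [plin_comm, plin_inl_inr, ov_comm]

lemma plin_inr_inr (b θ : ℝ) (σ τ : Config n) :
    plin (pairRow b θ (Sum.inr σ)) (pairRow b θ (Sum.inr τ)) = b ^ 2 * ov σ τ := by
  simp only [plin, pairRow, Sum.elim_inr, ov, Finset.mul_sum]
  refine Finset.sum_congr rfl fun j _ => ?_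
  linear_combination (b ^ 2 * spin (σ j) * spin (τ j)) * Real.sin_sq_add_cos_sq θ

lemma abs_plin_pairRow_le (b θ : ℝ) (x y : Config n ⊕ Config n) :
    |plin (pairRow b θ x) (pairRow b θ y)| ≤ b ^ 2 * |ov (cfg x) (cfg y)| := by
  have hb := sq_nonneg b
  have ht := Real.abs_cos_le_one θ
  have hmain : ∀ σ τ : Config n, |b ^ 2 * cos θ * ov σ τ| ≤ b ^ 2 * |ov σ τ| := fun σ τ => by
    rw [abs_mul, abs_mul, abs_of_nonneg hb]
    exact mul_le_mul_of_nonneg_right (mul_le_of_le_one_right hb ht) (abs_nonneg _)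
  rcases x with σ | σ <;> rcases y with τ | τ
  · rw [plin_inl_inl, abs_mul, abs_of_nonneg hb]; rfl
  · rw [plin_inl_inr]; exact hmain σ τ
  · rw [plin_inr_inl]; exact hmain σ τ
  · rw [plin_inr_inr, abs_mul, abs_of_nonneg hb]; rfl

lemma abs_plin_pairRow_le_one {b : ℝ} (hb : b ^ 2 * n ≤ 1) (θ : ℝ) (x y : Config n ⊕ Config n) :
    |plin (pairRow b θ x) (pairRow b θ y)| ≤ 1 :=
  (abs_plin_pairRow_le b θ x y).trans
    ((mul_le_mul_of_nonneg_left (abs_ov_le _ _) (sq_nonneg b)).trans hb)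

lemma plin_pairRow_self (b θ : ℝ) (x : Config n ⊕ Config n) :
    plin (pairRow b θ x) (pairRow b θ x) = b ^ 2 * n := by
  rcases x with σ | σ
  · rw [plin_inl_inl, ov_self]
  · rw [plin_inr_inr, ov_self]

lemma cw_pairRow_inl (b θ : ℝ) (σ : Config n) (ω : Fin n → ℝ × ℝ) :
    cw (pairRow b θ (Sum.inl σ)) ω =
      exp (-(b ^ 2 * n / 2)) * cosh (lin (rowc b σ) (fstF ω)) := by
  rw [cw, plin_pairRow_self, plin_pairRow_inl]

lemma cw_pairRow_inr (b θ : ℝ) (σ : Config n) (ω : Fin n → ℝ × ℝ) :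
    cw (pairRow b θ (Sum.inr σ)) ω =
      exp (-(b ^ 2 * n / 2)) * cosh (lin (rowc b σ) (rotF θ ω)) := by
  rw [cw, plin_pairRow_self, plin_pairRow_inr]

lemma sw_pairRow_inl (b θ : ℝ) (σ : Config n) (ω : Fin n → ℝ × ℝ) :
    sw (pairRow b θ (Sum.inl σ)) ω =
      exp (-(b ^ 2 * n / 2)) * sinh (lin (rowc b σ) (fstF ω)) := by
  rw [sw, plin_pairRow_self, plin_pairRow_inl]

lemma sw_pairRow_inr (b θ : ℝ) (σ : Config n) (ω : Fin n → ℝ × ℝ) :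
    sw (pairRow b θ (Sum.inr σ)) ω =
      exp (-(b ^ 2 * n / 2)) * sinh (lin (rowc b σ) (rotF θ ω)) := by
  rw [sw, plin_pairRow_self, plin_pairRow_inr]

lemma sum_mul_exp_ratio {S T : Type*} [Fintype S] [Fintype T] (e : ℝ) (he : e ≠ 0)
    (a : S → T → ℝ) (x y p : S → ℝ) (z w q : T → ℝ) :
    (∑ σ, ∑ τ, a σ τ * ((e * x σ) * (e * z τ))) *
      ((∑ σ, p σ * (e * y σ)) * (∑ τ, q τ * (e * w τ)))⁻¹ =
    (∑ σ, ∑ τ, a σ τ * (x σ * z τ)) * ((∑ σ, p σ * y σ) * (∑ τ, q τ * w τ))⁻¹ := by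
  have h1 : ∑ σ, ∑ τ, a σ τ * ((e * x σ) * (e * z τ)) =
      (e * e) * ∑ σ, ∑ τ, a σ τ * (x σ * z τ) := by
    simp only [Finset.mul_sum]
    exact Finset.sum_congr rfl fun σ _ => Finset.sum_congr rfl fun τ _ => by ring
  have h2 : ∑ σ, p σ * (e * y σ) = e * ∑ σ, p σ * y σ := by
    simp only [Finset.mul_sum]
    exact Finset.sum_congr rfl fun σ _ => by ring
  have h3 : ∑ σ, q σ * (e * w σ) = e * ∑ σ, q σ * w σ := by
    simp only [Finset.mul_sum]
    exact Finset.sum_congr rfl fun σ _ => by ring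
  rw [h1, h2, h3, mul_inv, mul_inv, mul_inv, mul_inv]
  field_simp

variable {P Q : Config n → ℝ} {b : ℝ} {k : ℕ}

lemma abs_row_even_le (θ : ℝ) (hb : b ^ 2 * n ≤ 1) (hk : Even k) (hP0 : ∀ σ, 0 ≤ P σ)
    (hQ0 : ∀ σ, 0 ≤ Q σ) (hP : ∑ σ, P σ = 1) (hQ : ∑ σ, Q σ = 1) :
    |∫ ω, (∑ σ, ∑ τ, P σ * Q τ * ov σ τ ^ k *
        (cosh (lin (rowc b σ) (fstF ω)) * cosh (lin (rowc b τ) (rotF θ ω)))) *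
        ((∑ σ, P σ * cosh (lin (rowc b σ) (fstF ω))) *
          (∑ σ, Q σ * cosh (lin (rowc b σ) (rotF θ ω))))⁻¹ ∂pairPi (Fin n) -
      ∑ σ, ∑ τ, P σ * Q τ * ov σ τ ^ k| ≤
      300 * (28 * fourK) *
        ∑ σ, ∑ τ, (P σ + Q σ) * (P τ + Q τ) * (b ^ 4 * |ov σ τ| ^ (k + 2)) := by
  have h := abs_row_cosh_le (u := pairRow b θ) (Q := fun x y => ov (cfg x) (cfg y))
    (B := b ^ 2) (k := k) (p := Sum.elim P 0) (q := Sum.elim 0 Q) (sq_nonneg b)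
    (abs_plin_pairRow_le_one hb θ) (abs_plin_pairRow_le b θ) hk
    (by rintro (σ | σ) <;> simp [hP0]) (by rintro (σ | σ) <;> simp [hQ0])
    (by simpa using hP) (by simpa using hQ)
  simp only [Fintype.sum_sum_type, Sum.elim_inl, Sum.elim_inr, Pi.zero_apply, zero_mul, mul_zero,
    Finset.sum_const_zero, add_zero, zero_add, cfg, id, cw_pairRow_inl, cw_pairRow_inr] at h
  rw [integral_congr_ae (.of_forall fun ω =>
    sum_mul_exp_ratio _ (exp_pos (-(b ^ 2 * (n : ℝ) / 2))).ne'
      (fun σ τ => P σ * Q τ * ov σ τ ^ k) (fun σ => cosh (lin (rowc b σ) (fstF ω)))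
      (fun σ => cosh (lin (rowc b σ) (fstF ω))) P (fun σ => cosh (lin (rowc b σ) (rotF θ ω)))
      (fun σ => cosh (lin (rowc b σ) (rotF θ ω))) Q)] at h
  refine h.trans (le_of_eq ?_)
  congr 1
  simp only [← Finset.sum_add_distrib]
  exact Finset.sum_congr rfl fun σ _ => Finset.sum_congr rfl fun τ _ => by ring

lemma abs_row_odd_le (θ : ℝ) (hb : b ^ 2 * n ≤ 1) (k : ℕ) (hP0 : ∀ σ, 0 ≤ P σ)
    (hQ0 : ∀ σ, 0 ≤ Q σ) (hP : ∑ σ, P σ = 1) (hQ : ∑ σ, Q σ = 1) :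
    |∫ ω, (∑ σ, ∑ τ, P σ * Q τ * ov σ τ ^ k *
        (sinh (lin (rowc b σ) (fstF ω)) * sinh (lin (rowc b τ) (rotF θ ω)))) *
        ((∑ σ, P σ * cosh (lin (rowc b σ) (fstF ω))) *
          (∑ σ, Q σ * cosh (lin (rowc b σ) (rotF θ ω))))⁻¹ ∂pairPi (Fin n) -
      (b ^ 2 * cos θ * ∑ σ, ∑ τ, P σ * Q τ * ov σ τ ^ (k + 1) -
        b ^ 4 * cos θ * ∑ σ, ∑ τ, ∑ ρ, P σ * Q τ * (P ρ + Q ρ) *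
          (ov σ τ ^ k * ov σ ρ * ov τ ρ))| ≤
      300 * (28 * fourK) *
        ∑ σ, ∑ τ, (P σ + Q σ) * (P τ + Q τ) * (b ^ 6 * |ov σ τ| ^ (k + 3)) := by
  have h := abs_row_sinh_le (u := pairRow b θ) (Q := fun x y => ov (cfg x) (cfg y))
    (B := b ^ 2) (k := k) (p := Sum.elim P 0) (q := Sum.elim 0 Q)
    (fun (I : Fin k → Fin n) x => spinProd I (cfg x)) (sq_nonneg b)
    (abs_plin_pairRow_le_one hb θ) (abs_plin_pairRow_le b θ) (fun x y => ov_pow k _ _)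
    (by rintro (σ | σ) <;> simp [hP0]) (by rintro (σ | σ) <;> simp [hQ0])
    (by simpa using hP) (by simpa using hQ)
  simp only [Fintype.sum_sum_type, Sum.elim_inl, Sum.elim_inr, Pi.zero_apply, zero_mul, mul_zero,
    Finset.sum_const_zero, add_zero, zero_add, cfg, id, cw_pairRow_inl, cw_pairRow_inr,
    sw_pairRow_inl, sw_pairRow_inr, plin_inl_inl, plin_inl_inr, plin_inr_inl, plin_inr_inr] at h
  rw [integral_congr_ae (.of_forall fun ω =>
    sum_mul_exp_ratio _ (exp_pos (-(b ^ 2 * (n : ℝ) / 2))).ne'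
      (fun σ τ => P σ * Q τ * ov σ τ ^ k) (fun σ => sinh (lin (rowc b σ) (fstF ω)))
      (fun σ => cosh (lin (rowc b σ) (fstF ω))) P (fun σ => sinh (lin (rowc b σ) (rotF θ ω)))
      (fun σ => cosh (lin (rowc b σ) (rotF θ ω))) Q)] at h
  have e1 : ∑ σ, ∑ τ, P σ * Q τ * ov σ τ ^ k * (b ^ 2 * cos θ * ov σ τ) =
      b ^ 2 * cos θ * ∑ σ, ∑ τ, P σ * Q τ * ov σ τ ^ (k + 1) := by
    simp only [Finset.mul_sum]
    exact Finset.sum_congr rfl fun σ _ => Finset.sum_congr rfl fun τ _ => by ring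
  have e2 : ∑ σ, ∑ τ, (∑ ρ, P σ * Q τ * P ρ * ov σ τ ^ k *
        (b ^ 2 * ov σ ρ * (b ^ 2 * cos θ * ov τ ρ)) +
      ∑ ρ, P σ * Q τ * Q ρ * ov σ τ ^ k * (b ^ 2 * cos θ * ov σ ρ * (b ^ 2 * ov τ ρ))) =
      b ^ 4 * cos θ * ∑ σ, ∑ τ, ∑ ρ, P σ * Q τ * (P ρ + Q ρ) *
          (ov σ τ ^ k * ov σ ρ * ov τ ρ) := by
    simp only [Finset.mul_sum, ← Finset.sum_add_distrib]
    exact Finset.sum_congr rfl fun σ _ => Finset.sum_congr rfl fun τ _ =>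
      Finset.sum_congr rfl fun ρ _ => by ring
  rw [e1, e2] at h
  refine h.trans (le_of_eq ?_)
  congr 1
  simp only [← Finset.sum_add_distrib]
  exact Finset.sum_congr rfl fun σ _ => Finset.sum_congr rfl fun τ _ => by ring

end RowConfig

section CrossMoments
variable {n : ℕ}

/-- Gibbs weights in the first disorder. -/
def wX (b : ℝ) (ω : Fin n × Fin n → ℝ × ℝ) (σ : Config n) : ℝ := gw (skc n b) (fstF ω) σ

/-- Gibbs weights in the rotated disorder. -/
def wY (b θ : ℝ) (ω : Fin n × Fin n → ℝ × ℝ) (σ : Config n) : ℝ := gw (skc n b) (rotF θ ω) σ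

lemma wX_nonneg (b : ℝ) (ω : Fin n × Fin n → ℝ × ℝ) (σ : Config n) : 0 ≤ wX b ω σ :=
  gw_nonneg _ _ _

lemma wY_nonneg (b θ : ℝ) (ω : Fin n × Fin n → ℝ × ℝ) (σ : Config n) : 0 ≤ wY b θ ω σ :=
  gw_nonneg _ _ _

lemma wX_le_one (b : ℝ) (ω : Fin n × Fin n → ℝ × ℝ) (σ : Config n) : wX b ω σ ≤ 1 :=
  gw_le_one _ _ _

lemma wY_le_one (b θ : ℝ) (ω : Fin n × Fin n → ℝ × ℝ) (σ : Config n) : wY b θ ω σ ≤ 1 :=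
  gw_le_one _ _ _

lemma sum_wX (b : ℝ) (ω : Fin n × Fin n → ℝ × ℝ) : ∑ σ, wX b ω σ = 1 := sum_gw _ _

lemma sum_wY (b θ : ℝ) (ω : Fin n × Fin n → ℝ × ℝ) : ∑ σ, wY b θ ω σ = 1 := sum_gw _ _

@[fun_prop] lemma continuous_wX (b : ℝ) (σ : Config n) : Continuous fun ω => wX b ω σ := by
  unfold wX; fun_prop

@[fun_prop] lemma continuous_wY (b θ : ℝ) (σ : Config n) : Continuous fun ω => wY b θ ω σ := by
  unfold wY; fun_prop

/-- Gibbs average over one replica in each of the two disorders. -/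
def gibX (b θ : ℝ) (f : Config n → Config n → ℝ) (ω : Fin n × Fin n → ℝ × ℝ) : ℝ :=
  ∑ σ, ∑ τ, wX b ω σ * wY b θ ω τ * f σ τ

/-- Gibbs average over one replica in each of the two disorders, and a third one from both. -/
def gibT (b θ : ℝ) (f : Config n → Config n → Config n → ℝ) (ω : Fin n × Fin n → ℝ × ℝ) : ℝ :=
  ∑ σ, ∑ τ, ∑ ρ, wX b ω σ * wY b θ ω τ * (wX b ω ρ + wY b θ ω ρ) * f σ τ ρ

/-- Gibbs average over two replicas from the superposition of the two disorders. -/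
def gibS (b θ : ℝ) (f : Config n → Config n → ℝ) (ω : Fin n × Fin n → ℝ × ℝ) : ℝ :=
  ∑ σ, ∑ τ, (wX b ω σ + wY b θ ω σ) * (wX b ω τ + wY b θ ω τ) * f σ τ

lemma integrable_of_weights {Ω : Type*} [TopologicalSpace Ω] [MeasurableSpace Ω]
    [OpensMeasurableSpace Ω] {μ : Measure Ω} [IsProbabilityMeasure μ] {w : Ω → ℝ} {C : ℝ}
    (hw : Continuous w) (hC : ∀ ω, |w ω| ≤ C) (c : ℝ) : Integrable (fun ω => w ω * c) μ :=
  (Integrable.of_bound hw.aestronglyMeasurable C (ae_of_all _ fun ω => hC ω)).mul_const c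

lemma integrable_gibX (b θ : ℝ) (f : Config n → Config n → ℝ) :
    Integrable (gibX b θ f) (pairPi (Fin n × Fin n)) := by
  unfold gibX
  refine integrable_finsetSum _ fun σ _ => integrable_finsetSum _ fun τ _ =>
    integrable_of_weights (C := 1) (by fun_prop) (fun ω => ?_) _
  have h1 := wX_nonneg b ω σ
  have h2 := wY_nonneg b θ ω τ
  rw [abs_of_nonneg (by positivity)]
  exact mul_le_one₀ (wX_le_one b ω σ) h2 (wY_le_one b θ ω τ)

lemma integrable_gibT (b θ : ℝ) (f : Config n → Config n → Config n → ℝ) :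
    Integrable (gibT b θ f) (pairPi (Fin n × Fin n)) := by
  unfold gibT
  refine integrable_finsetSum _ fun σ _ => integrable_finsetSum _ fun τ _ =>
    integrable_finsetSum _ fun ρ _ =>
    integrable_of_weights (C := 1 * 2) (by fun_prop) (fun ω => ?_) _
  have h1 := wX_nonneg b ω σ
  have h2 := wY_nonneg b θ ω τ
  have h3 := wX_nonneg b ω ρ
  have h4 := wY_nonneg b θ ω ρ
  rw [abs_of_nonneg (by positivity)]
  refine mul_le_mul (mul_le_one₀ (wX_le_one b ω σ) h2 (wY_le_one b θ ω τ)) ?_ (by positivity)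
    zero_le_one
  linarith [wX_le_one b ω ρ, wY_le_one b θ ω ρ]

lemma integrable_gibS (b θ : ℝ) (f : Config n → Config n → ℝ) :
    Integrable (gibS b θ f) (pairPi (Fin n × Fin n)) := by
  unfold gibS
  refine integrable_finsetSum _ fun σ _ => integrable_finsetSum _ fun τ _ =>
    integrable_of_weights (C := 2 * 2) (by fun_prop) (fun ω => ?_) _
  have h1 := wX_nonneg b ω σ
  have h2 := wY_nonneg b θ ω τ
  have h3 := wX_nonneg b ω τ
  have h4 := wY_nonneg b θ ω σ
  rw [abs_of_nonneg (by positivity)]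
  refine mul_le_mul ?_ ?_ (by positivity) (by norm_num)
  · linarith [wX_le_one b ω σ, wY_le_one b θ ω σ]
  · linarith [wX_le_one b ω τ, wY_le_one b θ ω τ]

lemma integral_gib2_fst (b : ℝ) (f : Config n → Config n → ℝ) :
    ∫ ω, gib2 b f (fstF ω) ∂pairPi (Fin n × Fin n) = ∫ g, gib2 b f g ∂stdPi (Fin n × Fin n) :=
  integral_comp_of_measurePreserving measurePreserving_fstF
    (continuous_gib2 b f).aestronglyMeasurable

lemma integral_gib2_rot (b θ : ℝ) (f : Config n → Config n → ℝ) :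
    ∫ ω, gib2 b f (rotF θ ω) ∂pairPi (Fin n × Fin n) = ∫ g, gib2 b f g ∂stdPi (Fin n × Fin n) :=
  integral_comp_of_measurePreserving (measurePreserving_rotF θ)
    (continuous_gib2 b f).aestronglyMeasurable

lemma integrable_gib2_fst (b : ℝ) (f : Config n → Config n → ℝ) :
    Integrable (fun ω => gib2 b f (fstF ω)) (pairPi (Fin n × Fin n)) :=
  measurePreserving_fstF.integrable_comp_of_integrable (integrable_gib2 b f)

lemma integrable_gib2_rot (b θ : ℝ) (f : Config n → Config n → ℝ) :
    Integrable (fun ω => gib2 b f (rotF θ ω)) (pairPi (Fin n × Fin n)) :=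
  (measurePreserving_rotF θ).integrable_comp_of_integrable (integrable_gib2 b f)

/-- The overlap moments between the two disorders. -/
def mom (n : ℕ) (b θ : ℝ) (k : ℕ) : ℝ :=
  ∫ ω, gibX b θ (fun σ τ => ov σ τ ^ k) ω ∂pairPi (Fin n × Fin n)

/-- The triangle moments. -/
def tri (n : ℕ) (b θ : ℝ) (k : ℕ) : ℝ :=
  ∫ ω, gibT b θ (fun σ τ ρ => ov σ τ ^ k * ov σ ρ * ov τ ρ) ω ∂pairPi (Fin n × Fin n)

lemma rotF_zero {ι : Type*} (ω : ι → ℝ × ℝ) : rotF 0 ω = fstF ω := by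
  funext p; simp [rotF, fstF]

lemma mom_zero (n : ℕ) (b : ℝ) (k : ℕ) : mom n b 0 k = Mom n b k := by
  rw [mom, Mom, ← integral_gib2_fst]
  simp only [gibX, gib2, wX, wY, rotF_zero]

lemma integral_gibS_le (n : ℕ) (b θ : ℝ) (k : ℕ) :
    ∫ ω, gibS b θ (fun σ τ => ov σ τ ^ k) ω ∂pairPi (Fin n × Fin n) ≤ 4 * Mom n b k := by
  have h1 := integral_gib2_fst b (fun σ τ : Config n => ov σ τ ^ k)
  have h2 := integral_gib2_rot b θ (fun σ τ : Config n => ov σ τ ^ k)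
  have i1 := integrable_gib2_fst b (fun σ τ : Config n => ov σ τ ^ k)
  have i2 := integrable_gib2_rot b θ (fun σ τ : Config n => ov σ τ ^ k)
  have key : ∫ ω, gibS b θ (fun σ τ => ov σ τ ^ k) ω ∂pairPi (Fin n × Fin n) ≤
      ∫ ω, 2 * (gib2 b (fun σ τ : Config n => ov σ τ ^ k) (fstF ω) +
      gib2 b (fun σ τ : Config n => ov σ τ ^ k) (rotF θ ω)) ∂pairPi (Fin n × Fin n) :=
    integral_mono (integrable_gibS b θ _) ((i1.add i2).const_mul 2)
      fun ω => sum_sum_add_ov_pow_le k _ _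
  rw [integral_const_mul, integral_add i1 i2, h1, h2] at key
  rw [Mom]
  linarith

lemma abs_integral_cav_sub_le (i : Fin (n + 1))
    {G : (Fin n × Fin n → ℝ × ℝ) × (Fin n → ℝ × ℝ) → ℝ} {A E : (Fin n × Fin n → ℝ × ℝ) → ℝ}
    (hG : Integrable G ((pairPi (Fin n × Fin n)).prod (pairPi (Fin n))))
    (hA : Integrable A (pairPi (Fin n × Fin n))) (hE : Integrable E (pairPi (Fin n × Fin n)))
    (h : ∀ v, |∫ w, G (v, w) ∂pairPi (Fin n) - A v| ≤ E v) :
    |∫ ω, G (cavBulk i ω, cavRow i ω) ∂pairPi (Fin (n + 1) × Fin (n + 1)) -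
      ∫ v, A v ∂pairPi (Fin n × Fin n)| ≤ ∫ v, E v ∂pairPi (Fin n × Fin n) := by
  rw [integral_comp_of_measurePreserving (measurePreserving_cav i) hG.aestronglyMeasurable,
    integral_prod _ hG, ← integral_sub hG.integral_prod_left hA]
  exact abs_integral_le_integral_abs.trans
    (integral_mono (hG.integral_prod_left.sub hA).abs hE h)

/-- The ratio produced by integrating out one spin in each replica. -/
def cavRatio (b θ : ℝ) (s : ℝ → ℝ) (f : Config n → Config n → ℝ)
    (z : (Fin n × Fin n → ℝ × ℝ) × (Fin n → ℝ × ℝ)) : ℝ :=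
  (∑ σ, ∑ τ, wX b z.1 σ * wY b θ z.1 τ * f σ τ *
      (s (lin (rowc b σ) (fstF z.2)) * s (lin (rowc b τ) (rotF θ z.2)))) *
    ((∑ σ, wX b z.1 σ * cosh (lin (rowc b σ) (fstF z.2))) *
      (∑ σ, wY b θ z.1 σ * cosh (lin (rowc b σ) (rotF θ z.2))))⁻¹

lemma measurable_cavRatio (b θ : ℝ) {s : ℝ → ℝ} (hs : Continuous s)
    (f : Config n → Config n → ℝ) : Measurable (cavRatio b θ s f) := by
  have hX := fun σ : Config n => continuous_wX b σ
  have hY := fun σ : Config n => continuous_wY b θ σ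
  refine Measurable.mul (Continuous.measurable ?_) (Measurable.inv (Continuous.measurable ?_))
  · refine continuous_finsetSum _ fun σ _ => continuous_finsetSum _ fun τ _ => ?_
    have := (hX σ).comp (continuous_fst (X := (Fin n × Fin n → ℝ × ℝ)) (Y := (Fin n → ℝ × ℝ)))
    have := (hY τ).comp (continuous_fst (X := (Fin n × Fin n → ℝ × ℝ)) (Y := (Fin n → ℝ × ℝ)))
    fun_prop
  · refine Continuous.mul ?_ ?_ <;> refine continuous_finsetSum _ fun σ _ => ?_
    · have := (hX σ).comp (continuous_fst (X := (Fin n × Fin n → ℝ × ℝ)) (Y := (Fin n → ℝ × ℝ)))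
      fun_prop
    · have := (hY σ).comp (continuous_fst (X := (Fin n × Fin n → ℝ × ℝ)) (Y := (Fin n → ℝ × ℝ)))
      fun_prop

lemma gibX_cav_sinh (b θ : ℝ) (i : Fin (n + 1)) (f : Config n → Config n → ℝ)
    (ω : Fin (n + 1) × Fin (n + 1) → ℝ × ℝ) :
    gibX b θ (fun σ τ => spin (σ i) * spin (τ i) * f (dropSpin i σ) (dropSpin i τ)) ω =
      cavRatio b θ sinh f (cavBulk i ω, cavRow i ω) := by
  refine (sum_gw_gw_cav b i (fstF ω) (rotF θ ω) spin f).trans ?_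
  have e : ∀ x : ℝ, (spin true * exp x + spin false * exp (-x)) / 2 = sinh x := fun x => by
    rw [Real.sinh_eq]; simp [spin, sub_eq_add_neg]
  simp only [e]
  rfl

lemma gibX_cav_cosh (b θ : ℝ) (i : Fin (n + 1)) (f : Config n → Config n → ℝ)
    (ω : Fin (n + 1) × Fin (n + 1) → ℝ × ℝ) :
    gibX b θ (fun σ τ => f (dropSpin i σ) (dropSpin i τ)) ω =
      cavRatio b θ cosh f (cavBulk i ω, cavRow i ω) := by
  have h := sum_gw_gw_cav b i (fstF ω) (rotF θ ω) (fun _ => 1) f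
  simp only [one_mul] at h
  refine h.trans ?_
  simp only [← Real.cosh_eq]
  rfl

lemma integrable_cavRatio_sinh (b θ : ℝ) (i : Fin (n + 1)) (f : Config n → Config n → ℝ) :
    Integrable (cavRatio b θ sinh f) ((pairPi (Fin n × Fin n)).prod (pairPi (Fin n))) := by
  rw [← (measurePreserving_cav i).integrable_comp
    (measurable_cavRatio b θ continuous_sinh f).aestronglyMeasurable]
  have e : cavRatio b θ sinh f ∘ (fun ω => (cavBulk i ω, cavRow i ω)) =
      gibX b θ (fun σ τ => spin (σ i) * spin (τ i) * f (dropSpin i σ) (dropSpin i τ)) :=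
    funext fun ω => (gibX_cav_sinh b θ i f ω).symm
  rw [e]
  exact integrable_gibX b θ _

lemma integrable_cavRatio_cosh (b θ : ℝ) (i : Fin (n + 1)) (f : Config n → Config n → ℝ) :
    Integrable (cavRatio b θ cosh f) ((pairPi (Fin n × Fin n)).prod (pairPi (Fin n))) := by
  rw [← (measurePreserving_cav i).integrable_comp
    (measurable_cavRatio b θ continuous_cosh f).aestronglyMeasurable]
  have e : cavRatio b θ cosh f ∘ (fun ω => (cavBulk i ω, cavRow i ω)) =
      gibX b θ (fun σ τ => f (dropSpin i σ) (dropSpin i τ)) :=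
    funext fun ω => (gibX_cav_cosh b θ i f ω).symm
  rw [e]
  exact integrable_gibX b θ _

/-- Moments of the overlap without the site `i`, weighted by the spins of the site `i`. -/
def momOdd (n : ℕ) (b θ : ℝ) (i : Fin (n + 1)) (k : ℕ) : ℝ :=
  ∫ ω, gibX b θ (fun σ τ => spin (σ i) * spin (τ i) * ov (dropSpin i σ) (dropSpin i τ) ^ k) ω
    ∂pairPi (Fin (n + 1) × Fin (n + 1))

/-- Moments of the overlap without the site `i`. -/
def momEven (n : ℕ) (b θ : ℝ) (i : Fin (n + 1)) (k : ℕ) : ℝ :=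
  ∫ ω, gibX b θ (fun σ τ => ov (dropSpin i σ) (dropSpin i τ) ^ k) ω
    ∂pairPi (Fin (n + 1) × Fin (n + 1))

/-- The constant of the cavity expansion. -/
def cavK : ℝ := 300 * (28 * fourK) * 4

lemma cavK_pos : 0 < cavK := by have := fourK_pos; unfold cavK; positivity

lemma abs_momOdd_sub_le {b : ℝ} (hb : b ^ 2 * n ≤ 1) (θ : ℝ) (i : Fin (n + 1)) {k : ℕ}
    (hk : Even (k + 3)) :
    |momOdd n b θ i k - (b ^ 2 * cos θ * mom n b θ (k + 1) - b ^ 4 * cos θ * tri n b θ k)| ≤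
      cavK * b ^ 6 * Mom n b (k + 3) := by
  rw [momOdd, mom, tri]
  have hG := integrable_cavRatio_sinh b θ i (fun σ τ : Config n => ov σ τ ^ k)
  have i1 := (integrable_gibX b θ (fun σ τ : Config n => ov σ τ ^ (k + 1))).const_mul
    (b ^ 2 * cos θ)
  have i2 := (integrable_gibT b θ (fun σ τ ρ : Config n => ov σ τ ^ k * ov σ ρ * ov τ ρ)).const_mul
    (b ^ 4 * cos θ)
  have i3 := (integrable_gibS b θ (fun σ τ : Config n => b ^ 6 * |ov σ τ| ^ (k + 3))).const_mul
    (300 * (28 * fourK))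
  have hv : ∀ v, |∫ w, cavRatio b θ sinh (fun σ τ : Config n => ov σ τ ^ k) (v, w) ∂pairPi (Fin n) -
      (b ^ 2 * cos θ * gibX b θ (fun σ τ : Config n => ov σ τ ^ (k + 1)) v -
        b ^ 4 * cos θ * gibT b θ (fun σ τ ρ : Config n => ov σ τ ^ k * ov σ ρ * ov τ ρ) v)| ≤
      300 * (28 * fourK) * gibS b θ (fun σ τ : Config n => b ^ 6 * |ov σ τ| ^ (k + 3)) v := by
    intro v
    have := abs_row_odd_le (P := wX b v) (Q := wY b θ v) θ hb k (wX_nonneg b v) (wY_nonneg b θ v)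
      (sum_wX b v) (sum_wY b θ v)
    simpa only [cavRatio, gibX, gibT, gibS] using this
  have h := abs_integral_cav_sub_le i hG (i1.sub i2) i3 hv
  simp only [← gibX_cav_sinh] at h
  simp only [Pi.sub_apply] at h
  rw [integral_sub i1 i2, integral_const_mul, integral_const_mul, integral_const_mul] at h
  refine LE.le.trans h ?_
  have e : ∀ ω, gibS b θ (fun σ τ : Config n => b ^ 6 * |ov σ τ| ^ (k + 3)) ω =
      b ^ 6 * gibS b θ (fun σ τ : Config n => ov σ τ ^ (k + 3)) ω := fun ω => by
    simp only [gibS, Finset.mul_sum, hk.pow_abs]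
    exact Finset.sum_congr rfl fun σ _ => Finset.sum_congr rfl fun τ _ => by ring
  simp only [e]
  rw [integral_const_mul]
  have hS := integral_gibS_le n b θ (k + 3)
  have hK := fourK_pos
  calc _ ≤ 300 * (28 * fourK) * (b ^ 6 * (4 * Mom n b (k + 3))) := by gcongr
    _ = _ := by rw [cavK]; ring

lemma abs_momEven_sub_le {b : ℝ} (hb : b ^ 2 * n ≤ 1) (θ : ℝ) (i : Fin (n + 1)) {k : ℕ}
    (hk : Even k) :
    |momEven n b θ i k - mom n b θ k| ≤ cavK * b ^ 4 * Mom n b (k + 2) := by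
  rw [momEven, mom]
  have hk2 : Even (k + 2) := hk.add even_two
  have hG := integrable_cavRatio_cosh b θ i (fun σ τ : Config n => ov σ τ ^ k)
  have i3 := (integrable_gibS b θ (fun σ τ : Config n => b ^ 4 * |ov σ τ| ^ (k + 2))).const_mul
    (300 * (28 * fourK))
  have hv : ∀ v, |∫ w, cavRatio b θ cosh (fun σ τ : Config n => ov σ τ ^ k) (v, w) ∂pairPi (Fin n) -
      gibX b θ (fun σ τ : Config n => ov σ τ ^ k) v| ≤
      300 * (28 * fourK) * gibS b θ (fun σ τ : Config n => b ^ 4 * |ov σ τ| ^ (k + 2)) v := by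
    intro v
    have := abs_row_even_le (P := wX b v) (Q := wY b θ v) θ hb hk (wX_nonneg b v) (wY_nonneg b θ v)
      (sum_wX b v) (sum_wY b θ v)
    simpa only [cavRatio, gibX, gibT, gibS] using this
  have h := abs_integral_cav_sub_le i hG (integrable_gibX b θ (fun σ τ : Config n => ov σ τ ^ k))
    i3 hv
  simp only [← gibX_cav_cosh] at h
  rw [integral_const_mul] at h
  refine LE.le.trans h ?_
  have e : ∀ ω, gibS b θ (fun σ τ : Config n => b ^ 4 * |ov σ τ| ^ (k + 2)) ω =
      b ^ 4 * gibS b θ (fun σ τ : Config n => ov σ τ ^ (k + 2)) ω := fun ω => by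
    simp only [gibS, Finset.mul_sum, hk2.pow_abs]
    exact Finset.sum_congr rfl fun σ _ => Finset.sum_congr rfl fun τ _ => by ring
  simp only [e]
  rw [integral_const_mul]
  have hS := integral_gibS_le n b θ (k + 2)
  have hK := fourK_pos
  calc _ ≤ 300 * (28 * fourK) * (b ^ 4 * (4 * Mom n b (k + 2))) := by gcongr
    _ = _ := by rw [cavK]; ring

end CrossMoments

section Relations
variable {n : ℕ}

lemma sum_triangle_nonneg (k : ℕ) (P : Config n → ℝ) {R : Config n → ℝ} (hR : ∀ ρ, 0 ≤ R ρ) :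
    0 ≤ ∑ σ, ∑ τ, ∑ ρ, P σ * P τ * R ρ * (ov σ τ ^ k * ov σ ρ * ov τ ρ) := by
  have e : ∑ σ, ∑ τ, ∑ ρ, P σ * P τ * R ρ * (ov σ τ ^ k * ov σ ρ * ov τ ρ) =
      ∑ ρ, R ρ * ∑ σ, ∑ τ, (P σ * ov σ ρ) * (P τ * ov τ ρ) * ov σ τ ^ k := by
    simp only [Finset.mul_sum]
    rw [Finset.sum_congr rfl fun σ _ => Finset.sum_comm, Finset.sum_comm]
    exact Finset.sum_congr rfl fun σ _ => Finset.sum_congr rfl fun τ _ =>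
      Finset.sum_congr rfl fun ρ _ => by ring
  rw [e]
  exact Finset.sum_nonneg fun ρ _ => mul_nonneg (hR ρ)
    (sum_sum_ov_pow_nonneg k fun σ => P σ * ov σ ρ)

lemma tri_one_nonneg (n : ℕ) (b θ : ℝ) : 0 ≤ tri n b θ 1 := by
  refine integral_nonneg fun ω => ?_
  have h1 := sum_triangle_nonneg 1 (wX b ω) (wY_nonneg b θ ω)
  have h2 := sum_triangle_nonneg 1 (wY b θ ω) (wX_nonneg b ω)
  have e1 : ∑ σ, ∑ τ, ∑ ρ, wX b ω σ * wX b ω τ * wY b θ ω ρ * (ov σ τ ^ 1 * ov σ ρ * ov τ ρ) =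
      ∑ σ, ∑ τ, ∑ ρ, wX b ω σ * wY b θ ω τ * wX b ω ρ * (ov σ τ ^ 1 * ov σ ρ * ov τ ρ) := by
    refine Finset.sum_congr rfl fun σ _ => ?_
    rw [Finset.sum_comm]
    refine Finset.sum_congr rfl fun τ _ => Finset.sum_congr rfl fun ρ _ => ?_
    rw [ov_comm ρ τ]; ring
  have e2 : ∑ σ, ∑ τ, ∑ ρ, wY b θ ω σ * wY b θ ω τ * wX b ω ρ * (ov σ τ ^ 1 * ov σ ρ * ov τ ρ) =
      ∑ σ, ∑ τ, ∑ ρ, wX b ω σ * wY b θ ω τ * wY b θ ω ρ * (ov σ τ ^ 1 * ov σ ρ * ov τ ρ) := by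
    rw [Finset.sum_congr rfl fun σ _ => Finset.sum_comm, Finset.sum_comm]
    refine Finset.sum_congr rfl fun σ _ => Finset.sum_congr rfl fun τ _ =>
      Finset.sum_congr rfl fun ρ _ => ?_
    rw [ov_comm τ σ, ov_comm ρ σ]; ring
  rw [e1] at h1
  rw [e2] at h2
  refine (add_nonneg h1 h2).trans (le_of_eq ?_)
  simp only [gibT, ← Finset.sum_add_distrib]
  exact Finset.sum_congr rfl fun σ _ => Finset.sum_congr rfl fun τ _ =>
    Finset.sum_congr rfl fun ρ _ => by ring

lemma tri_zero_nonneg (n : ℕ) (b : ℝ) (k : ℕ) : 0 ≤ tri n b 0 k := by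
  refine integral_nonneg fun ω => ?_
  have h1 := sum_triangle_nonneg k (wX b ω) (R := fun ρ => wX b ω ρ + wX b ω ρ)
    fun ρ => add_nonneg (wX_nonneg b ω ρ) (wX_nonneg b ω ρ)
  have e : wY b 0 ω = wX b ω := by funext σ; simp only [wX, wY, rotF_zero]
  change 0 ≤ gibT b 0 _ ω
  simpa only [gibT, e] using h1

lemma triangle_le {l : ℝ} (hl : 0 < l) (x y z : ℝ) :
    x ^ 1 * y * z ≤ l / 2 * x ^ 2 + (4 * l)⁻¹ * (y ^ 4 + z ^ 4) := by
  have h1 : x * (y * z) ≤ l / 2 * x ^ 2 + (2 * l)⁻¹ * (y * z) ^ 2 := by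
    have h := sq_nonneg (l * x - y * z)
    have e : l / 2 * x ^ 2 + (2 * l)⁻¹ * (y * z) ^ 2 - x * (y * z) =
        (2 * l)⁻¹ * (l * x - y * z) ^ 2 := by field_simp; ring
    have : 0 ≤ (2 * l)⁻¹ * (l * x - y * z) ^ 2 := by positivity
    linarith
  have h2 : (2 * l)⁻¹ * (y * z) ^ 2 ≤ (4 * l)⁻¹ * (y ^ 4 + z ^ 4) := by
    have e : (4 * l)⁻¹ * (y ^ 4 + z ^ 4) - (2 * l)⁻¹ * (y * z) ^ 2 =
      (4 * l)⁻¹ * (y ^ 2 - z ^ 2) ^ 2 := by field_simp; ring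
    have : 0 ≤ (4 * l)⁻¹ * (y ^ 2 - z ^ 2) ^ 2 := by positivity
    linarith
  calc x ^ 1 * y * z = x * (y * z) := by ring
    _ ≤ _ := by linarith

lemma tri_one_le (n : ℕ) (b θ : ℝ) {l : ℝ} (hl : 0 < l) :
    tri n b θ 1 ≤ l * mom n b θ 2 + l⁻¹ * Mom n b 4 := by
  have i1 := (integrable_gibX b θ (fun σ τ : Config n => ov σ τ ^ 2)).const_mul l
  have i2 := (integrable_gibS b θ (fun σ τ : Config n => ov σ τ ^ 4)).const_mul (4 * l)⁻¹
  have h : tri n b θ 1 ≤ ∫ ω, (l * gibX b θ (fun σ τ : Config n => ov σ τ ^ 2) ω +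
      (4 * l)⁻¹ * gibS b θ (fun σ τ : Config n => ov σ τ ^ 4) ω) ∂pairPi (Fin n × Fin n) := by
    refine integral_mono (integrable_gibT b θ _) (i1.add i2) fun ω => ?_
    have hX := sum_wX b ω
    have hY := sum_wY b θ ω
    set P := wX b ω with hP
    set Q := wY b θ ω with hQ
    have hP0 : ∀ σ, 0 ≤ P σ := wX_nonneg b ω
    have hQ0 : ∀ σ, 0 ≤ Q σ := wY_nonneg b θ ω
    have s1 : gibT b θ (fun σ τ ρ => ov σ τ ^ 1 * ov σ ρ * ov τ ρ) ω ≤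
        ∑ σ, ∑ τ, ∑ ρ, P σ * Q τ * (P ρ + Q ρ) *
          (l / 2 * ov σ τ ^ 2 + (4 * l)⁻¹ * (ov σ ρ ^ 4 + ov τ ρ ^ 4)) := by
      refine Finset.sum_le_sum fun σ _ => Finset.sum_le_sum fun τ _ =>
        Finset.sum_le_sum fun ρ _ => mul_le_mul_of_nonneg_left (triangle_le hl _ _ _) ?_
      have := hP0 σ; have := hQ0 τ; have := hP0 ρ; have := hQ0 ρ
      positivity
    refine s1.trans (le_of_eq ?_)
    have a1 : ∀ c : Config n → Config n → ℝ, ∑ σ, ∑ τ, ∑ ρ, P σ * Q τ * (P ρ + Q ρ) * c σ τ =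
        2 * ∑ σ, ∑ τ, P σ * Q τ * c σ τ := by
      intro c
      simp only [Finset.mul_sum]
      refine Finset.sum_congr rfl fun σ _ => Finset.sum_congr rfl fun τ _ => ?_
      rw [← Finset.sum_mul, ← Finset.mul_sum, Finset.sum_add_distrib, hX, hY]; ring
    have a2 : ∀ c : Config n → Config n → ℝ, ∑ σ, ∑ τ, ∑ ρ, P σ * Q τ * (P ρ + Q ρ) * c σ ρ =
        ∑ σ, ∑ ρ, P σ * (P ρ + Q ρ) * c σ ρ := by
      intro c
      refine Finset.sum_congr rfl fun σ _ => ?_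
      rw [Finset.sum_comm]
      refine Finset.sum_congr rfl fun ρ _ => ?_
      calc ∑ τ, P σ * Q τ * (P ρ + Q ρ) * c σ ρ = ∑ τ, Q τ * (P σ * (P ρ + Q ρ) * c σ ρ) :=
            Finset.sum_congr rfl fun τ _ => by ring
        _ = _ := by rw [← Finset.sum_mul, hY, one_mul]
    have a3 : ∀ c : Config n → Config n → ℝ, ∑ σ, ∑ τ, ∑ ρ, P σ * Q τ * (P ρ + Q ρ) * c τ ρ =
        ∑ τ, ∑ ρ, Q τ * (P ρ + Q ρ) * c τ ρ := by
      intro c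
      rw [Finset.sum_comm]
      refine Finset.sum_congr rfl fun τ _ => ?_
      rw [Finset.sum_comm]
      refine Finset.sum_congr rfl fun ρ _ => ?_
      calc ∑ σ, P σ * Q τ * (P ρ + Q ρ) * c τ ρ = ∑ σ, P σ * (Q τ * (P ρ + Q ρ) * c τ ρ) :=
            Finset.sum_congr rfl fun τ _ => by ring
        _ = _ := by rw [← Finset.sum_mul, hX, one_mul]
    have split : ∑ σ, ∑ τ, ∑ ρ, P σ * Q τ * (P ρ + Q ρ) *
          (l / 2 * ov σ τ ^ 2 + (4 * l)⁻¹ * (ov σ ρ ^ 4 + ov τ ρ ^ 4)) =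
        l / 2 * ∑ σ, ∑ τ, ∑ ρ, P σ * Q τ * (P ρ + Q ρ) * ov σ τ ^ 2 +
        (4 * l)⁻¹ * (∑ σ, ∑ τ, ∑ ρ, P σ * Q τ * (P ρ + Q ρ) * ov σ ρ ^ 4 +
          ∑ σ, ∑ τ, ∑ ρ, P σ * Q τ * (P ρ + Q ρ) * ov τ ρ ^ 4) := by
      simp only [Finset.mul_sum, mul_add, ← Finset.sum_add_distrib]
      exact Finset.sum_congr rfl fun σ _ => Finset.sum_congr rfl fun τ _ =>
        Finset.sum_congr rfl fun ρ _ => by ring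
    have eS : gibS b θ (fun σ τ : Config n => ov σ τ ^ 4) ω =
        ∑ σ, ∑ ρ, P σ * (P ρ + Q ρ) * ov σ ρ ^ 4 + ∑ τ, ∑ ρ, Q τ * (P ρ + Q ρ) * ov τ ρ ^ 4 := by
      simp only [gibS, ← Finset.sum_add_distrib]
      exact Finset.sum_congr rfl fun σ _ => Finset.sum_congr rfl fun τ _ => by ring
    have eX : gibX b θ (fun σ τ : Config n => ov σ τ ^ 2) ω = ∑ σ, ∑ τ, P σ * Q τ * ov σ τ ^ 2 := rfl
    rw [split, a1 fun σ τ => ov σ τ ^ 2, a2 fun σ τ => ov σ τ ^ 4, a3 fun σ τ => ov σ τ ^ 4, eS, eX]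
    ring
  refine h.trans ?_
  rw [integral_add i1 i2, integral_const_mul, integral_const_mul]
  have hS := integral_gibS_le n b θ 4
  have : (4 * l)⁻¹ * ∫ ω, gibS b θ (fun σ τ : Config n => ov σ τ ^ 4) ω ∂pairPi (Fin n × Fin n) ≤
      (4 * l)⁻¹ * (4 * Mom n b 4) := by gcongr
  have e : (4 * l)⁻¹ * (4 * Mom n b 4) = l⁻¹ * Mom n b 4 := by field_simp
  rw [mom]
  linarith

/-- The expectation of a Gibbs average over one replica in each of the two disorders. -/
def EX (b θ : ℝ) (f : Config n → Config n → ℝ) : ℝ :=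
  ∫ ω, gibX b θ f ω ∂pairPi (Fin n × Fin n)

lemma EX_add (b θ : ℝ) (f g : Config n → Config n → ℝ) :
    EX b θ (fun σ τ => f σ τ + g σ τ) = EX b θ f + EX b θ g := by
  rw [EX, EX, EX, ← integral_add (integrable_gibX b θ f) (integrable_gibX b θ g)]
  refine integral_congr_ae (ae_of_all _ fun ω => ?_)
  simp only [gibX, mul_add, Finset.sum_add_distrib]

lemma EX_const_mul (b θ c : ℝ) (f : Config n → Config n → ℝ) :
    EX b θ (fun σ τ => c * f σ τ) = c * EX b θ f := by
  rw [EX, EX, ← integral_const_mul]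
  refine integral_congr_ae (ae_of_all _ fun ω => ?_)
  simp only [gibX, Finset.mul_sum]
  exact Finset.sum_congr rfl fun σ _ => Finset.sum_congr rfl fun τ _ => by ring

lemma EX_const (b θ c : ℝ) : EX (n := n) b θ (fun _ _ => c) = c := by
  have e : ∀ ω, gibX (n := n) b θ (fun _ _ => c) ω = c := fun ω => by
    simp only [gibX, ← Finset.sum_mul, ← Finset.mul_sum, sum_wX, sum_wY, one_mul]
  simp only [EX, e, integral_const, probReal_univ, smul_eq_mul, one_mul]

lemma EX_sum {J : Type*} [Fintype J] (b θ : ℝ) (f : J → Config n → Config n → ℝ) :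
    EX b θ (fun σ τ => ∑ j, f j σ τ) = ∑ j, EX b θ (f j) := by
  simp only [EX]
  rw [← integral_finsetSum _ fun j _ => integrable_gibX b θ (f j)]
  refine integral_congr_ae (ae_of_all _ fun ω => ?_)
  simp only [gibX, Finset.mul_sum]
  rw [Finset.sum_congr rfl fun σ _ => Finset.sum_comm, Finset.sum_comm]

lemma EX_nonneg (b θ : ℝ) {f : Config n → Config n → ℝ} (hf : ∀ σ τ, 0 ≤ f σ τ) : 0 ≤ EX b θ f :=
  integral_nonneg fun ω => Finset.sum_nonneg fun σ _ => Finset.sum_nonneg fun τ _ =>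
    mul_nonneg (mul_nonneg (wX_nonneg b ω σ) (wY_nonneg b θ ω τ)) (hf σ τ)

lemma mom_even_nonneg (n : ℕ) (b θ : ℝ) {k : ℕ} (hk : Even k) : 0 ≤ mom n b θ k :=
  EX_nonneg b θ fun _ _ => hk.pow_nonneg _

lemma abs_average_sub_le {N : ℕ} (hN : 0 < N) {a : Fin N → ℝ} {c E : ℝ} (h : ∀ i, |a i - c| ≤ E) :
    |(∑ i, a i) / N - c| ≤ E := by
  have hN' : (0 : ℝ) < N := by exact_mod_cast hN
  have e : (∑ i, a i) / N - c = (∑ i, (a i - c)) / N := by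
    rw [Finset.sum_sub_distrib]; simp; field_simp
  rw [e, abs_div, abs_of_pos hN', div_le_iff₀ hN']
  refine (Finset.abs_sum_le_sum_abs _ _).trans ((Finset.sum_le_sum fun i _ => h i).trans ?_)
  simp [mul_comm]

lemma mom_two_eq (b θ : ℝ) (i : Fin (n + 1)) :
    mom (n + 1) b θ 2 = 1 + 2 * momOdd n b θ i 1 + momEven n b θ i 2 := by
  have h : mom (n + 1) b θ 2 = EX b θ (fun σ τ : Config (n + 1) => (1 +
      2 * (spin (σ i) * spin (τ i) * ov (dropSpin i σ) (dropSpin i τ) ^ 1)) +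
        ov (dropSpin i σ) (dropSpin i τ) ^ 2) := by
    refine congrArg (EX b θ) (funext fun σ => funext fun τ => ?_)
    rw [ov_eq_dropSpin i σ τ]
    linear_combination spin (τ i) * spin (τ i) * spin_mul_self (σ i) + spin_mul_self (τ i)
  rw [h, EX_add, EX_add, EX_const_mul, EX_const]
  rfl

lemma mom_four_eq (b θ : ℝ) (i : Fin (n + 1)) :
    mom (n + 1) b θ 4 = 1 + 4 * momOdd n b θ i 1 + 6 * momEven n b θ i 2 +
      4 * momOdd n b θ i 3 + momEven n b θ i 4 := by
  have h : mom (n + 1) b θ 4 = EX b θ (fun σ τ : Config (n + 1) => (((1 +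
      4 * (spin (σ i) * spin (τ i) * ov (dropSpin i σ) (dropSpin i τ) ^ 1)) +
        6 * ov (dropSpin i σ) (dropSpin i τ) ^ 2) +
      4 * (spin (σ i) * spin (τ i) * ov (dropSpin i σ) (dropSpin i τ) ^ 3)) +
        ov (dropSpin i σ) (dropSpin i τ) ^ 4) := by
    refine congrArg (EX b θ) (funext fun σ => funext fun τ => ?_)
    rw [ov_eq_dropSpin i σ τ]
    have e : (spin (σ i) * spin (τ i)) ^ 2 = 1 := by
      linear_combination spin (τ i) * spin (τ i) * spin_mul_self (σ i) + spin_mul_self (τ i)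
    generalize spin (σ i) * spin (τ i) = s at e ⊢
    generalize ov (dropSpin i σ) (dropSpin i τ) = r
    linear_combination (s ^ 2 + 1 + 4 * s * r + 6 * r ^ 2) * e
  rw [h, EX_add, EX_add, EX_add, EX_add, EX_const_mul, EX_const_mul, EX_const_mul, EX_const]
  rfl

lemma mom_two_eq_sum (b θ : ℝ) :
    mom (n + 1) b θ 2 = ∑ i, (1 + momOdd n b θ i 1) := by
  have h : mom (n + 1) b θ 2 = EX b θ (fun σ τ : Config (n + 1) => ∑ i, (1 +
      spin (σ i) * spin (τ i) * ov (dropSpin i σ) (dropSpin i τ) ^ 1)) := by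
    refine congrArg (EX b θ) (funext fun σ => funext fun τ => ?_)
    rw [sq]
    conv_lhs => enter [1]; rw [ov]
    rw [Finset.sum_mul]
    refine Finset.sum_congr rfl fun i _ => ?_
    rw [ov_eq_dropSpin i σ τ]
    linear_combination spin (τ i) * spin (τ i) * spin_mul_self (σ i) + spin_mul_self (τ i)
  rw [h, EX_sum]
  refine Finset.sum_congr rfl fun i _ => ?_
  rw [EX_add, EX_const]
  rfl

lemma mom_four_eq_sum (b θ : ℝ) :
    mom (n + 1) b θ 4 = ∑ i, (1 + 3 * momOdd n b θ i 1 + 3 * momEven n b θ i 2 +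
      momOdd n b θ i 3) := by
  have h : mom (n + 1) b θ 4 = EX b θ (fun σ τ : Config (n + 1) => ∑ i, (((1 +
      3 * (spin (σ i) * spin (τ i) * ov (dropSpin i σ) (dropSpin i τ) ^ 1)) +
      3 * ov (dropSpin i σ) (dropSpin i τ) ^ 2) +
      spin (σ i) * spin (τ i) * ov (dropSpin i σ) (dropSpin i τ) ^ 3)) := by
    refine congrArg (EX b θ) (funext fun σ => funext fun τ => ?_)
    rw [pow_succ']
    conv_lhs => enter [1]; rw [ov]
    rw [Finset.sum_mul]
    refine Finset.sum_congr rfl fun i _ => ?_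
    rw [ov_eq_dropSpin i σ τ]
    have e : (spin (σ i) * spin (τ i)) ^ 2 = 1 := by
      linear_combination spin (τ i) * spin (τ i) * spin_mul_self (σ i) + spin_mul_self (τ i)
    generalize spin (σ i) * spin (τ i) = s at e ⊢
    generalize ov (dropSpin i σ) (dropSpin i τ) = r
    linear_combination (s ^ 2 + 1 + 3 * s * r + 3 * r ^ 2) * e
  rw [h, EX_sum]
  refine Finset.sum_congr rfl fun i _ => ?_
  rw [EX_add, EX_add, EX_add, EX_const_mul, EX_const_mul, EX_const]
  rfl

lemma exists_cavity_relations {b : ℝ} (hb : b ^ 2 * n ≤ 1) (θ : ℝ) :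
    ∃ J₁ E₂ J₃ E₄ : ℝ, 0 ≤ E₂ ∧ mom (n + 1) b θ 2 = (n + 1) * (1 + J₁) ∧
      mom (n + 1) b θ 2 = 1 + 2 * J₁ + E₂ ∧
      mom (n + 1) b θ 4 = (n + 1) * (1 + 3 * J₁ + 3 * E₂ + J₃) ∧
      mom (n + 1) b θ 4 = 1 + 4 * J₁ + 6 * E₂ + 4 * J₃ + E₄ ∧
      |J₁ - (b ^ 2 * cos θ * mom n b θ 2 - b ^ 4 * cos θ * tri n b θ 1)| ≤
        cavK * b ^ 6 * Mom n b 4 ∧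
      |E₂ - mom n b θ 2| ≤ cavK * b ^ 4 * Mom n b 4 ∧
      |J₃ - (b ^ 2 * cos θ * mom n b θ 4 - b ^ 4 * cos θ * tri n b θ 3)| ≤
        cavK * b ^ 6 * Mom n b 6 ∧
      |E₄ - mom n b θ 4| ≤ cavK * b ^ 4 * Mom n b 6 := by
  have hN : (0 : ℝ) < ((n + 1 : ℕ) : ℝ) := by positivity
  have hcast : (n : ℝ) + 1 = ((n + 1 : ℕ) : ℝ) := by push_cast; ring
  have avg : ∀ c : ℝ, c = (∑ _i : Fin (n + 1), c) / ((n + 1 : ℕ) : ℝ) := fun c => by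
    simp; field_simp
  refine ⟨(∑ i, momOdd n b θ i 1) / ((n + 1 : ℕ) : ℝ), (∑ i, momEven n b θ i 2) / ((n + 1 : ℕ) : ℝ),
    (∑ i, momOdd n b θ i 3) / ((n + 1 : ℕ) : ℝ), (∑ i, momEven n b θ i 4) / ((n + 1 : ℕ) : ℝ),
    ?_, ?_, ?_, ?_, ?_, ?_, ?_, ?_, ?_⟩
  · exact div_nonneg (Finset.sum_nonneg fun i _ => EX_nonneg b θ fun _ _ => sq_nonneg _) hN.le
  · rw [mom_two_eq_sum, hcast, Finset.sum_add_distrib]; simp; field_simp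
  · rw [avg (mom (n + 1) b θ 2), Finset.sum_congr rfl fun i _ => mom_two_eq b θ i]
    simp only [Finset.sum_add_distrib, ← Finset.mul_sum]; simp; field_simp
  · rw [mom_four_eq_sum, hcast]
    simp only [Finset.sum_add_distrib, ← Finset.mul_sum]; simp; field_simp
  · rw [avg (mom (n + 1) b θ 4), Finset.sum_congr rfl fun i _ => mom_four_eq b θ i]
    simp only [Finset.sum_add_distrib, ← Finset.mul_sum]; simp; field_simp
  · exact abs_average_sub_le n.succ_pos fun i => abs_momOdd_sub_le hb θ i (k := 1) (by decide)
  · exact abs_average_sub_le n.succ_pos fun i => abs_momEven_sub_le hb θ i (k := 2) (by decide)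
  · exact abs_average_sub_le n.succ_pos fun i => abs_momOdd_sub_le hb θ i (k := 3) (by decide)
  · exact abs_average_sub_le n.succ_pos fun i => abs_momEven_sub_le hb θ i (k := 4) (by decide)

end Relations

section Scalar

lemma second_moment_upper {N a t x y J E T m K : ℝ} (hN : 0 < N) (ha : 0 ≤ a) (haN : a * N ≤ 1)
    (ht0 : 0 ≤ t) (ht1 : t ≤ 1) (hx0 : 0 ≤ x) (hT : 0 ≤ T) (hm : 0 ≤ m) (hK : 0 ≤ K)
    (hx : x = N * (1 + J)) (hxE : x = 1 + 2 * J + E)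
    (hJ : J ≤ a * t * y - a ^ 2 * t * T + K * a * m) (hy : y ≤ E + K * m) :
    y ≤ x + 1 + K * m ∧ (1 - a * N * t) * x ≤ N + 1 + 2 * K * m := by
  have hJ1 : -1 ≤ J := by
    by_contra! h
    have : N * (1 + J) < 0 := mul_neg_of_pos_of_neg hN (by linarith)
    linarith
  have hy2 : y ≤ x + 1 + K * m := by linarith
  refine ⟨hy2, ?_⟩
  have hKm : 0 ≤ K * m := mul_nonneg hK hm
  have hT' : 0 ≤ N * (a ^ 2 * t * T) := by positivity
  have hs0 : 0 ≤ a * N := by positivity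
  have hst : a * N * t ≤ 1 := mul_le_one₀ haN ht0 ht1
  have hst0 : 0 ≤ a * N * t := by positivity
  have h1 : x ≤ N + a * N * t * y + a * N * (K * m) := by
    have := mul_le_mul_of_nonneg_left hJ hN.le
    nlinarith
  have h2 : a * N * t * y ≤ a * N * t * (x + 1 + K * m) := mul_le_mul_of_nonneg_left hy2 hst0
  have h3 : a * N * t * (1 + K * m) ≤ 1 * (1 + K * m) :=
    mul_le_mul_of_nonneg_right hst (by positivity)
  have h4 : a * N * (K * m) ≤ 1 * (K * m) := mul_le_mul_of_nonneg_right haN hKm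
  nlinarith

lemma second_moment_lower {N a t x y J E T m K : ℝ} (hN : 0 < N) (ha : 0 ≤ a) (haN : a * N ≤ 1)
    (ht0 : 0 ≤ t) (ht1 : t ≤ 1) (hx0 : 0 ≤ x) (hT : 0 ≤ T) (hm : 0 ≤ m) (hK : 0 ≤ K)
    (hx : x = N * (1 + J)) (hxE : x = 1 + 2 * J + E)
    (hJ : a * t * y - a ^ 2 * t * T - K * a * m ≤ J) (hy : E - K * m ≤ y) :
    N - (2 * (x / N) + 2 * K * m + a * T) ≤ (1 - a * N * t) * x := by
  have hJx : J = x / N - 1 := by rw [hx]; field_simp; ring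
  have hxN : 0 ≤ x / N := by positivity
  have hKm : 0 ≤ K * m := mul_nonneg hK hm
  have hs0 : 0 ≤ a * N := by positivity
  have hst : a * N * t ≤ 1 := mul_le_one₀ haN ht0 ht1
  have hst0 : 0 ≤ a * N * t := by positivity
  have hy2 : x - 2 * (x / N) + 1 - K * m ≤ y := by linarith
  have h1 : N + a * N * t * y - a * N * t * (a * T) - a * N * (K * m) ≤ x := by
    have := mul_le_mul_of_nonneg_left hJ hN.le
    nlinarith
  have h2 : a * N * t * (x - 2 * (x / N) + 1 - K * m) ≤ a * N * t * y :=
    mul_le_mul_of_nonneg_left hy2 hst0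
  have h3 : a * N * t * (2 * (x / N) + K * m + a * T) ≤ 1 * (2 * (x / N) + K * m + a * T) :=
    mul_le_mul_of_nonneg_right hst (by positivity)
  have h4 : a * N * (K * m) ≤ 1 * (K * m) := mul_le_mul_of_nonneg_right haN hKm
  nlinarith

lemma second_moment_closed {N s ε x y m K d : ℝ} (hN : 1 ≤ N) (hε : 0 < ε) (hε1 : ε ≤ 1)
    (hs : s ≤ 1 - ε) (hx0 : 0 ≤ x) (hy0 : 0 ≤ y) (hK : 0 ≤ K) (hd : 0 ≤ d) (hKd : K * d ≤ 1 / 8)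
    (hy : y ≤ x + 1 + K * m) (hx : (1 - s) * x ≤ N + 1 + 2 * K * m) (hm : m ≤ d * ε * y + 1) :
    x ≤ (5 + 5 * K) * (N / ε) := by
  have h1 : K * m ≤ K * d * ε * y + K := by nlinarith
  have h2 : K * d * ε * y ≤ 1 / 8 * (ε * y) := by nlinarith [mul_nonneg hε.le hy0]
  have h3 : ε * y ≤ y := by nlinarith
  have h4 : y ≤ 2 * (x + 1 + K) := by nlinarith
  have h5 : ε * x ≤ (1 - s) * x := by nlinarith
  have h6 : ε * y ≤ 2 * (ε * x) + 2 + 2 * K := by nlinarith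
  have h7 : ε * x ≤ (5 + 5 * K) * N := by nlinarith
  rw [mul_div_assoc', le_div_iff₀ hε]
  linarith

lemma fourth_moment_closed {N a ε x z w J E J3 E4 m K d : ℝ} (hN : 1 ≤ N) (ha : 0 ≤ a)
    (hε : 0 < ε) (hε1 : ε ≤ 1) (hs : a * N ≤ 1 - ε) (hx0 : 0 ≤ x) (hz0 : 0 ≤ z) (hw0 : 0 ≤ w)
    (hK : 0 ≤ K) (hd : 0 ≤ d) (hm0 : 0 ≤ m) (hKd : K * d ≤ 1 / 8)
    (hx : x = N * (1 + J)) (hxE : x = 1 + 2 * J + E)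
    (hz : z = N * (1 + 3 * J + 3 * E + J3)) (hzE : z = 1 + 4 * J + 6 * E + 4 * J3 + E4)
    (hJ3 : J3 ≤ a * w + K * a * m) (hw : w ≤ E4 + K * m) (hm : m ≤ d * ε * w + 1) :
    w ≤ 2 * (z + 9 + 14 * x + K) ∧ ε * z ≤ (100 + 10 * K) * (N * (x + 1)) := by
  have hJ1 : -1 ≤ J := by
    by_contra! h
    have : N * (1 + J) < 0 := mul_neg_of_pos_of_neg (by linarith) (by linarith)
    linarith
  have hJx : J ≤ x := by nlinarith
  have hE : E ≤ x + 1 := by linarith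
  have hEJ : 4 * J3 ≥ - (4 + 12 * J + 12 * E) := by
    have : 0 ≤ 1 + 3 * J + 3 * E + J3 := by
      by_contra! h
      have : N * (1 + 3 * J + 3 * E + J3) < 0 := mul_neg_of_pos_of_neg (by linarith) h
      linarith
    linarith
  have hw1 : w ≤ z + 9 + 14 * x + K * m := by linarith
  have h1 : K * m ≤ K * d * ε * w + K := by nlinarith
  have h2 : K * d * ε * w ≤ 1 / 8 * (ε * w) := by nlinarith [mul_nonneg hε.le hw0]
  have h3 : ε * w ≤ w := by nlinarith
  have h4 : w ≤ 2 * (z + 9 + 14 * x + K) := by nlinarith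
  refine ⟨h4, ?_⟩
  have haN0 : 0 ≤ a * N := by positivity
  have hKm : 0 ≤ K * m := by positivity
  have hNJ : N * J ≤ x := by nlinarith
  have h5 : z ≤ N * (4 + 3 * x) + 3 * x + a * N * w + a * N * (K * m) := by
    have e1 := mul_le_mul_of_nonneg_left hJ3 (by linarith : (0 : ℝ) ≤ N)
    have e2 := mul_le_mul_of_nonneg_left hE (by linarith : (0 : ℝ) ≤ N)
    nlinarith
  have h6 : a * N * w ≤ a * N * (z + 9 + 14 * x + K * m) := mul_le_mul_of_nonneg_left hw1 haN0
  have h7 : a * N * (z + 9 + 14 * x + 2 * (K * m)) ≤ (1 - ε) * z + (9 + 14 * x + 2 * (K * m)) := by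
    have e1 := mul_le_mul_of_nonneg_right hs hz0
    have e2 := mul_le_mul_of_nonneg_right (hs.trans (by linarith : 1 - ε ≤ 1))
      (by positivity : 0 ≤ 9 + 14 * x + 2 * (K * m))
    nlinarith
  have h8 : ε * z ≤ N * (4 + 3 * x) + 17 * x + 9 + 2 * (K * m) := by linarith
  have h9 : ε * w ≤ 2 * (ε * z) + 2 * (9 + 14 * x + K) := by
    have e1 := mul_le_mul_of_nonneg_left h4 hε.le
    have e2 : ε * (9 + 14 * x + K) ≤ 1 * (9 + 14 * x + K) :=
      mul_le_mul_of_nonneg_right hε1 (by positivity)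
    linarith
  have h10 : ε * z ≤ 2 * (N * (4 + 3 * x) + 17 * x + 9 + 2 * K + 9 + 14 * x + K) := by linarith
  have h11 : x ≤ N * x := le_mul_of_one_le_left hx0 hN
  have h12 : K ≤ K * (N * (x + 1)) := le_mul_of_one_le_right hK (by linarith)
  linarith

end Scalar

section Assembly

lemma exists_Mom_four_le {κ : ℝ} (hκ : 0 < κ) : ∃ C : ℝ, 0 < C ∧ ∃ n₀ : ℕ, 1 ≤ n₀ ∧ ∀ n, n₀ ≤ n →
    ∀ b ε : ℝ, 0 < ε → ε ≤ 1 → b ^ 2 * (n + 1) ≤ 1 - ε → κ ≤ n * ε ^ 3 →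
    Mom n b 4 ≤ C * ((n + 1) ^ 2 / ε ^ 2) := by
  have hK := cavK_pos
  set K := cavK
  obtain ⟨n₀, hn₀⟩ := exists_Mom_descent (δ := 1 / (8 * K)) (by positivity) hκ
  refine ⟨2 * ((100 + 10 * K) * (6 + 5 * K) + 9 + 14 * (5 + 5 * K) + K), by positivity, max n₀ 1,
    le_max_right _ _, fun n hn b ε hε hε1 hb hκn => ?_⟩
  have hn1 : (1 : ℝ) ≤ n := by exact_mod_cast (le_max_right _ _).trans hn
  have hb2 := sq_nonneg b
  have hbn : b ^ 2 * n ≤ 1 - ε := by nlinarith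
  have hb1 : b ^ 2 ≤ 1 := by nlinarith
  obtain ⟨d4, d6⟩ := hn₀ n ((le_max_left _ _).trans hn) b ε hε hε1 hbn hκn
  obtain ⟨J, E, J3, E4, hE0, hx, hxE, hz, hzE, hJ, hE, hJ3, hE4⟩ :=
    exists_cavity_relations (n := n) (b := b) (hbn.trans (by linarith)) 0
  have hT1 := tri_zero_nonneg n b 1
  have hT3 := tri_zero_nonneg n b 3
  rw [mom_zero n, Real.cos_zero] at hJ hJ3
  rw [mom_zero n] at hE hE4
  have M2 : 0 ≤ Mom n b 2 := Mom_even_nonneg n b 1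
  have M4 : 0 ≤ Mom n b 4 := Mom_even_nonneg n b 2
  have M6 : 0 ≤ Mom n b 6 := Mom_even_nonneg n b 3
  have hx0 : 0 ≤ mom (n + 1) b 0 2 := mom_even_nonneg _ _ _ (by decide)
  have hz0 : 0 ≤ mom (n + 1) b 0 4 := mom_even_nonneg _ _ _ (by decide)
  set x := mom (n + 1) b 0 2
  set z := mom (n + 1) b 0 4
  have hKd : K * (1 / (8 * K)) ≤ 1 / 8 := le_of_eq (by field_simp)
  have hbn1 : b ^ 4 * (n : ℝ) ^ 2 ≤ 1 := by
    have h0 : 0 ≤ b ^ 2 * n := by positivity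
    have := pow_le_one₀ (n := 2) h0 (hbn.trans (by linarith))
    calc b ^ 4 * (n : ℝ) ^ 2 = (b ^ 2 * n) ^ 2 := by ring
      _ ≤ 1 := this
  have hb4 : b ^ 4 ≤ 1 := by
    calc b ^ 4 = (b ^ 2) ^ 2 := by ring
      _ ≤ 1 := pow_le_one₀ hb2 hb1
  have hdesc : ∀ A B : ℝ, 0 ≤ B → A ≤ 1 / (8 * K) * ε * n ^ 2 * B + 1 →
      b ^ 4 * A ≤ 1 / (8 * K) * ε * B + 1 := by
    intro A B hB hA
    have h1 : b ^ 4 * A ≤ b ^ 4 * (1 / (8 * K) * ε * n ^ 2 * B + 1) :=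
      mul_le_mul_of_nonneg_left hA (by positivity)
    have h2 : (1 / (8 * K) * ε * B) * (b ^ 4 * n ^ 2) ≤ (1 / (8 * K) * ε * B) * 1 :=
      mul_le_mul_of_nonneg_left hbn1 (by positivity)
    linarith
  have m4 := hdesc _ _ M2 d4
  have m6 := hdesc _ _ M4 d6
  have hN : (1 : ℝ) ≤ n + 1 := by linarith
  obtain ⟨u1, u2⟩ := second_moment_upper (N := n + 1) (a := b ^ 2) (t := 1) (x := x)
    (y := Mom n b 2) (J := J) (E := E) (T := tri n b 0 1) (m := b ^ 4 * Mom n b 4) (K := K)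
    (by linarith) hb2 (hb.trans (by linarith)) zero_le_one le_rfl hx0 hT1 (by positivity) hK.le
    hx hxE (by have := (abs_le.1 hJ).2; linarith) (by have := (abs_le.1 hE).1; linarith)
  rw [mul_one] at u2
  have hxb := second_moment_closed hN hε hε1 hb hx0 M2 hK.le (by positivity) hKd u1 u2 m4
  obtain ⟨v1, v2⟩ := fourth_moment_closed (N := n + 1) (a := b ^ 2) (x := x) (z := z)
    (w := Mom n b 4) (J := J) (E := E) (J3 := J3) (E4 := E4) (m := b ^ 4 * Mom n b 6) (K := K)
    (d := 1 / (8 * K)) hN hb2 hε hε1 hb hx0 hz0 M4 hK.le (by positivity) (by positivity) hKd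
    hx hxE hz hzE (by have := (abs_le.1 hJ3).2; have : 0 ≤ b ^ 4 * tri n b 0 3 := by positivity
                      linarith) (by have := (abs_le.1 hE4).1; linarith) m6
  have hNe : 1 ≤ (n + 1) / ε := by rw [le_div_iff₀ hε]; linarith
  set R := (n + 1) / ε with hR
  have hR2 : ((n : ℝ) + 1) ^ 2 / ε ^ 2 = R ^ 2 := by rw [hR, div_pow]
  have hRR : R ≤ R ^ 2 := by nlinarith
  rw [hR2]
  have hz2 : z ≤ (100 + 10 * K) * (6 + 5 * K) * R ^ 2 := by
    have h1 : z ≤ (100 + 10 * K) * (R * (x + 1)) := by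
      have e : (100 + 10 * K) * (R * (x + 1)) = (100 + 10 * K) * ((n + 1) * (x + 1)) / ε := by
        rw [hR]; ring
      rw [e, le_div_iff₀ hε]; linarith
    have h2 : x + 1 ≤ (6 + 5 * K) * R := by linarith
    calc z ≤ (100 + 10 * K) * (R * (x + 1)) := h1
      _ ≤ (100 + 10 * K) * (R * ((6 + 5 * K) * R)) := by gcongr
      _ = _ := by ring
  have hx2 : x ≤ (5 + 5 * K) * R ^ 2 := hxb.trans (mul_le_mul_of_nonneg_left hRR (by positivity))
  have hKR : K ≤ K * R ^ 2 := le_mul_of_one_le_right hK.le (by linarith)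
  linarith

lemma second_moment_window {N a ε c C K d x y T m M : ℝ} (hN : 1 ≤ N) (ha : 0 ≤ a)
    (haN : a * N ≤ 1) (hε : 0 < ε) (hεd : ε ≤ d) (hd1 : d ≤ 1) (hC : 0 ≤ C) (hK : 0 ≤ K)
    (hc0 : 0 ≤ c) (hx0 : 0 ≤ x) (hq : 1 / ε ^ 2 ≤ c * N) (hm : m ≤ C * (1 / ε ^ 2))
    (hM : a * M ≤ C * (N * (1 / ε ^ 2))) (hy : y ≤ x + 1 + K * m)
    (hup : d * x ≤ N + 1 + 2 * K * m)
    (hlow : N - (2 * (x / N) + 2 * K * m + a * T) ≤ d * x)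
    (hT0 : 0 ≤ T) (hT : ∀ l, 0 < l → T ≤ l * y + l⁻¹ * M) :
    |x / N - 1 / d| ≤ (12 + 12 * K * C * c + 2 * K * C + C) *
      (1 / (N * ε ^ 2 * d) + 1 / (√N * ε * (d * √d))) := by
  have hd : 0 < d := hε.trans_le hεd
  have hN0 : 0 < N := by linarith
  have hr : 0 < √N := Real.sqrt_pos.2 hN0
  have hp : 0 < √d := Real.sqrt_pos.2 hd
  have hrr : √N * √N = N := Real.mul_self_sqrt hN0.le
  have hpp : √d * √d = d := Real.mul_self_sqrt hd.le
  set r := √N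
  set p := √d
  have hq1 : 1 ≤ 1 / ε ^ 2 := by
    rw [le_div_iff₀ (by positivity), one_mul]; exact pow_le_one₀ hε.le (hεd.trans hd1)
  have hdq : 1 / d ≤ 1 / ε ^ 2 := by
    refine one_div_le_one_div_of_le (by positivity) ?_
    nlinarith
  set q := 1 / ε ^ 2 with hqdef
  have hKm : K * m ≤ K * C * q := by nlinarith
  have hKm2 : K * m ≤ K * C * c * N := by
    have : K * C * q ≤ K * C * (c * N) := mul_le_mul_of_nonneg_left hq (by positivity)
    linarith
  have hdx : d * x ≤ (2 + 2 * K * C * c) * N := by linarith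
  have hdy : d * y ≤ (4 + 3 * K * C * c) * N := by
    have h1 : d * y ≤ d * (x + 1 + K * C * c * N) :=
      mul_le_mul_of_nonneg_left (by linarith) hd.le
    have h2 : d * (1 + K * C * c * N) ≤ 1 * (1 + K * C * c * N) :=
      mul_le_mul_of_nonneg_right hd1 (by positivity)
    linarith
  have hay : a * y ≤ (4 + 3 * K * C * c) / d := by
    rw [le_div_iff₀ hd]
    have h1 : a * (d * y) ≤ a * ((4 + 3 * K * C * c) * N) := mul_le_mul_of_nonneg_left hdy ha
    have h2 : (4 + 3 * K * C * c) * (a * N) ≤ (4 + 3 * K * C * c) * 1 :=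
      mul_le_mul_of_nonneg_left haN (by positivity)
    linarith
  have hl : 0 < r * p / ε := by positivity
  have haT : a * T ≤ (4 + 3 * K * C * c + C) * (r / (ε * p)) := by
    have h1 := mul_le_mul_of_nonneg_left (hT _ hl) ha
    have h2 : r * p / ε * (a * y) ≤ r * p / ε * ((4 + 3 * K * C * c) / d) :=
      mul_le_mul_of_nonneg_left hay hl.le
    have h3 : (r * p / ε)⁻¹ * (a * M) ≤ (r * p / ε)⁻¹ * (C * (N * q)) :=
      mul_le_mul_of_nonneg_left hM (by positivity)
    have e2 : r * p / ε * ((4 + 3 * K * C * c) / d) = (4 + 3 * K * C * c) * (r / (ε * p)) := by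
      rw [← hpp]; field_simp
    have e3 : (r * p / ε)⁻¹ * (C * (N * q)) = C * (r / (ε * p)) := by
      rw [hqdef, ← hrr]; field_simp
    linarith
  have hxN : x / N ≤ (2 + 2 * K * C * c) * q := by
    have h1 : x / N ≤ (2 + 2 * K * C * c) * (1 / d) := by
      rw [div_le_iff₀ hN0, mul_one_div, div_mul_eq_mul_div, le_div_iff₀ hd]; linarith
    exact h1.trans (mul_le_mul_of_nonneg_left hdq (by positivity))
  have haT0 : 0 ≤ a * T := by positivity
  have hw0 : 0 ≤ r / (ε * p) := by positivity
  have hmain : |d * x - N| ≤ (12 + 12 * K * C * c + 2 * K * C + C) * (q + r / (ε * p)) := by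
    have e1 : 0 ≤ K * C * c := by positivity
    have e2 : 0 ≤ K * C := by positivity
    have b1 : 2 * (x / N) + 1 + 2 * K * m + a * T ≤
        (5 + 4 * K * C * c + 2 * K * C) * q + (4 + 3 * K * C * c + C) * (r / (ε * p)) := by
      linarith
    have b2 : (5 + 4 * K * C * c + 2 * K * C) * q ≤ (12 + 12 * K * C * c + 2 * K * C + C) * q :=
      mul_le_mul_of_nonneg_right (by linarith) (by linarith)
    have b3 : (4 + 3 * K * C * c + C) * (r / (ε * p)) ≤
        (12 + 12 * K * C * c + 2 * K * C + C) * (r / (ε * p)) :=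
      mul_le_mul_of_nonneg_right (by linarith) hw0
    have hxN0 : 0 ≤ x / N := by positivity
    rw [abs_le]
    constructor <;> linarith
  have e : x / N - 1 / d = (d * x - N) / (N * d) := by field_simp
  rw [e, abs_div, abs_of_pos (by positivity : 0 < N * d), div_le_iff₀ (by positivity)]
  refine hmain.trans (le_of_eq ?_)
  have e' : q + r / (ε * p) = (1 / (N * ε ^ 2 * d) + 1 / (r * ε * (d * p))) * (N * d) := by
    rw [hqdef, ← hrr]
    field_simp
  rw [e']
  ring

lemma exists_second_moment_estimate {κ : ℝ} (hκ : 0 < κ) : ∃ C : ℝ, 0 < C ∧ ∃ n₀ : ℕ, ∀ n, n₀ ≤ n →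
    ∀ b ε θ : ℝ, 0 < ε → ε ≤ 1 → b ^ 2 * (n + 1) ≤ 1 - ε → κ ≤ n * ε ^ 3 → 0 ≤ cos θ →
    |mom (n + 1) b θ 2 / (n + 1) - 1 / (1 - b ^ 2 * (n + 1) * cos θ)| ≤
      C * (1 / ((n + 1) * ε ^ 2 * (1 - b ^ 2 * (n + 1) * cos θ)) +
        1 / (√(n + 1) * ε *
          ((1 - b ^ 2 * (n + 1) * cos θ) * √(1 - b ^ 2 * (n + 1) * cos θ)))) := by
  have hK := cavK_pos
  obtain ⟨C, hC, n₀, hn₀, h4⟩ := exists_Mom_four_le hκ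
  refine ⟨12 + 12 * cavK * C * (1 / κ) + 2 * cavK * C + C, by positivity, n₀,
    fun n hn b ε θ hε hε1 hb hκn ht => ?_⟩
  have hn1 : (1 : ℝ) ≤ n := by exact_mod_cast hn₀.trans hn
  have hb2 := sq_nonneg b
  have ht1 := Real.cos_le_one θ
  have hbn : b ^ 2 * n ≤ 1 - ε := by nlinarith
  have hM := h4 n hn b ε hε hε1 hb hκn
  obtain ⟨J, E, J3, E4, hE0, hx, hxE, -, -, hJ, hE, -, -⟩ :=
    exists_cavity_relations (n := n) (b := b) (hbn.trans (by linarith)) θ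
  have M4 : 0 ≤ Mom n b 4 := Mom_even_nonneg n b 2
  have hx0 : 0 ≤ mom (n + 1) b θ 2 := mom_even_nonneg _ _ _ (by decide)
  have hT := tri_one_nonneg n b θ
  have hN : (1 : ℝ) ≤ n + 1 := by linarith
  have hb1 : b ^ 2 * ((n : ℝ) + 1) ≤ 1 := hb.trans (by linarith)
  have hm0 : 0 ≤ b ^ 4 * Mom n b 4 := by positivity
  obtain ⟨u1, u2⟩ := second_moment_upper (N := n + 1) (a := b ^ 2) (t := cos θ)
    (m := b ^ 4 * Mom n b 4) (K := cavK) (T := tri n b θ 1)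
    (by linarith) hb2 hb1 ht ht1 hx0 hT hm0 hK.le hx hxE
    (by have := (abs_le.1 hJ).2; linarith) (y := mom n b θ 2)
    (by have := (abs_le.1 hE).1; linarith)
  have u3 := second_moment_lower (N := n + 1) (a := b ^ 2) (t := cos θ)
    (m := b ^ 4 * Mom n b 4) (K := cavK) (T := tri n b θ 1)
    (by linarith) hb2 hb1 ht ht1 hx0 hT hm0 hK.le hx hxE
    (by have := (abs_le.1 hJ).1; linarith) (y := mom n b θ 2)
    (by have := (abs_le.1 hE).2; linarith)
  have hs0 : 0 ≤ b ^ 2 * ((n : ℝ) + 1) := by positivity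
  have hst : b ^ 2 * ((n : ℝ) + 1) * cos θ ≤ b ^ 2 * (n + 1) := mul_le_of_le_one_right hs0 ht1
  have hst0 : 0 ≤ b ^ 2 * ((n : ℝ) + 1) * cos θ := by positivity
  have hq : 1 / ε ^ 2 ≤ 1 / κ * (n + 1) := by
    rw [one_div_mul_eq_div, div_le_div_iff₀ (by positivity) hκ]
    have h3 : ε ^ 3 ≤ ε ^ 2 := pow_le_pow_of_le_one hε.le hε1 (by norm_num)
    nlinarith [mul_le_mul_of_nonneg_left h3 (by linarith : (0 : ℝ) ≤ n), sq_nonneg ε]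
  refine second_moment_window (a := b ^ 2) (y := mom n b θ 2) (T := tri n b θ 1)
    (m := b ^ 4 * Mom n b 4) (M := Mom n b 4) hN hb2 hb1 hε (by linarith) (by linarith) hC.le hK.le
    (by positivity) hx0 hq ?_ ?_ u1 u2 u3 hT fun l hl => tri_one_le n b θ hl
  · have h1 : b ^ 4 * Mom n b 4 ≤ b ^ 4 * (C * ((n + 1) ^ 2 / ε ^ 2)) :=
      mul_le_mul_of_nonneg_left hM (by positivity)
    have h2 : (b ^ 2 * ((n : ℝ) + 1)) ^ 2 ≤ 1 := pow_le_one₀ hs0 hb1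
    have h3 : C * (1 / ε ^ 2) * (b ^ 2 * ((n : ℝ) + 1)) ^ 2 ≤ C * (1 / ε ^ 2) * 1 :=
      mul_le_mul_of_nonneg_left h2 (by positivity)
    have e : b ^ 4 * (C * (((n : ℝ) + 1) ^ 2 / ε ^ 2)) =
      C * (1 / ε ^ 2) * (b ^ 2 * ((n : ℝ) + 1)) ^ 2 := by ring
    linarith
  · have h1 : b ^ 2 * Mom n b 4 ≤ b ^ 2 * (C * ((n + 1) ^ 2 / ε ^ 2)) :=
      mul_le_mul_of_nonneg_left hM (by positivity)
    have h3 : C * ((n + 1) * (1 / ε ^ 2)) * (b ^ 2 * ((n : ℝ) + 1)) ≤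
        C * ((n + 1) * (1 / ε ^ 2)) * 1 := mul_le_mul_of_nonneg_left hb1 (by positivity)
    have e : b ^ 2 * (C * (((n : ℝ) + 1) ^ 2 / ε ^ 2)) =
      C * ((n + 1) * (1 / ε ^ 2)) * (b ^ 2 * ((n : ℝ) + 1)) := by ring
    linarith

end Assembly

lemma abs_sub_le_of_abs_deriv_le {f f' B B' : ℝ → ℝ} {s t : ℝ} (hst : s ≤ t)
    (hf : ∀ x ∈ Set.Icc s t, HasDerivAt f (f' x) x)
    (hB : ∀ x ∈ Set.Icc s t, HasDerivAt B (B' x) x)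
    (h : ∀ x ∈ Set.Icc s t, |f' x| ≤ B' x) : |f t - f s| ≤ B t - B s := by
  have := image_norm_le_of_norm_deriv_right_le_deriv_boundary' (f := fun x => f x - f s)
    (f' := f') (B := fun x => B x - B s) (B' := B') (a := s) (b := t)
    (fun x hx => ((hf x hx).continuousAt.sub continuousAt_const).continuousWithinAt)
    (fun x hx => ((hf x ⟨hx.1, hx.2.le⟩).sub_const _).hasDerivWithinAt) (by simp)
    (fun x hx => ((hB x hx).continuousAt.sub continuousAt_const).continuousWithinAt)
    (fun x hx => ((hB x ⟨hx.1, hx.2.le⟩).sub_const _).hasDerivWithinAt)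
    (fun x hx => h x ⟨hx.1, hx.2.le⟩) (x := t) ⟨hst, le_rfl⟩
  exact this

lemma memLp_two_lse {ι S : Type*} [Fintype ι] [Fintype S] [Nonempty S] (a : S → ι → ℝ) :
    MemLp (lse a) 2 (stdPi ι) := by
  have hc : Continuous (lse a) := continuous_lse a
  rw [memLp_two_iff_integrable_sq hc.aestronglyMeasurable]
  refine Integrable.mono' (((integrable_exp_mul_lse a 1).add (integrable_exp_mul_lse a (-1))).const_mul 2)
    (hc.pow 2).aestronglyMeasurable (ae_of_all _ fun g => ?_)
  rw [Real.norm_of_nonneg (sq_nonneg _), Pi.add_apply]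
  have h1 := exp_pos (1 * lse a g)
  have h2 := exp_pos (-1 * lse a g)
  rcases le_total 0 (lse a g) with h | h
  · have := quadratic_le_exp_of_nonneg h
    rw [one_mul] at *
    linarith
  · have := quadratic_le_exp_of_nonneg (neg_nonneg.2 h)
    rw [neg_one_mul] at *
    nlinarith

lemma variance_lse {ι S : Type*} [Fintype ι] [Fintype S] [Nonempty S] (a : S → ι → ℝ) :
    variance (lse a) (stdPi ι) =
      (∫ ω, lse a (fstF ω) * lse a (rotF 0 ω) ∂pairPi ι) -
        ∫ ω, lse a (fstF ω) * lse a (rotF (π / 2) ω) ∂pairPi ι := by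
  have hc : Continuous fun g => lse a g ^ 2 := (continuous_lse a).pow 2
  rw [variance_eq_sub (memLp_two_lse a), integral_fst_mul_rot_half_pi, sq (∫ x, lse a x ∂stdPi ι)]
  have := integral_comp_of_measurePreserving (measurePreserving_fstF (ι := ι))
    hc.aestronglyMeasurable
  simp only [rotF_zero, ← sq, Pi.pow_apply]
  rw [this]

lemma integral_sum_gw_skc (n : ℕ) (b θ : ℝ) :
    ∫ ω, ∑ x, ∑ y, gw (skc n b) (fstF ω) x * gw (skc n b) (rotF θ ω) y *
      ∑ p, skc n b x p * skc n b y p ∂pairPi (Fin n × Fin n) =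
      b ^ 2 / 2 * (mom n b θ 2 - n) := by
  have h : ∀ ω : Fin n × Fin n → ℝ × ℝ, ∑ x, ∑ y, gw (skc n b) (fstF ω) x *
      gw (skc n b) (rotF θ ω) y * ∑ p, skc n b x p * skc n b y p =
      b ^ 2 / 2 * gibX b θ (fun σ τ => ov σ τ ^ 2) ω - b ^ 2 / 2 * n := by
    intro ω
    have h1 : ∑ x, ∑ y, gw (skc n b) (fstF ω) x * gw (skc n b) (rotF θ ω) y = 1 := by
      rw [← Finset.sum_mul_sum, sum_gw, sum_gw, one_mul]
    have h2 : b ^ 2 / 2 * (n : ℝ) = ∑ x, ∑ y, gw (skc n b) (fstF ω) x *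
        gw (skc n b) (rotF θ ω) y * (b ^ 2 / 2 * n) := by
      simp only [← Finset.sum_mul]
      rw [h1, one_mul]
    rw [h2, gibX, Finset.mul_sum, ← Finset.sum_sub_distrib]
    refine Finset.sum_congr rfl fun x _ => ?_
    rw [Finset.mul_sum, ← Finset.sum_sub_distrib]
    refine Finset.sum_congr rfl fun y _ => ?_
    rw [skc_dot, wX, wY]
    ring
  simp only [h]
  rw [integral_sub ((integrable_gibX b θ _).const_mul _) (integrable_const _),
    integral_const_mul, mom]
  simp
  ring

lemma hasDerivAt_interpolation {u θ : ℝ} (h : 0 < 1 - u * cos θ) :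
    HasDerivAt (fun θ => -(1 / 2) * log (1 - u * cos θ) - u / 2 * cos θ)
      (-sin θ * (u / 2 * (1 / (1 - u * cos θ) - 1))) θ := by
  have h1 : HasDerivAt (fun θ => 1 - u * cos θ) (-(u * -sin θ)) θ :=
    ((hasDerivAt_cos θ).const_mul u).const_sub 1
  have h2 := ((h1.log h.ne').const_mul (-(1 / 2))).sub ((hasDerivAt_cos θ).const_mul (u / 2))
  refine h2.congr_deriv ?_
  field_simp
  ring

lemma hasDerivAt_neg_inv_sqrt {u θ : ℝ} (h : 0 < 1 - u * cos θ) :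
    HasDerivAt (fun θ => -(1 / √(1 - u * cos θ)))
      (u * sin θ / (2 * ((1 - u * cos θ) * √(1 - u * cos θ)))) θ := by
  have h1 : HasDerivAt (fun θ => 1 - u * cos θ) (-(u * -sin θ)) θ :=
    ((hasDerivAt_cos θ).const_mul u).const_sub 1
  have hp : 0 < √(1 - u * cos θ) := Real.sqrt_pos.2 h
  have h2 := ((h1.sqrt h.ne').inv hp.ne').neg
  simp only [one_div]
  refine h2.congr_deriv ?_
  rw [Real.sq_sqrt h.le]
  field_simp

lemma exists_variance_estimate {κ : ℝ} (hκ : 0 < κ) : ∃ C : ℝ, 0 < C ∧ ∃ n₀ : ℕ, ∀ n, n₀ ≤ n →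
    ∀ b u ε : ℝ, 0 < ε → 0 ≤ u → b ^ 2 * (n + 1) = u → u = 1 - ε → κ ≤ n * ε ^ 3 →
    |variance (lse (skc (n + 1) b)) (stdPi (Fin (n + 1) × Fin (n + 1))) -
        (-(1 / 2) * log (1 - u) - u / 2)| ≤ C / √((n + 1) * ε ^ 3) := by
  obtain ⟨C, hC, n₀, H⟩ := exists_second_moment_estimate hκ
  refine ⟨C * (1 + 1 / √κ), by positivity, n₀, fun n hn b u ε hε hu hbu huε hκn => ?_⟩
  have hN : (0 : ℝ) < n + 1 := by positivity
  have hε1 : ε ≤ 1 := by linarith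
  have hd : ∀ θ ∈ Set.Icc 0 (π / 2), 0 ≤ cos θ ∧ 0 ≤ sin θ ∧ ε ≤ 1 - u * cos θ := by
    intro θ hθ
    have hc : 0 ≤ cos θ := cos_nonneg_of_mem_Icc ⟨by linarith [hθ.1, pi_pos], hθ.2⟩
    refine ⟨hc, sin_nonneg_of_nonneg_of_le_pi hθ.1 (by linarith [hθ.2, pi_pos]), ?_⟩
    nlinarith [cos_le_one θ]
  set V : ℝ → ℝ := fun θ => ∫ ω, lse (skc (n + 1) b) (fstF ω) * lse (skc (n + 1) b) (rotF θ ω)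
    ∂pairPi (Fin (n + 1) × Fin (n + 1)) with hV
  have hVd : ∀ θ, HasDerivAt V (-sin θ * (u / 2 * (mom (n + 1) b θ 2 / (n + 1) - 1))) θ := by
    intro θ
    have h := hasDerivAt_lse_covariance (skc (n + 1) b) θ
    rw [integral_sum_gw_skc] at h
    convert h using 1
    rw [← hbu]
    push_cast
    field_simp
  have key := abs_sub_le_of_abs_deriv_le (s := 0) (t := π / 2) (by positivity)
    (fun θ hθ => (hVd θ).sub (hasDerivAt_interpolation (u := u) (hε.trans_le (hd θ hθ).2.2)))
    (fun θ hθ => ((hasDerivAt_id θ).const_mul (C / (2 * ((n + 1) * ε ^ 3)))).add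
      ((hasDerivAt_neg_inv_sqrt (u := u) (hε.trans_le (hd θ hθ).2.2)).const_mul
        (C / (√(n + 1) * ε)))) (by
    intro θ hθ
    obtain ⟨hc, hs, hεd⟩ := hd θ hθ
    have h := H n hn b ε θ hε hε1 (by rw [hbu, huε]) hκn hc
    rw [hbu] at h
    set d := 1 - u * cos θ
    have hd0 : 0 < d := hε.trans_le hεd
    have e : -sin θ * (u / 2 * (mom (n + 1) b θ 2 / (n + 1) - 1)) -
        -sin θ * (u / 2 * (1 / d - 1)) =
        -(sin θ * (u / 2)) * (mom (n + 1) b θ 2 / (n + 1) - 1 / d) := by ring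
    rw [e, abs_mul, abs_neg, abs_of_nonneg (by positivity)]
    refine (mul_le_mul_of_nonneg_left h (by positivity)).trans ?_
    have h1 : sin θ * (u / 2) * (C * (1 / ((n + 1) * ε ^ 2 * d))) ≤
        C / (2 * ((n + 1) * ε ^ 3)) := by
      have a1 : sin θ * (u / 2) ≤ 1 / 2 := by nlinarith [sin_le_one θ]
      have a2 : 1 / ((n + 1) * ε ^ 2 * d) ≤ 1 / ((n + 1) * ε ^ 2 * ε) :=
        one_div_le_one_div_of_le (by positivity) (mul_le_mul_of_nonneg_left hεd (by positivity))
      calc sin θ * (u / 2) * (C * (1 / ((n + 1) * ε ^ 2 * d)))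
          ≤ 1 / 2 * (C * (1 / ((n + 1) * ε ^ 2 * ε))) := by gcongr
        _ = C / (2 * ((n + 1) * ε ^ 3)) := by field_simp
    have h2 : sin θ * (u / 2) * (C * (1 / (√(n + 1) * ε * (d * √d)))) =
        C / (√(n + 1) * ε) * (u * sin θ / (2 * (d * √d))) := by
      have := Real.sqrt_pos.2 hd0
      have := Real.sqrt_pos.2 hN
      field_simp
    rw [mul_one]
    linarith)
  have hvar := variance_lse (skc (n + 1) b)
  have e0 : V 0 - V (π / 2) = variance (lse (skc (n + 1) b)) (stdPi (Fin (n + 1) × Fin (n + 1))) :=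
    hvar.symm
  simp only [Pi.sub_apply, Pi.add_apply, cos_zero, cos_pi_div_two, id, mul_zero, mul_one, sub_zero,
    Real.log_one, Real.sqrt_one, zero_add] at key
  rw [← e0, abs_sub_comm]
  have hw : κ ≤ (n + 1) * ε ^ 3 := by nlinarith [pow_pos hε 3]
  have hw0 : 0 < (n + 1) * ε ^ 3 := hκ.trans_le hw
  have h1u : 1 - u = ε := by linarith
  have e1 : √((n + 1) * ε ^ 3) = √(n + 1) * ε * √ε := by
    rw [Real.sqrt_mul hN.le, pow_succ, Real.sqrt_mul (by positivity), Real.sqrt_sq hε.le]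
    ring
  have hsw : 0 < √((n + 1) * ε ^ 3) := Real.sqrt_pos.2 hw0
  have hsκ : 0 < √κ := Real.sqrt_pos.2 hκ
  have e2 : C / (√(n + 1) * ε) * (1 / √ε) = C / √((n + 1) * ε ^ 3) := by
    rw [e1, div_mul_div_comm, mul_one]
  have e3 : C / (2 * ((n + 1) * ε ^ 3)) * (π / 2) ≤ C * (1 / √κ) / √((n + 1) * ε ^ 3) := by
    have a1 : C / (2 * ((n + 1) * ε ^ 3)) * (π / 2) ≤ C / (2 * ((n + 1) * ε ^ 3)) * 2 := by
      gcongr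
      linarith [pi_le_four]
    have a2 : C / (2 * ((n + 1) * ε ^ 3)) * 2 =
        C * (1 / √((n + 1) * ε ^ 3)) / √((n + 1) * ε ^ 3) := by
      rw [mul_one_div, div_div, Real.mul_self_sqrt hw0.le]
      field_simp
    refine a1.trans (a2.le.trans ?_)
    have := Real.sqrt_le_sqrt hw
    gcongr
  have e4 : 0 ≤ C / (√(n + 1) * ε) := by positivity
  have e5 : C * (1 + 1 / √κ) / √((n + 1) * ε ^ 3) =
      C / √((n + 1) * ε ^ 3) + C * (1 / √κ) / √((n + 1) * ε ^ 3) := by ring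
  rw [e5, ← e2]
  rw [h1u] at key ⊢
  refine le_trans (le_of_eq ?_) (key.trans ?_)
  · congr 1
    ring
  · linarith

lemma freeEnergy_eq_lse (N : ℕ) (β : ℝ) : freeEnergy N β = lse (skc N (β / √N)) := by
  funext g
  simp only [freeEnergy, partFun, lse, psum, lin, ham, skc]
  congr 1
  refine Finset.sum_congr rfl fun σ _ => ?_
  rw [Finset.mul_sum, Finset.sum_filter]
  congr 1
  refine Finset.sum_congr rfl fun p _ => ?_
  split_ifs <;> ring

lemma exists_eventually_const_le {u : ℕ → ℝ}
    (h : (∃ c : ℝ, 0 < c ∧ Tendsto u atTop (nhds c)) ∨ Tendsto u atTop atTop) :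
    ∃ k : ℝ, 0 < k ∧ ∀ᶠ n in atTop, k ≤ u n := by
  rcases h with ⟨c, hc, h⟩ | h
  · exact ⟨c / 2, by positivity, h.eventually (eventually_ge_nhds (by linarith))⟩
  · exact ⟨1, one_pos, h.eventually_ge_atTop 1⟩

lemma exists_uniform_of_eventually {f g : ℕ → ℝ} (hg : ∀ n, 1 ≤ n → 0 < g n) {C : ℝ}
    (h : ∀ᶠ n in atTop, f n ≤ C * g n) : ∃ L : ℝ, ∀ n, 1 ≤ n → f n ≤ L * g n := by
  obtain ⟨m, hm⟩ := eventually_atTop.1 h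
  refine ⟨|C| + ∑ k ∈ Finset.range m, |f k / g k|, fun n hn => ?_⟩
  have hgn := hg n hn
  have hs : 0 ≤ ∑ k ∈ Finset.range m, |f k / g k| := Finset.sum_nonneg fun _ _ => abs_nonneg _
  rcases le_or_gt m n with hmn | hmn
  · refine (hm n hmn).trans (mul_le_mul_of_nonneg_right ?_ hgn.le)
    linarith [le_abs_self C]
  · have h1 := Finset.single_le_sum (f := fun k => |f k / g k|) (fun _ _ => abs_nonneg _)
      (Finset.mem_range.2 hmn)
    rw [← div_le_iff₀ hgn]
    linarith [le_abs_self (f n / g n), abs_nonneg C]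

lemma cube_rpow_third_mul {x ε : ℝ} (hx : 0 ≤ x) :
    (x ^ ((1 : ℝ) / 3) * ε) ^ 3 = x * ε ^ 3 := by
  rw [mul_pow, ← Real.rpow_natCast, ← Real.rpow_mul hx]
  norm_num

lemma rpow_neg_three_halves {x ε : ℝ} (hx : 0 ≤ x) (hε : 0 ≤ ε) :
    (x ^ ((1 : ℝ) / 3) * ε) ^ (-(3 : ℝ) / 2) = 1 / √(x * ε ^ 3) := by
  have h0 : 0 ≤ x ^ ((1 : ℝ) / 3) * ε := mul_nonneg (Real.rpow_nonneg hx _) hε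
  rw [← cube_rpow_third_mul hx, Real.sqrt_eq_rpow, one_div (_ ^ _), ← Real.rpow_neg (by positivity),
    ← Real.rpow_natCast, ← Real.rpow_mul h0]
  norm_num

theorem variance_freeEnergy_near_critical
    (β : ℕ → ℝ) (hβmem : ∀ N, β N ∈ Set.Ioo (0 : ℝ) 1)
    (hc : (∃ c : ℝ, 0 < c ∧
        Tendsto (fun N : ℕ => (N : ℝ) ^ ((1 : ℝ) / 3) * (1 - β N ^ 2)) atTop (nhds c)) ∨
      Tendsto (fun N : ℕ => (N : ℝ) ^ ((1 : ℝ) / 3) * (1 - β N ^ 2)) atTop atTop) :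
    ∃ L : ℝ, ∀ N : ℕ, 1 ≤ N →
      |variance (freeEnergy N (β N)) (gaussPi N) - nuSK (β N)| ≤
        L * ((N : ℝ) ^ ((1 : ℝ) / 3) * (1 - β N ^ 2)) ^ (-(3 : ℝ) / 2) := by
  have hε : ∀ N, 0 < 1 - β N ^ 2 := fun N => by
    have := hβmem N
    nlinarith [this.1, this.2]
  obtain ⟨k, hk, hkN⟩ := exists_eventually_const_le hc
  obtain ⟨C, hC, n₀, H⟩ := exists_variance_estimate (κ := k ^ 3 / 2) (by positivity)
  refine exists_uniform_of_eventually (C := C) (fun N hN => ?_) ?_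
  · have hN0 : (0 : ℝ) < N := by exact_mod_cast hN
    exact Real.rpow_pos_of_pos (mul_pos (Real.rpow_pos_of_pos hN0 _) (hε N)) _
  filter_upwards [hkN, eventually_ge_atTop (n₀ + 2)] with N hkN hN
  obtain ⟨n, rfl⟩ : ∃ n, N = n + 1 := ⟨N - 1, by omega⟩
  have hn1 : (1 : ℝ) ≤ n := by exact_mod_cast (by omega : 1 ≤ n)
  have hN0 : (0 : ℝ) < n + 1 := by linarith
  have hε' := hε (n + 1)
  have h3 : k ^ 3 ≤ (n + 1) * (1 - β (n + 1) ^ 2) ^ 3 := by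
    have h := pow_le_pow_left₀ hk.le hkN 3
    rw [cube_rpow_third_mul (by positivity)] at h
    exact_mod_cast h
  have h4 : k ^ 3 / 2 ≤ n * (1 - β (n + 1) ^ 2) ^ 3 := by
    nlinarith [pow_pos hε' 3]
  have h := H n (by omega) (β (n + 1) / √(n + 1)) (β (n + 1) ^ 2) (1 - β (n + 1) ^ 2) hε'
    (sq_nonneg _) (by rw [div_pow, Real.sq_sqrt hN0.le]; field_simp) (by ring) h4
  rw [rpow_neg_three_halves (by positivity) hε'.le, freeEnergy_eq_lse, nuSK, mul_one_div]
  push_cast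
  exact h

end SKVar

/-- Near-critical variance of the SK free energy
(Theorem 1.1, variance part, of Dey–Kang). -/
theorem sk_variance_near_critical
    (β : ℕ → ℝ) (hβmem : ∀ N, β N ∈ Set.Ioo (0 : ℝ) 1)
    (hβlim : Tendsto β atTop (nhds 1))
    (hc : (∃ c : ℝ, 0 < c ∧
        Tendsto (fun N : ℕ => (N : ℝ) ^ ((1 : ℝ) / 3) * (1 - β N ^ 2)) atTop (nhds c)) ∨
      Tendsto (fun N : ℕ => (N : ℝ) ^ ((1 : ℝ) / 3) * (1 - β N ^ 2)) atTop atTop) :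
    ∃ L : ℝ, ∀ N : ℕ, 1 ≤ N →
      |variance (freeEnergy N (β N)) (gaussPi N) - nuSK (β N)| ≤
        L * ((N : ℝ) ^ ((1 : ℝ) / 3) * (1 - β N ^ 2)) ^ (-(3 : ℝ) / 2) := by
  exact SKVar.variance_freeEnergy_near_critical β hβmem hc

end
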